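/- arXiv:2603.22664 — 2 statements merged into one kernel-verified Lean document; each statement's English description precedes it below -/
import Mathlib

section
/- Let μ be a log-concave probability measure on ℝ^n and let f : ℝ^n → ℝ be a polynomial of degree d ≥ 2. Then the following three conditions are quantitatively equivalent, with constants depending only on each other and on d: (1) there is C₁ > 0 with Var_μ(f) ≥ C₁; (2) there is C₂ > 0 with sup_{a ∈ ℝ} μ({x : |f(x) − a| ≤ ε}) ≤ C₂ ε^{1/d} for every ε > 0; (3) there is C₃ > 0 with |∫_{ℝ^n} e^{itf(x)} dμ(x)| ≤ C₃ |t|^{−1/d} for every t ≠ 0. Precisely: (3) implies (2) with C₂ depending only on C₃ and d; (2) implies (1) with C₁ depending only on C₂ and d; and (1) implies (3) with C₃ depending only on C₁ and d. -/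
open MeasureTheory

noncomputable section

/-- Variance of a real function with respect to a measure. -/
def mVar {α : Type*} [MeasurableSpace α] (μ : Measure α) (f : α → ℝ) : ℝ :=
  (∫ x, f x ^ 2 ∂μ) - (∫ x, f x ∂μ) ^ 2

/-- A measure on ℝ^n is log-concave if it has a log-concave density w.r.t. Lebesgue measure. -/
def IsLogConcave {n : ℕ} (μ : Measure (Fin n → ℝ)) : Prop :=
  ∃ ρ : (Fin n → ℝ) → ℝ, (∀ x, 0 ≤ ρ x) ∧
    μ = volume.withDensity (fun x => ENNReal.ofReal (ρ x)) ∧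
    ∀ x y : Fin n → ℝ, ∀ l : ℝ, 0 ≤ l → l ≤ 1 →
      ρ x ^ l * ρ y ^ (1 - l) ≤ ρ (l • x + (1 - l) • y)

section

open Set

/-- A Remez-type inequality: a polynomial bounded on a subset of an interval is bounded on the
interval, with a constant depending on the degree and the proportion of the subset. -/
lemma exists_remez_const (k : ℕ) : ∃ C : ℝ, 0 < C ∧ ∀ p : Polynomial ℝ, p.natDegree ≤ k →
    ∀ (a b m l : ℝ) (E : Set ℝ), E ⊆ Icc a b → 0 < m → ENNReal.ofReal m ≤ volume E → 0 ≤ l →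
      (∀ x ∈ E, |p.eval x| ≤ l) → ∀ x ∈ Icc a b, |p.eval x| ≤ C * ((b - a) / m) ^ k * l := by
  induction k with
  | zero =>
    refine ⟨1, one_pos, fun p hp a b m l E hE hm hv hl hb x hx => ?_⟩
    have hne : E.Nonempty := by
      rw [nonempty_iff_ne_empty]
      rintro rfl
      simp at hv
      linarith
    obtain ⟨y, hy⟩ := hne
    have := hb y hy
    rw [Polynomial.eq_C_of_natDegree_le_zero hp] at this ⊢
    simpa using this
  | succ k ih =>
    obtain ⟨C, hC, h⟩ := ih
    refine ⟨1 + 8 * C * 2 ^ k, by positivity, fun p hp a b m l E hE hm hv hl hb x hx => ?_⟩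
    have hne : E.Nonempty := by
      rw [nonempty_iff_ne_empty]
      rintro rfl
      simp at hv
      linarith
    obtain ⟨y, hy⟩ := hne
    have hab : m ≤ b - a := by
      have h1 := hv.trans (measure_mono hE)
      rw [Real.volume_Icc] at h1
      have hab0 : a ≤ b := (hE hy).1.trans (hE hy).2
      exact (ENNReal.ofReal_le_ofReal_iff (by linarith)).1 h1
    obtain ⟨g, hg⟩ := Polynomial.X_sub_C_dvd_sub_C_eval (a := y) (p := p)
    have hgdeg : g.natDegree ≤ k := by
      rcases eq_or_ne g 0 with rfl | hg0
      · simp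
      · have h1 : (p - Polynomial.C (p.eval y)).natDegree ≤ k + 1 :=
          (Polynomial.natDegree_sub_C).trans_le hp
        rw [hg, Polynomial.natDegree_mul (Polynomial.X_sub_C_ne_zero y) hg0,
          Polynomial.natDegree_X_sub_C] at h1
        omega
    have heval : ∀ z, p.eval z = p.eval y + (z - y) * g.eval z := by
      intro z
      have := congrArg (Polynomial.eval z) hg
      simp at this
      linarith
    have hvol : ENNReal.ofReal (m / 2) ≤ volume (E \ Ioo (y - m / 4) (y + m / 4)) := by
      have h1 : volume E ≤ volume (E \ Ioo (y - m / 4) (y + m / 4))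
          + volume (Ioo (y - m / 4) (y + m / 4)) := by
        refine (measure_mono ?_).trans (measure_union_le _ _)
        intro z hz
        by_cases hz' : z ∈ Ioo (y - m / 4) (y + m / 4)
        · exact Or.inr hz'
        · exact Or.inl ⟨hz, hz'⟩
      rw [Real.volume_Ioo] at h1
      have h2 : ENNReal.ofReal m = ENNReal.ofReal (m / 2) +
          ENNReal.ofReal (y + m / 4 - (y - m / 4)) := by
        rw [← ENNReal.ofReal_add (by linarith) (by linarith)]; congr 1; ring
      rw [h2] at hv
      exact (ENNReal.add_le_add_iff_right ENNReal.ofReal_ne_top).1 (hv.trans h1)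
    have hgb := h g hgdeg a b (m / 2) (8 * l / m) _ (sdiff_subset.trans hE) (by linarith) hvol
      (by positivity) ?_ x hx
    · rw [heval x]
      have hx' : |x - y| ≤ b - a := by
        have := hE hy
        rw [abs_le]; constructor <;> linarith [hx.1, hx.2, this.1, this.2]
      have hr : 1 ≤ (b - a) / m := by rwa [one_le_div hm]
      calc |p.eval y + (x - y) * g.eval x| ≤ |p.eval y| + |x - y| * |g.eval x| := by
            rw [← abs_mul]; exact abs_add_le _ _
        _ ≤ l + (b - a) * (C * ((b - a) / (m / 2)) ^ k * (8 * l / m)) := by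
            refine add_le_add (hb y hy) (mul_le_mul hx' hgb (abs_nonneg _) (by linarith))
        _ = l + 8 * C * 2 ^ k * ((b - a) / m) ^ (k + 1) * l := by
            have : (b - a) / (m / 2) = 2 * ((b - a) / m) := by field_simp
            rw [this, mul_pow, pow_succ]
            field_simp
        _ ≤ ((b - a) / m) ^ (k + 1) * l + 8 * C * 2 ^ k * ((b - a) / m) ^ (k + 1) * l := by
            gcongr
            exact le_mul_of_one_le_left hl (one_le_pow₀ hr)
        _ = _ := by ring
    · intro z hz
      have h1 : m / 4 ≤ |z - y| := by
        by_contra hlt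
        push Not at hlt
        rw [abs_lt] at hlt
        exact hz.2 ⟨by linarith, by linarith⟩
      have h2 : |(z - y) * g.eval z| ≤ 2 * l := by
        have : (z - y) * g.eval z = p.eval z - p.eval y := by rw [heval z]; ring
        rw [this]
        exact (abs_sub _ _).trans (by linarith [hb z hz.1, hb y hy])
      rw [abs_mul] at h2
      have h3 : m / 4 * |g.eval z| ≤ 2 * l := le_trans (by gcongr) h2
      rw [le_div_iff₀ hm]
      linarith

/-- First-derivative van der Corput bound. -/
lemma norm_integral_exp_le_of_deriv_ge (q : Polynomial ℝ) {c e l : ℝ} (hce : c ≤ e) (hl : 0 < l)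
    (h1 : ∀ x ∈ Icc c e, l ≤ |q.derivative.eval x|)
    (h2 : (∀ x ∈ Icc c e, 0 ≤ q.derivative.derivative.eval x) ∨
      (∀ x ∈ Icc c e, q.derivative.derivative.eval x ≤ 0)) :
    ‖∫ x in c..e, Complex.exp (Complex.I * ((q.eval x : ℝ) : ℂ))‖ ≤ 4 / l := by
  set p := q.derivative with hp
  have hne : ∀ x ∈ uIcc c e, p.eval x ≠ 0 := by
    intro x hx h
    rw [uIcc_of_le hce] at hx
    have := h1 x hx
    rw [h] at this
    simp at this
    linarith
  have hinv : ∀ x ∈ Icc c e, |(p.eval x)⁻¹| ≤ l⁻¹ := by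
    intro x hx
    rw [abs_inv]
    exact inv_anti₀ hl (h1 x hx)
  have hw : ∀ x ∈ uIcc c e, HasDerivAt (fun x => (p.eval x)⁻¹)
      (-(p.derivative.eval x) / (p.eval x) ^ 2) x := fun x hx =>
    (p.hasDerivAt x).inv (hne x hx)
  have hwc : ∀ x ∈ uIcc c e, HasDerivAt (fun x => (((p.eval x)⁻¹ : ℝ) : ℂ))
      ((-(p.derivative.eval x) / (p.eval x) ^ 2 : ℝ) : ℂ) x := fun x hx =>
    (hw x hx).ofReal_comp
  have hE : ∀ x : ℝ, HasDerivAt (fun x : ℝ => Complex.exp (Complex.I * ((q.eval x : ℝ) : ℂ)))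
      (Complex.exp (Complex.I * ((q.eval x : ℝ) : ℂ)) * (Complex.I * ((p.eval x : ℝ) : ℂ))) x := fun x =>
    (((q.hasDerivAt x).ofReal_comp).const_mul Complex.I).cexp
  have hcw : ContinuousOn (fun x => -(p.derivative.eval x) / (p.eval x) ^ 2) (uIcc c e) :=
    (p.derivative.continuous.neg.continuousOn).div (p.continuous.pow 2).continuousOn
      fun x hx => pow_ne_zero _ (hne x hx)
  have hiw : IntervalIntegrable (fun x => ((-(p.derivative.eval x) / (p.eval x) ^ 2 : ℝ) : ℂ))
      volume c e := (Complex.continuous_ofReal.comp_continuousOn hcw).intervalIntegrable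
  have hnorm : ∀ x : ℝ, ‖Complex.exp (Complex.I * ((q.eval x : ℝ) : ℂ))‖ = 1 := fun x => by
    rw [mul_comm]; exact Complex.norm_exp_ofReal_mul_I _
  have key := intervalIntegral.integral_mul_deriv_eq_deriv_mul hwc (fun x _ => hE x) hiw
    (by
      refine Continuous.intervalIntegrable ?_ _ _
      have := q.continuous
      have := p.continuous
      fun_prop)
  have hlhs : ∫ x in c..e, (((p.eval x)⁻¹ : ℝ) : ℂ) *
      (Complex.exp (Complex.I * ((q.eval x : ℝ) : ℂ)) * (Complex.I * ((p.eval x : ℝ) : ℂ)))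
      = Complex.I * ∫ x in c..e, Complex.exp (Complex.I * ((q.eval x : ℝ) : ℂ)) := by
    rw [← intervalIntegral.integral_const_mul]
    refine intervalIntegral.integral_congr fun x hx => ?_
    have : ((p.eval x : ℝ) : ℂ) ≠ 0 := by exact_mod_cast hne x hx
    simp only [Complex.ofReal_inv]
    field_simp
  have hvar : ‖∫ x in c..e, ((-(p.derivative.eval x) / (p.eval x) ^ 2 : ℝ) : ℂ) *
      Complex.exp (Complex.I * ((q.eval x : ℝ) : ℂ))‖ ≤ |(p.eval e)⁻¹ - (p.eval c)⁻¹| := by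
    have hint : ∫ x in c..e, -(p.derivative.eval x) / (p.eval x) ^ 2
        = (p.eval e)⁻¹ - (p.eval c)⁻¹ :=
      intervalIntegral.integral_eq_sub_of_hasDerivAt hw hcw.intervalIntegrable
    have hle : ‖∫ x in c..e, ((-(p.derivative.eval x) / (p.eval x) ^ 2 : ℝ) : ℂ) *
      Complex.exp (Complex.I * ((q.eval x : ℝ) : ℂ))‖ ≤
        ∫ x in c..e, |-(p.derivative.eval x) / (p.eval x) ^ 2| := by
      refine (intervalIntegral.norm_integral_le_integral_norm hce).trans_eq ?_
      refine intervalIntegral.integral_congr fun x _ => ?_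
      simp only [norm_mul, hnorm, mul_one, Complex.norm_real, Real.norm_eq_abs]
    refine hle.trans ?_
    rw [← hint]
    rcases h2 with h2 | h2
    · rw [← abs_neg, ← intervalIntegral.integral_neg]
      refine le_trans (le_of_eq ?_) (le_abs_self _)
      refine intervalIntegral.integral_congr fun x hx => ?_
      rw [uIcc_of_le hce] at hx
      rw [neg_div, abs_neg, abs_of_nonneg, neg_neg]
      exact div_nonneg (h2 x hx) (by positivity)
    · refine le_trans (le_of_eq ?_) (le_abs_self _)
      refine intervalIntegral.integral_congr fun x hx => ?_
      rw [uIcc_of_le hce] at hx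
      rw [abs_of_nonneg]
      exact div_nonneg (by linarith [h2 x hx]) (by positivity)
  have hfin : ‖Complex.I * ∫ x in c..e, Complex.exp (Complex.I * ((q.eval x : ℝ) : ℂ))‖ ≤ 4 / l := by
    rw [← hlhs, key]
    have hc := hinv c ⟨le_rfl, hce⟩
    have he := hinv e ⟨hce, le_rfl⟩
    have hvar' := hvar.trans (abs_sub _ _)
    refine (norm_sub_le _ _).trans ?_
    refine (add_le_add (norm_sub_le _ _) hvar').trans ?_
    simp only [norm_mul, hnorm, mul_one, Complex.norm_real, Real.norm_eq_abs]
    calc _ ≤ l⁻¹ + l⁻¹ + (l⁻¹ + l⁻¹) := by gcongr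
      _ = 4 / l := by ring
  simpa using hfin

lemma norm_integral_le_of_finset_breaks {F : ℝ → ℂ} (hF : Continuous F) {B : ℝ} (hB : 0 ≤ B)
    {A : Set ℝ} (hA : MeasurableSet A) (S : Finset ℝ)
    (h : ∀ c e, c ≤ e → (∀ x ∈ S, x ∉ Ioo c e) →
      ‖∫ x in c..e, F x‖ ≤ B + volume.real (A ∩ Ioc c e)) {c e : ℝ} (hce : c ≤ e) :
    ‖∫ x in c..e, F x‖ ≤ (S.card + 1) * B + volume.real (A ∩ Ioc c e) := by
  classical
  have key : ∀ N : ℕ, ∀ c e, c ≤ e → (S.filter (· ∈ Ioo c e)).card ≤ N →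
      ‖∫ x in c..e, F x‖ ≤ (N + 1) * B + volume.real (A ∩ Ioc c e) := by
    intro N
    induction N using Nat.strong_induction_on with
    | _ N ih =>
      intro c e hce hN
      by_cases hS : ∀ x ∈ S, x ∉ Ioo c e
      · refine (h c e hce hS).trans ?_
        gcongr
        nlinarith [(Nat.cast_nonneg N : (0 : ℝ) ≤ N)]
      · push Not at hS
        obtain ⟨x, hxS, hx⟩ := hS
        set N₁ := (S.filter (· ∈ Ioo c x)).card
        set N₂ := (S.filter (· ∈ Ioo x e)).card
        have hcard : N₁ + N₂ + 1 ≤ N := by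
          have hd : Disjoint (S.filter (· ∈ Ioo c x)) (S.filter (· ∈ Ioo x e)) := by
            rw [Finset.disjoint_left]
            intro y hy hy'
            simp only [Finset.mem_filter, mem_Ioo] at hy hy'
            linarith [hy.2.2, hy'.2.1]
          have hx' : x ∉ S.filter (· ∈ Ioo c x) ∪ S.filter (· ∈ Ioo x e) := by
            simp
          rw [← Finset.card_union_of_disjoint hd, ← Finset.card_insert_of_notMem hx']
          refine le_trans (Finset.card_le_card ?_) hN
          intro y hy
          simp only [Finset.mem_insert, Finset.mem_union, Finset.mem_filter, mem_Ioo] at hy ⊢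
          rcases hy with rfl | hy | hy
          · exact ⟨hxS, hx⟩
          · exact ⟨hy.1, hy.2.1, hy.2.2.trans hx.2⟩
          · exact ⟨hy.1, hx.1.trans hy.2.1, hy.2.2⟩
        have i1 := ih N₁ (by omega) c x hx.1.le le_rfl
        have i2 := ih N₂ (by omega) x e hx.2.le le_rfl
        have hI : ∫ y in c..e, F y = (∫ y in c..x, F y) + ∫ y in x..e, F y :=
          (intervalIntegral.integral_add_adjacent_intervals (hF.intervalIntegrable _ _)
            (hF.intervalIntegrable _ _)).symm
        have hV : volume.real (A ∩ Ioc c e)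
            = volume.real (A ∩ Ioc c x) + volume.real (A ∩ Ioc x e) := by
          rw [← Ioc_union_Ioc_eq_Ioc hx.1.le hx.2.le, inter_union_distrib_left]
          refine measureReal_union ?_ (hA.inter measurableSet_Ioc)
            (measure_ne_top_of_subset inter_subset_right (by simp))
            (measure_ne_top_of_subset inter_subset_right (by simp))
          rw [Set.disjoint_left]
          intro y hy hy'
          exact absurd hy.2.2 (not_le.2 hy'.2.1)
        rw [hI, hV]
        have hc' : (N₁ : ℝ) + N₂ + 1 ≤ N := by exact_mod_cast hcard
        calc _ ≤ _ := norm_add_le _ _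
          _ ≤ _ := add_le_add i1 i2
          _ = (N₁ + N₂ + 1 + 1) * B +
            (volume.real (A ∩ Ioc c x) + volume.real (A ∩ Ioc x e)) := by ring
          _ ≤ _ := by gcongr
  exact key S.card c e hce (Finset.card_filter_le _ _)

/-- A polynomial without roots in an open interval, or identically zero, has a constant weak sign
on the closed interval. -/
lemma Polynomial.nonneg_or_nonpos_of_roots (p : Polynomial ℝ) {c e : ℝ} (hce : c < e)
    (h : ∀ x ∈ p.roots.toFinset, x ∉ Ioo c e) :
    (∀ x ∈ Icc c e, 0 ≤ p.eval x) ∨ (∀ x ∈ Icc c e, p.eval x ≤ 0) := by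
  rcases eq_or_ne p 0 with rfl | hp
  · simp
  have hne : ∀ x ∈ Ioo c e, p.eval x ≠ 0 := by
    intro x hx h0
    exact h x (by simpa [hp] using h0) hx
  have hcl : Icc c e = closure (Ioo c e) := (closure_Ioo hce.ne).symm
  have hsign : (∀ x ∈ Ioo c e, 0 ≤ p.eval x) ∨ (∀ x ∈ Ioo c e, p.eval x ≤ 0) := by
    by_contra hcon
    push Not at hcon
    obtain ⟨⟨x, hx, hx'⟩, y, hy, hy'⟩ := hcon
    obtain ⟨z, hz, hz'⟩ := (isPreconnected_Ioo (a := c) (b := e)).intermediate_value hx hy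
      p.continuous.continuousOn ⟨hx'.le, hy'.le⟩
    exact hne z hz hz'
  rw [hcl]
  refine hsign.imp (fun h x hx => ?_) (fun h x hx => ?_)
  · exact closure_minimal h (isClosed_le continuous_const p.continuous) hx
  · exact closure_minimal h (isClosed_le p.continuous continuous_const) hx

/-- A van der Corput estimate for polynomial phases. -/
lemma norm_integral_exp_le_add_sublevel (q : Polynomial ℝ) {d : ℕ} (hq : q.natDegree ≤ d)
    {c e l : ℝ} (hce : c ≤ e) (hl : 0 < l) :
    ‖∫ x in c..e, Complex.exp (Complex.I * ((q.eval x : ℝ) : ℂ))‖ ≤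
      (3 * d + 1) * (4 / l) + volume.real ({x | |q.derivative.eval x| ≤ l} ∩ Ioc c e) := by
  classical
  set p := q.derivative with hp
  have hpd : p.natDegree ≤ d := (Polynomial.natDegree_derivative_le q).trans (by omega)
  have hppd : p.derivative.natDegree ≤ d :=
    (Polynomial.natDegree_derivative_le p).trans (by omega)
  have hcont : Continuous fun x : ℝ => Complex.exp (Complex.I * ((q.eval x : ℝ) : ℂ)) := by
    have := q.continuous
    fun_prop
  have hnorm : ∀ x : ℝ, ‖Complex.exp (Complex.I * ((q.eval x : ℝ) : ℂ))‖ = 1 := fun x => by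
    rw [mul_comm]; exact Complex.norm_exp_ofReal_mul_I _
  set S : Finset ℝ := p.derivative.roots.toFinset ∪
    ((p - Polynomial.C l).roots.toFinset ∪ (p + Polynomial.C l).roots.toFinset) with hS
  have hScard : S.card ≤ 3 * d := by
    have hroot : ∀ r : Polynomial ℝ, r.natDegree ≤ d → r.roots.toFinset.card ≤ d := fun r hr =>
      (Multiset.toFinset_card_le _).trans ((Polynomial.card_roots' r).trans hr)
    have h1 := hroot _ hppd
    have h2 := hroot (p - Polynomial.C l) (by rwa [Polynomial.natDegree_sub_C])
    have h3 := hroot (p + Polynomial.C l) (by rwa [Polynomial.natDegree_add_C])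
    have h4 := Finset.card_union_le p.derivative.roots.toFinset
      ((p - Polynomial.C l).roots.toFinset ∪ (p + Polynomial.C l).roots.toFinset)
    have h5 := Finset.card_union_le (p - Polynomial.C l).roots.toFinset
      (p + Polynomial.C l).roots.toFinset
    rw [hS]
    omega
  have hAm : MeasurableSet {x | |p.eval x| ≤ l} :=
    (isClosed_le p.continuous.abs continuous_const).measurableSet
  refine (norm_integral_le_of_finset_breaks hcont (B := 4 / l) (by positivity) hAm S ?_ hce).trans
    ?_
  · intro c e hce hbr
    rcases hce.eq_or_lt with rfl | hlt
    · simp; positivity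
    have s1 := p.derivative.nonneg_or_nonpos_of_roots hlt
      (fun x hx => hbr x (by simp only [hS, Finset.mem_union]; exact Or.inl hx))
    have s2 := (p - Polynomial.C l).nonneg_or_nonpos_of_roots hlt
      (fun x hx => hbr x (by simp only [hS, Finset.mem_union]; exact Or.inr (Or.inl hx)))
    have s3 := (p + Polynomial.C l).nonneg_or_nonpos_of_roots hlt
      (fun x hx => hbr x (by simp only [hS, Finset.mem_union]; exact Or.inr (Or.inr hx)))
    simp only [Polynomial.eval_sub, Polynomial.eval_add, Polynomial.eval_C] at s2 s3
    have hbig : (∀ x ∈ Icc c e, l ≤ |p.eval x|) →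
        ‖∫ x in c..e, Complex.exp (Complex.I * ((q.eval x : ℝ) : ℂ))‖ ≤
          4 / l + volume.real ({x | |p.eval x| ≤ l} ∩ Ioc c e) := fun h =>
      (norm_integral_exp_le_of_deriv_ge q hce hl h s1).trans
        (le_add_of_nonneg_right measureReal_nonneg)
    rcases s2 with s2 | s2
    · exact hbig fun x hx => le_trans (by linarith [s2 x hx]) (le_abs_self _)
    rcases s3 with s3 | s3
    · have hsub : {x | |p.eval x| ≤ l} ∩ Ioc c e = Ioc c e := by
        refine inter_eq_right.2 fun x hx => ?_
        have hx' := Ioc_subset_Icc_self hx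
        have h2 := s2 x hx'
        have h3 := s3 x hx'
        have h4 : |p.eval x| ≤ l := abs_le.2 ⟨by linarith, by linarith⟩
        exact h4
      rw [hsub]
      have h1 : ‖∫ x in c..e, Complex.exp (Complex.I * ((q.eval x : ℝ) : ℂ))‖ ≤ e - c := by
        have := intervalIntegral.norm_integral_le_of_norm_le_const (a := c) (b := e) (C := 1)
          (f := fun x : ℝ => Complex.exp (Complex.I * ((q.eval x : ℝ) : ℂ)))
          (fun x _ => (hnorm x).le)
        rwa [one_mul, abs_of_nonneg (by linarith)] at this
      rw [Real.volume_real_Ioc_of_le hce]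
      have : 0 ≤ 4 / l := by positivity
      linarith
    · exact hbig fun x hx => le_trans (by linarith [s3 x hx]) (neg_le_abs _)
  · gcongr
    exact_mod_cast hScard

/-- Oscillatory integrals of polynomial phases over subintervals of an interval on which the phase
oscillates by at least `τ`. -/
lemma exists_oscillatory_const (d : ℕ) (hd : 2 ≤ d) : ∃ C : ℝ, 0 < C ∧
    ∀ q : Polynomial ℝ, q.natDegree ≤ d → ∀ a b τ x y : ℝ, 0 < τ → x ∈ Icc a b → y ∈ Icc a b →
      τ ≤ q.eval x - q.eval y → ∀ c e : ℝ, a ≤ c → c ≤ e → e ≤ b →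
      ‖∫ x in c..e, Complex.exp (Complex.I * ((q.eval x : ℝ) : ℂ))‖ ≤
        C * (b - a) * τ ^ (-(1 / (d : ℝ))) := by
  obtain ⟨C, hC, hrem⟩ := exists_remez_const (d - 1)
  refine ⟨(3 * d + 1) * 4 + max 1 C, by positivity, ?_⟩
  intro q hq a b τ x y hτ hx hy hxy c e hac hce heb
  have hne : x ≠ y := by rintro rfl; linarith
  have hab : 0 < b - a := by
    rcases lt_or_gt_of_ne hne with h | h <;> linarith [hx.1, hx.2, hy.1, hy.2]
  have hd0 : (0 : ℝ) < d := by positivity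
  set l := τ ^ (1 / (d : ℝ)) / (b - a) with hldef
  have hτd : 0 < τ ^ (1 / (d : ℝ)) := Real.rpow_pos_of_pos hτ _
  have hl : 0 < l := by positivity
  have hinv : 1 / l = (b - a) * τ ^ (-(1 / (d : ℝ))) := by
    rw [hldef, Real.rpow_neg hτ.le]; field_simp
  -- a point with large derivative
  have hξ : ∃ ξ ∈ Icc a b, τ / (b - a) ≤ |q.derivative.eval ξ| := by
    by_contra hcon
    push Not at hcon
    obtain ⟨z, hz, hz'⟩ : ∃ z ∈ uIcc y x, q.eval x - q.eval y =
        q.derivative.eval z * (x - y) := by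
      rcases lt_or_gt_of_ne hne with h | h
      · obtain ⟨z, hz, hz'⟩ := exists_hasDerivAt_eq_slope (fun x => q.eval x)
          (fun x => q.derivative.eval x) h q.continuous.continuousOn
          (fun z _ => q.hasDerivAt z)
        refine ⟨z, ⟨?_, ?_⟩, ?_⟩
        · simp [h.le, hz.1.le]
        · simp [h.le, hz.2.le]
        · rw [hz']; field_simp [sub_ne_zero.2 h.ne']; grind
      · obtain ⟨z, hz, hz'⟩ := exists_hasDerivAt_eq_slope (fun x => q.eval x)
          (fun x => q.derivative.eval x) h q.continuous.continuousOn
          (fun z _ => q.hasDerivAt z)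
        refine ⟨z, ⟨?_, ?_⟩, ?_⟩
        · simp [h.le, hz.1.le]
        · simp [h.le, hz.2.le]
        · rw [hz']; field_simp [sub_ne_zero.2 h.ne']
    have h1 := hcon z (uIcc_subset_Icc hy hx hz)
    have h2 : |x - y| ≤ b - a := by
      rw [abs_le]; constructor <;> linarith [hx.1, hx.2, hy.1, hy.2]
    have h3 : q.eval x - q.eval y ≤ |q.derivative.eval z| * |x - y| := by
      rw [hz', ← abs_mul]; exact le_abs_self _
    have h4 : 0 < |x - y| := abs_pos.2 (sub_ne_zero.2 hne)
    have h5 : |q.derivative.eval z| * |x - y| < τ / (b - a) * |x - y| := by gcongr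
    have h6 : τ / (b - a) * |x - y| ≤ τ / (b - a) * (b - a) := by gcongr
    rw [div_mul_cancel₀ _ hab.ne'] at h6
    linarith
  obtain ⟨ξ, hξ, hξ'⟩ := hξ
  set A := {x | |q.derivative.eval x| ≤ l} ∩ Ioc c e with hA
  have hsub : volume.real A ≤ max 1 C * (b - a) * τ ^ (-(1 / (d : ℝ))) := by
    set m := volume.real A with hm
    rcases (measureReal_nonneg : 0 ≤ m).eq_or_lt with h0 | h0
    · rw [show m = 0 from h0.symm]; positivity
    have h1 := hrem q.derivative ((Polynomial.natDegree_derivative_le q).trans (by omega)) a b m l A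
      (fun z hz => ⟨hac.trans hz.2.1.le, hz.2.2.trans heb⟩) h0
      (by rw [hm, ofReal_measureReal (measure_ne_top_of_subset inter_subset_right (by simp))])
      hl.le (fun z hz => hz.1) ξ hξ
    have h2 := hξ'.trans h1
    have hpow : m ^ (d - 1) ≤ (max 1 C * (b - a) * τ ^ (-(1 / (d : ℝ)))) ^ (d - 1) := by
      have h3 : m ^ (d - 1) ≤ C * (b - a) ^ (d - 1) * (τ ^ (1 / (d : ℝ)) / τ) := by
        rw [div_pow] at h2
        rw [hldef] at h2
        have hmp : 0 < m ^ (d - 1) := by positivity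
        have h2' := mul_le_mul_of_nonneg_right h2 (show 0 ≤ (b - a) * m ^ (d - 1) / τ by positivity)
        have e1 : τ / (b - a) * ((b - a) * m ^ (d - 1) / τ) = m ^ (d - 1) := by field_simp
        have e2 : C * ((b - a) ^ (d - 1) / m ^ (d - 1)) * (τ ^ (1 / (d : ℝ)) / (b - a)) *
          ((b - a) * m ^ (d - 1) / τ) = C * (b - a) ^ (d - 1) * (τ ^ (1 / (d : ℝ)) / τ) := by
          field_simp
        rwa [e1, e2] at h2'
      refine h3.trans ?_
      have e3 : τ ^ (1 / (d : ℝ)) / τ = (τ ^ (-(1 / (d : ℝ)))) ^ (d - 1) := by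
        rw [← Real.rpow_natCast, ← Real.rpow_mul hτ.le, ← Real.rpow_sub_one hτ.ne']
        congr 1
        rw [Nat.cast_sub (by omega)]
        push_cast
        field_simp
        ring
      rw [e3, mul_pow, mul_pow]
      gcongr
      exact (le_max_right _ _).trans (le_self_pow₀ (le_max_left _ _) (by omega))
    exact (pow_le_pow_iff_left₀ h0.le (by positivity) (by omega)).1 hpow
  refine (norm_integral_exp_le_add_sublevel q hq hce hl).trans ?_
  have : (3 * d + 1) * (4 / l) = (3 * (d : ℝ) + 1) * 4 * ((b - a) * τ ^ (-(1 / (d : ℝ)))) := by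
    rw [← hinv]; ring
  rw [this]
  linarith

section

open scoped Pointwise

/-- Multiplicative form of log-concavity for functions with values in `[0, ∞]`. -/
def LogConcaveFun {E : Type*} [AddCommMonoid E] [Module ℝ E] (φ : E → ENNReal) : Prop :=
  ∀ (x y : E) (a b : ℝ), 0 < a → 0 < b → a + b = 1 → φ x ^ a * φ y ^ b ≤ φ (a • x + b • y)

/-- Measures on the line with a measurable log-concave density. -/
def HasLogConcaveDensity (ν : Measure ℝ) : Prop :=
  ∃ r : ℝ → ENNReal, Measurable r ∧ LogConcaveFun r ∧ ν = volume.withDensity r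

/-- Unimodal probability densities with a fixed exponential decay. -/
structure IsNormalDensity (A : ℝ) (R : ℝ → ℝ) : Prop where
  measurable : Measurable R
  nonneg : ∀ z, 0 ≤ R z
  le_exp : ∀ z, R z ≤ A * Real.exp (-|z|)
  integral_eq_one : ∫ z, R z = 1
  ordConnected : ∀ s, OrdConnected {z | s ≤ R z}

lemma LogConcaveFun.convex_superlevel {E : Type*} [AddCommGroup E] [Module ℝ E]
    {φ : E → ENNReal} (hφ : LogConcaveFun φ) (s : ENNReal) : Convex ℝ {x | s ≤ φ x} := by
  rw [convex_iff_forall_pos]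
  intro x hx y hy a b ha hb hab
  refine le_trans ?_ (hφ x y a b ha hb hab)
  calc s = s ^ (a + b) := by rw [hab, ENNReal.rpow_one]
    _ = s ^ a * s ^ b := ENNReal.rpow_add_of_nonneg _ _ ha.le hb.le
    _ ≤ _ := by
      gcongr
      · exact hx
      · exact hy

/-- An integrable log-concave function on the line is bounded. -/
lemma LogConcaveFun.bounded {r : ℝ → ENNReal} (hr : LogConcaveFun r) (hm : Measurable r)
    (h1 : ∫⁻ x, r x = 1) : ∃ M : ENNReal, M ≠ ⊤ ∧ ∀ x, r x ≤ M := by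
  have hpos : ∃ s : ℝ, 0 < s ∧ volume {x | ENNReal.ofReal s ≤ r x} ≠ 0 := by
    by_contra hcon
    push Not at hcon
    have h0 : r =ᵐ[volume] 0 := by
      have : ∀ n : ℕ, ∀ᵐ x, r x < ENNReal.ofReal (1 / ((n : ℝ) + 1)) := by
        intro n
        have := hcon (1 / ((n : ℝ) + 1)) (by positivity)
        rw [measure_eq_zero_iff_ae_notMem] at this
        filter_upwards [this] with x hx
        simpa using hx
      rw [← ae_all_iff] at this
      filter_upwards [this] with x hx
      by_contra hne
      rw [Pi.zero_apply] at hne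
      have hlt : r x < ⊤ := (hx 0).trans ENNReal.ofReal_lt_top
      have hp : 0 < (r x).toReal := ENNReal.toReal_pos hne hlt.ne
      obtain ⟨n, hn⟩ := exists_nat_one_div_lt hp
      have := hx n
      rw [← ENNReal.ofReal_toReal hlt.ne] at this
      exact absurd ((ENNReal.ofReal_lt_ofReal_iff (by positivity)).1 this) (by linarith)
    rw [lintegral_congr_ae h0] at h1
    simp at h1
  obtain ⟨s, hs, hv⟩ := hpos
  set V := {x | ENNReal.ofReal s ≤ r x} with hV
  set v := volume V with hvdef
  have hs0 : ENNReal.ofReal s ≠ 0 := by simpa using hs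
  set K : ENNReal := (ENNReal.ofReal (1 / 2) * v)⁻¹ with hK
  have hK0 : ENNReal.ofReal (1 / 2) * v ≠ 0 := mul_ne_zero (by simp) hv
  have hKt : K ≠ ⊤ := ENNReal.inv_ne_top.2 hK0
  refine ⟨K ^ (2 : ℝ) / ENNReal.ofReal s, ?_, fun x => ?_⟩
  · exact ENNReal.div_ne_top (ENNReal.rpow_ne_top_of_nonneg (by norm_num) hKt) hs0
  · set c : ENNReal := r x ^ (1 / 2 : ℝ) * ENNReal.ofReal s ^ (1 / 2 : ℝ) with hc
    have hsub : (fun z => (1 / 2 : ℝ) • x + z) '' ((1 / 2 : ℝ) • V) ⊆ {y | c ≤ r y} := by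
      rintro _ ⟨_, ⟨y, hy, rfl⟩, rfl⟩
      refine le_trans ?_ (hr x y (1 / 2) (1 / 2) (by norm_num) (by norm_num) (by norm_num))
      rw [hc]
      exact mul_le_mul_right (ENNReal.rpow_le_rpow hy (by norm_num)) _
    have hvol : ENNReal.ofReal (1 / 2) * v ≤ volume {y | c ≤ r y} := by
      refine le_trans (le_of_eq ?_) (measure_mono hsub)
      rw [image_add_left, measure_preimage_add, Measure.addHaar_smul]
      simp [hvdef]
    have hmk : c * (ENNReal.ofReal (1 / 2) * v) ≤ 1 :=
      calc _ ≤ c * volume {y | c ≤ r y} := by gcongr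
        _ ≤ ∫⁻ x, r x := mul_meas_ge_le_lintegral hm c
        _ = 1 := h1
    have hcK : c ≤ K := ENNReal.le_inv_iff_mul_le.2 hmk
    rw [ENNReal.le_div_iff_mul_le (Or.inl hs0) (Or.inl ENNReal.ofReal_ne_top)]
    calc r x * ENNReal.ofReal s = c ^ (2 : ℝ) := by
          rw [hc, ENNReal.mul_rpow_of_nonneg _ _ (by norm_num : (0 : ℝ) ≤ 2),
            ← ENNReal.rpow_mul, ← ENNReal.rpow_mul]
          norm_num
      _ ≤ K ^ (2 : ℝ) := by gcongr

lemma lintegral_comp_affine (x₀ : ℝ) {L : ℝ} (hL : 0 < L) {G : ℝ → ENNReal} (hG : Measurable G) :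
    ∫⁻ y, G y = ENNReal.ofReal L * ∫⁻ z, G (x₀ + L * z) := by
  have h1 := Real.smul_map_volume_mul_left hL.ne'
  calc ∫⁻ y, G y = ∫⁻ y, G (x₀ + y) := (lintegral_add_left_eq_self G x₀).symm
    _ = ∫⁻ y, G (x₀ + y) ∂(ENNReal.ofReal |L| • Measure.map (fun z => L * z) volume) := by rw [h1]
    _ = _ := by
      rw [lintegral_smul_measure, lintegral_map (f := fun y => G (x₀ + y))
        (hG.comp (measurable_const_add x₀)) (measurable_const_mul L), abs_of_pos hL, smul_eq_mul]

lemma exists_normal_form : ∃ A : ℝ, 0 < A ∧ ∀ ν : Measure ℝ, IsProbabilityMeasure ν →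
    HasLogConcaveDensity ν → ∃ (x₀ L : ℝ) (R : ℝ → ℝ), IsNormalDensity A R ∧
      ν = (volume.withDensity fun z => ENNReal.ofReal (R z)).map (fun z => x₀ + L * z) := by
  refine ⟨4 * Real.exp 1 * Real.exp 1, by positivity, ?_⟩
  rintro ν hν ⟨r, hm, hr, rfl⟩
  have h1 : ∫⁻ x, r x = 1 := by
    have := hν.measure_univ
    rwa [withDensity_apply _ MeasurableSet.univ, Measure.restrict_univ] at this
  obtain ⟨M, hMt, hM⟩ := hr.bounded hm h1
  have hfin : ∀ x, r x ≠ ⊤ := fun x => ne_top_of_le_ne_top hMt (hM x)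
  set ρ : ℝ → ℝ := fun x => (r x).toReal with hρ
  have hrρ : ∀ x, r x = ENNReal.ofReal (ρ x) := fun x => (ENNReal.ofReal_toReal (hfin x)).symm
  have hρ0 : ∀ x, 0 ≤ ρ x := fun x => ENNReal.toReal_nonneg
  have hbdd : BddAbove (range ρ) := ⟨M.toReal, by
    rintro _ ⟨x, rfl⟩; exact ENNReal.toReal_mono hMt (hM x)⟩
  have hlc : ∀ x y a b : ℝ, 0 < a → 0 < b → a + b = 1 →
      ρ x ^ a * ρ y ^ b ≤ ρ (a * x + b * y) := by
    intro x y a b ha hb hab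
    have := ENNReal.toReal_mono (hfin _) (hr x y a b ha hb hab)
    rwa [ENNReal.toReal_mul, ← ENNReal.toReal_rpow, ← ENNReal.toReal_rpow] at this
  -- a point where the density is at least half its supremum
  obtain ⟨xs, hxs⟩ : ∃ xs, 0 < ρ xs ∧ ∀ x, ρ x ≤ 2 * ρ xs := by
    have hsup : 0 < ⨆ x, ρ x := by
      by_contra hle
      push Not at hle
      have : ∀ x, r x = 0 := fun x => by
        rw [hrρ, ENNReal.ofReal_eq_zero]
        exact (le_ciSup hbdd x).trans hle
      simp [this] at h1
    obtain ⟨xs, hxs⟩ := exists_lt_of_lt_ciSup (half_lt_self hsup)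
    exact ⟨xs, by linarith, fun x => (le_ciSup hbdd x).trans (by linarith)⟩
  obtain ⟨hM0, hle⟩ := hxs
  set M₀ := ρ xs with hM₀
  set e := Real.exp 1 with he
  have he0 : 0 < e := Real.exp_pos 1
  set L := 2 * e / M₀ with hL
  have hL0 : 0 < L := by positivity
  have hconv : ∀ s, Convex ℝ {x | s ≤ ρ x} := by
    intro s
    have : {x | s ≤ ρ x} = {x | ENNReal.ofReal s ≤ r x} := by
      ext x
      rw [mem_ofPred_eq, mem_ofPred_eq, hrρ, ENNReal.ofReal_le_ofReal_iff (hρ0 x)]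
    rw [this]
    exact hr.convex_superlevel _
  have hnear : ∀ y, M₀ / e ≤ ρ y → |y - xs| ≤ e / M₀ := by
    intro y hy
    have hxs : xs ∈ {x | M₀ / e ≤ ρ x} := by
      show M₀ / e ≤ M₀
      exact div_le_self hM0.le (Real.one_le_exp zero_le_one)
    have hsub : uIcc xs y ⊆ {x | M₀ / e ≤ ρ x} := by
      rw [← segment_eq_uIcc]
      exact (hconv _).segment_subset hxs hy
    have hv : ENNReal.ofReal (M₀ / e) * volume (uIcc xs y) ≤ 1 :=
      calc _ ≤ ENNReal.ofReal (M₀ / e) * volume {x | ENNReal.ofReal (M₀ / e) ≤ r x} := by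
            gcongr
            intro z hz
            rw [mem_ofPred_eq, hrρ]
            exact ENNReal.ofReal_le_ofReal (hsub hz)
        _ ≤ ∫⁻ x, r x := mul_meas_ge_le_lintegral hm _
        _ = 1 := h1
    rw [Real.volume_interval, ← ENNReal.ofReal_mul (by positivity), ENNReal.ofReal_le_one] at hv
    rw [le_div_iff₀ hM0]
    have := mul_le_mul_of_nonneg_right hv he0.le
    have e1 : M₀ / e * |y - xs| * e = |y - xs| * M₀ := by field_simp
    linarith
  have hdecay : ∀ y, ρ y ≤ 2 * e * M₀ * Real.exp (-(|y - xs| / L)) := by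
    intro y
    set u := |y - xs| / L with hu
    have hu0 : 0 ≤ u := by positivity
    rcases le_or_gt u 1 with h | h
    · have : Real.exp (-1) ≤ Real.exp (-u) := Real.exp_le_exp.2 (by linarith)
      have e2 : e * Real.exp (-1) = 1 := by rw [he, ← Real.exp_add]; simp
      calc ρ y ≤ 2 * M₀ := hle y
        _ = 2 * e * M₀ * Real.exp (-1) := by linear_combination (-2 * M₀) * e2
        _ ≤ _ := by gcongr
    · set w := (1 - 1 / u) * xs + (1 / u) * y with hw
      have hupos : 0 < u := by linarith
      have hu1 : 1 / u < 1 := by rw [div_lt_one hupos]; exact h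
      have hwd : |w - xs| = L := by
        have : w - xs = (1 / u) * (y - xs) := by rw [hw]; ring
        rw [this, abs_mul, abs_of_pos (by positivity), hu]
        have : |y - xs| ≠ 0 := by
          intro h0
          rw [hu, h0] at h
          norm_num at h
        field_simp
      have hwlt : ρ w < M₀ / e := by
        by_contra hcon
        push Not at hcon
        have := hnear w hcon
        rw [hwd, hL] at this
        have h3 : 0 < e / M₀ := by positivity
        have h4 : 2 * e / M₀ = 2 * (e / M₀) := by ring
        linarith
      have hge := hlc xs y (1 - 1 / u) (1 / u) (by linarith) (by positivity) (by ring)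
      rw [← hw] at hge
      have h5 : M₀ ^ (1 - 1 / u) * ρ y ^ (1 / u) ≤ M₀ * Real.exp (-1) := by
        rw [Real.exp_neg]; exact hge.trans hwlt.le
      have h6 : ρ y ^ (1 / u) ≤ M₀ ^ (1 / u) * Real.exp (-1) := by
        have h7 : M₀ = M₀ ^ (1 - 1 / u) * M₀ ^ (1 / u) := by
          rw [← Real.rpow_add hM0]; simp
        have h8 : 0 < M₀ ^ (1 - 1 / u) := Real.rpow_pos_of_pos hM0 _
        refine le_of_mul_le_mul_left ?_ h8
        rw [← mul_assoc, ← h7]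
        exact h5
      have h9 : ρ y ≤ M₀ * Real.exp (-u) := by
        have := Real.rpow_le_rpow (Real.rpow_nonneg (hρ0 y) _) h6 hu0
        rw [← Real.rpow_mul (hρ0 y), Real.mul_rpow (by positivity) (by positivity),
          ← Real.rpow_mul hM0.le, ← Real.exp_mul] at this
        have e1 : 1 / u * u = 1 := by field_simp
        rw [e1, Real.rpow_one, Real.rpow_one, neg_one_mul] at this
        exact this
      refine h9.trans ?_
      gcongr
      have : 1 ≤ e := Real.one_le_exp zero_le_one
      nlinarith
  refine ⟨xs, L, fun z => L * ρ (xs + L * z), ⟨?_, ?_, ?_, ?_, ?_⟩, ?_⟩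
  · exact (hm.ennreal_toReal.comp ((measurable_const_mul L).const_add xs)).const_mul L
  · exact fun z => mul_nonneg hL0.le (hρ0 _)
  · intro z
    have := hdecay (xs + L * z)
    have e1 : |xs + L * z - xs| / L = |z| := by
      rw [add_sub_cancel_left, abs_mul, abs_of_pos hL0]; field_simp
    rw [e1] at this
    calc L * ρ (xs + L * z) ≤ L * (2 * e * M₀ * Real.exp (-|z|)) := by gcongr
      _ = _ := by rw [hL]; field_simp; ring
  · have h2 := lintegral_comp_affine xs hL0 hm
    rw [h1, ← lintegral_const_mul' _ _ ENNReal.ofReal_ne_top] at h2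
    rw [integral_eq_lintegral_of_nonneg_ae]
    · have : ∀ z, ENNReal.ofReal (L * ρ (xs + L * z)) = ENNReal.ofReal L * r (xs + L * z) :=
        fun z => by rw [ENNReal.ofReal_mul hL0.le, hrρ]
      simp_rw [this]
      rw [← h2]; simp
    · exact Filter.Eventually.of_forall fun z => mul_nonneg hL0.le (hρ0 _)
    · exact ((hm.ennreal_toReal.comp
        ((measurable_const_mul L).const_add xs)).const_mul L).aestronglyMeasurable
  · intro s
    have : {z | s ≤ L * ρ (xs + L * z)} = (fun z => xs + L * z) ⁻¹' {x | s / L ≤ ρ x} := by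
      ext z
      simp only [mem_ofPred_eq, mem_preimage]
      rw [div_le_iff₀ hL0, mul_comm]
    rw [this]
    refine (hconv _).ordConnected.preimage_mono fun a b hab => ?_
    show xs + L * a ≤ xs + L * b
    gcongr
  · have hme : Measurable fun z : ℝ => xs + L * z := (measurable_const_mul L).const_add xs
    ext s hs
    rw [Measure.map_apply hme hs, withDensity_apply _ hs, withDensity_apply _ (hme hs),
      ← lintegral_indicator hs, ← lintegral_indicator (hme hs),
      lintegral_comp_affine xs hL0 (hm.indicator hs),
      ← lintegral_const_mul' _ _ ENNReal.ofReal_ne_top]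
    refine lintegral_congr fun z => ?_
    by_cases hz : xs + L * z ∈ s
    · rw [indicator_of_mem hz, indicator_of_mem (by exact hz), ENNReal.ofReal_mul hL0.le, hrρ]
    · rw [indicator_of_notMem hz, indicator_of_notMem (by exact hz), mul_zero]

end

lemma integrable_exp_neg_half_abs : Integrable fun z : ℝ => Real.exp (-(|z| / 2)) := by
  by_contra h
  have h1 := integral_undef h
  rw [integral_comp_abs (f := fun z : ℝ => Real.exp (-(z / 2)))] at h1
  have h2 : (fun z : ℝ => Real.exp (-(z / 2))) = fun z => Real.exp (-(1 / 2) * z) := by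
    ext z; congr 1; ring
  rw [h2, integral_exp_mul_Ioi (by norm_num)] at h1
  norm_num at h1

lemma integrable_add_abs_pow_mul_exp {B : ℝ} (hB : 0 ≤ B) (m : ℕ) :
    Integrable fun z : ℝ => (B + |z|) ^ m * Real.exp (-|z|) := by
  refine (integrable_exp_neg_half_abs.const_mul
    (2 ^ m * m.factorial * Real.exp (B / 2))).mono' ?_ ?_
  · exact Continuous.aestronglyMeasurable (by fun_prop)
  · refine Filter.Eventually.of_forall fun z => ?_
    have h0 : 0 ≤ B + |z| := by positivity
    rw [Real.norm_of_nonneg (by positivity)]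
    have h1 := Real.pow_div_factorial_le_exp ((B + |z|) / 2) (by positivity) m
    rw [div_le_iff₀ (by positivity), div_pow, div_le_iff₀ (by positivity)] at h1
    have h2 : Real.exp ((B + |z|) / 2) * Real.exp (-|z|) =
        Real.exp (B / 2) * Real.exp (-(|z| / 2)) := by
      rw [← Real.exp_add, ← Real.exp_add]; congr 1; ring
    calc _ ≤ (Real.exp ((B + |z|) / 2) * m.factorial * 2 ^ m) * Real.exp (-|z|) := by gcongr
      _ = _ := by linear_combination (m.factorial * 2 ^ m : ℝ) * h2

namespace IsNormalDensity

variable {A : ℝ} {R : ℝ → ℝ}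

lemma integrable (h : IsNormalDensity A R) : Integrable R := by
  by_contra hc
  have := h.integral_eq_one
  rw [integral_undef hc] at this
  norm_num at this

lemma integrable_mul (h : IsNormalDensity A R) {g : ℝ → ℝ} (hg : Measurable g) {K : ℝ}
    (hK : ∀ z, |g z| ≤ K) : Integrable fun z => g z * R z :=
  h.integrable.bdd_mul hg.aestronglyMeasurable (Filter.Eventually.of_forall hK)

lemma pos (h : IsNormalDensity A R) : 0 < A := by
  by_contra hA
  push Not at hA
  have h0 : ∀ z, R z = 0 := fun z => le_antisymm
    ((h.le_exp z).trans (mul_nonpos_of_nonpos_of_nonneg hA (Real.exp_pos _).le)) (h.nonneg z)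
  have := h.integral_eq_one
  simp [h0] at this

lemma le_const (h : IsNormalDensity A R) (z : ℝ) : R z ≤ A :=
  (h.le_exp z).trans (mul_le_of_le_one_right h.pos.le (Real.exp_le_one_iff.2 (by simp)))

end IsNormalDensity

lemma exists_normal_tail (A : ℝ) {ε : ℝ} (hε : 0 < ε) : ∃ B : ℝ, 0 < B ∧
    ∀ R, IsNormalDensity A R → ∫ z in {z : ℝ | B < |z|}, R z ≤ ε := by
  set c := ∫ z : ℝ, |z| * Real.exp (-|z|) with hc
  have hc0 : 0 ≤ c := integral_nonneg fun z => by positivity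
  have hint : Integrable fun z : ℝ => |z| * Real.exp (-|z|) := by
    have := integrable_add_abs_pow_mul_exp le_rfl 1
    simpa using this
  refine ⟨|A| * c / ε + 1, by positivity, fun R hR => ?_⟩
  have hA := hR.pos
  rw [abs_of_pos hA]
  set B := A * c / ε + 1 with hB
  have hB0 : 0 < B := by positivity
  have hms : MeasurableSet {z : ℝ | B < |z|} := measurableSet_lt measurable_const measurable_norm
  have hi := hint.const_mul (A / B)
  calc ∫ z in {z : ℝ | B < |z|}, R z
      ≤ ∫ z in {z : ℝ | B < |z|}, A / B * (|z| * Real.exp (-|z|)) := by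
        refine setIntegral_mono_on hR.integrable.integrableOn hi.integrableOn hms fun z hz => ?_
        have hz' : B < |z| := hz
        have h1 : 1 ≤ |z| / B := by rw [le_div_iff₀ hB0]; linarith
        calc R z ≤ A * Real.exp (-|z|) := hR.le_exp z
          _ ≤ (A * Real.exp (-|z|)) * (|z| / B) := le_mul_of_one_le_right (by positivity) h1
          _ = _ := by ring
    _ ≤ ∫ z, A / B * (|z| * Real.exp (-|z|)) :=
        setIntegral_le_integral hi (Filter.Eventually.of_forall fun z => by positivity)
    _ = A / B * c := integral_const_mul _ _
    _ ≤ ε := by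
        rw [div_mul_eq_mul_div, div_le_iff₀ hB0, hB]
        have : ε * (A * c / ε + 1) = A * c + ε := by field_simp
        linarith

/-- Second moments of polynomials are controlled by truncated first moments. -/
lemma exists_normal_moment_const {A : ℝ} (hA : 0 < A) (d : ℕ) : ∃ C : ℝ, 0 < C ∧
    ∀ R, IsNormalDensity A R → ∀ q : Polynomial ℝ, q.natDegree ≤ d →
      ∫ z, min 1 |q.eval z| * R z ≤ 1 / 2 → ∫ z, q.eval z ^ 2 * R z ≤ C := by
  obtain ⟨B, hB, htail⟩ := exists_normal_tail A (show (0 : ℝ) < 1 / 4 by norm_num)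
  obtain ⟨C, hC, hrem⟩ := exists_remez_const d
  have hint := (integrable_add_abs_pow_mul_exp hB.le (d * 2)).const_mul
    (C ^ 2 * (8 * A) ^ (d * 2) * A)
  set I := ∫ z : ℝ, C ^ 2 * (8 * A) ^ (d * 2) * A * ((B + |z|) ^ (d * 2) * Real.exp (-|z|)) with hI
  refine ⟨I + 1, ?_, fun R hR q hq hmin => ?_⟩
  · have : 0 ≤ I := integral_nonneg fun z => by positivity
    linarith
  set E := {z : ℝ | |z| ≤ B ∧ |q.eval z| ≤ 1} with hE
  have hEsub : E ⊆ Icc (-B) B := fun z hz => abs_le.1 hz.1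
  have hEm : MeasurableSet E := (measurableSet_le measurable_norm measurable_const).inter
    (measurableSet_le (f := fun z => |q.eval z|) (by fun_prop) measurable_const)
  have hEfin : volume E ≠ ⊤ := ne_top_of_le_ne_top (by simp) (measure_mono hEsub)
  have hTm : MeasurableSet {z : ℝ | B < |z|} := measurableSet_lt measurable_const measurable_norm
  have hmass : 1 / 4 ≤ A * volume.real E := by
    have hR1 : Integrable fun z => min 1 |q.eval z| * R z := by
      refine hR.integrable_mul (K := 1) (by fun_prop) fun z => ?_
      rw [abs_of_nonneg (by positivity)]
      exact min_le_left _ _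
    have hR2 : Integrable (E.indicator R) := hR.integrable.indicator hEm
    have hR3 : Integrable ({z : ℝ | B < |z|}.indicator R) := hR.integrable.indicator hTm
    have h1 : ∫ z, R z ≤ ∫ z, (min 1 |q.eval z| * R z + E.indicator R z +
        {z : ℝ | B < |z|}.indicator R z) := by
      refine integral_mono hR.integrable ((hR1.add hR2).add hR3) fun z => ?_
      have hz0 := hR.nonneg z
      have ha : 0 ≤ min 1 |q.eval z| * R z := by positivity
      have hb : 0 ≤ E.indicator R z := indicator_nonneg (fun z _ => hR.nonneg z) z
      have hc : 0 ≤ {z : ℝ | B < |z|}.indicator R z := indicator_nonneg (fun z _ => hR.nonneg z) z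
      show R z ≤ min 1 |q.eval z| * R z + E.indicator R z + {z : ℝ | B < |z|}.indicator R z
      by_cases h1 : B < |z|
      · rw [indicator_of_mem (s := {z : ℝ | B < |z|}) h1]
        linarith
      · push Not at h1
        by_cases h2 : |q.eval z| ≤ 1
        · rw [indicator_of_mem (s := E) ⟨h1, h2⟩]
          linarith
        · push Not at h2
          rw [min_eq_left h2.le] at ha ⊢
          linarith
    have h1' : ∫ z, R z ≤ (∫ z, min 1 |q.eval z| * R z) + (∫ z, E.indicator R z) +
        ∫ z, {z : ℝ | B < |z|}.indicator R z := by
      rw [← integral_add hR1 hR2]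
      exact h1.trans_eq (integral_add (hR1.add hR2) hR3)
    rw [hR.integral_eq_one, integral_indicator hEm, integral_indicator hTm] at h1'
    have h2 := htail R hR
    have h3 : ∫ z in E, R z ≤ A * volume.real E := by
      calc ∫ z in E, R z ≤ ∫ z in E, A :=
            setIntegral_mono hR.integrable.integrableOn
              (integrableOn_const hEfin) hR.le_const
        _ = _ := by rw [setIntegral_const, smul_eq_mul, mul_comm]
    linarith
  have hvol : ENNReal.ofReal (1 / (4 * A)) ≤ volume E := by
    rw [← ENNReal.ofReal_toReal hEfin]
    refine ENNReal.ofReal_le_ofReal ?_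
    rw [div_le_iff₀ (by positivity)]
    have : A * (volume E).toReal = A * volume.real E := rfl
    linarith
  have hqb : ∀ z, |q.eval z| ≤ C * (8 * A * (B + |z|)) ^ d := by
    intro z
    have hz := hrem q hq (-(B + |z|)) (B + |z|) (1 / (4 * A)) 1 E
      (hEsub.trans (Icc_subset_Icc (by linarith [abs_nonneg z]) (by linarith [abs_nonneg z])))
      (by positivity) hvol zero_le_one (fun x hx => hx.2) z
      ⟨by linarith [neg_abs_le z], by linarith [le_abs_self z]⟩
    have e1 : (B + |z| - -(B + |z|)) / (1 / (4 * A)) = 8 * A * (B + |z|) := by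
      field_simp; ring
    rw [e1, mul_one] at hz
    exact hz
  have : ∫ z, q.eval z ^ 2 * R z ≤ I := by
    refine integral_mono_of_nonneg (Filter.Eventually.of_forall fun z => ?_) hint
      (Filter.Eventually.of_forall fun z => ?_)
    · exact mul_nonneg (sq_nonneg _) (hR.nonneg z)
    · have h1 := hqb z
      have h2 : q.eval z ^ 2 ≤ (C * (8 * A * (B + |z|)) ^ d) ^ 2 := by
        rw [← sq_abs]; gcongr
      calc q.eval z ^ 2 * R z ≤ (C * (8 * A * (B + |z|)) ^ d) ^ 2 * (A * Real.exp (-|z|)) :=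
            mul_le_mul h2 (hR.le_exp z) (hR.nonneg z) (by positivity)
        _ = _ := by
          rw [mul_pow, ← pow_mul, mul_pow]; ring
  linarith

lemma integral_map_affine_withDensity {E : Type*} [NormedAddCommGroup E] [NormedSpace ℝ E]
    {A : ℝ} {R : ℝ → ℝ} (hR : IsNormalDensity A R) (x₀ L : ℝ) {g : ℝ → E} (hg : Continuous g) :
    ∫ x, g x ∂((volume.withDensity fun z => ENNReal.ofReal (R z)).map (fun z => x₀ + L * z)) =
      ∫ z, R z • g (x₀ + L * z) := by
  rw [integral_map (by fun_prop) hg.aestronglyMeasurable]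
  have h := integral_withDensity_eq_integral_toReal_smul₀ (μ := volume)
    (f := fun z => ENNReal.ofReal (R z)) (hR.measurable.ennreal_ofReal.aemeasurable)
    (Filter.Eventually.of_forall fun z => ENNReal.ofReal_lt_top) (fun z => g (x₀ + L * z))
  rw [h]
  refine integral_congr_ae (Filter.Eventually.of_forall fun z => ?_)
  simp only [ENNReal.toReal_ofReal (hR.nonneg z)]

lemma eval_comp_affine (q : Polynomial ℝ) (x₀ L z : ℝ) :
    (q.comp (Polynomial.C x₀ + Polynomial.C L * Polynomial.X)).eval z = q.eval (x₀ + L * z) := by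
  simp

lemma natDegree_comp_affine_le {q : Polynomial ℝ} {d : ℕ} (hq : q.natDegree ≤ d) (x₀ L : ℝ) :
    (q.comp (Polynomial.C x₀ + Polynomial.C L * Polynomial.X)).natDegree ≤ d := by
  refine Polynomial.natDegree_comp_le.trans ?_
  have : (Polynomial.C x₀ + Polynomial.C L * Polynomial.X : Polynomial ℝ).natDegree ≤ 1 := by
    compute_degree
  calc _ ≤ d * 1 := Nat.mul_le_mul hq this
    _ = d := mul_one d

theorem exists_moment_const_line (d : ℕ) : ∃ C : ℝ, 0 < C ∧
    ∀ ν : Measure ℝ, IsProbabilityMeasure ν → HasLogConcaveDensity ν →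
    ∀ q : Polynomial ℝ, q.natDegree ≤ d →
      ∫ x, min 1 |q.eval x| ∂ν ≤ 1 / 2 → ∫ x, q.eval x ^ 2 ∂ν ≤ C := by
  obtain ⟨A, hA, hnf⟩ := exists_normal_form
  obtain ⟨C, hC, hM⟩ := exists_normal_moment_const hA d
  refine ⟨C, hC, fun ν hν hlc q hq h => ?_⟩
  obtain ⟨x₀, L, R, hR, rfl⟩ := hnf ν hν hlc
  rw [integral_map_affine_withDensity hR x₀ L (by fun_prop)] at h ⊢
  have := hM R hR _ (natDegree_comp_affine_le hq x₀ L)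
  simp only [eval_comp_affine] at this
  simp only [smul_eq_mul, mul_comm (R _)] at h ⊢
  exact this h

lemma OrdConnected.exists_ae_eq_Ioc {S : Set ℝ} (hS : OrdConnected S) {a b : ℝ} (hab : a ≤ b)
    (hsub : S ⊆ Icc a b) : ∃ c e, a ≤ c ∧ c ≤ e ∧ e ≤ b ∧ S =ᵐ[volume] Ioc c e := by
  rcases S.eq_empty_or_nonempty with rfl | hne
  · exact ⟨a, a, le_rfl, le_rfl, hab, by simp⟩
  have hbb : BddBelow S := ⟨a, fun x hx => (hsub hx).1⟩
  have hba : BddAbove S := ⟨b, fun x hx => (hsub hx).2⟩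
  refine ⟨sInf S, sSup S, le_csInf hne fun x hx => (hsub hx).1, csInf_le_csSup hne hbb hba,
    csSup_le hne fun x hx => (hsub hx).2, ?_⟩
  have h1 : S ⊆ Icc (sInf S) (sSup S) := fun x hx => ⟨csInf_le hbb hx, le_csSup hba hx⟩
  have h2 : Ioo (sInf S) (sSup S) ⊆ S := by
    rintro x ⟨hx1, hx2⟩
    obtain ⟨u, hu, hux⟩ := exists_lt_of_csInf_lt hne hx1
    obtain ⟨v, hv, hxv⟩ := exists_lt_of_lt_csSup hne hx2
    exact hS.out hu hv ⟨hux.le, hxv.le⟩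
  have h3 : Ioo (sInf S) (sSup S) =ᵐ[volume] Icc (sInf S) (sSup S) := Ioo_ae_eq_Icc
  have h4 : Ioc (sInf S) (sSup S) =ᵐ[volume] Icc (sInf S) (sSup S) := Ioc_ae_eq_Icc
  refine Filter.EventuallyEq.trans ?_ h4.symm
  exact (Filter.EventuallyLE.antisymm (h1.eventuallyLE)
    (h3.symm.le.trans h2.eventuallyLE))

lemma IsNormalDensity.abs_le_of_le {A : ℝ} {R : ℝ → ℝ} (h : IsNormalDensity A R) {s z : ℝ}
    (hs : 0 < s) (hz : s ≤ R z) : |z| ≤ 2 * (√A * s ^ (-(1 / 2) : ℝ)) := by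
  have hA := h.pos
  have hp : 0 < s ^ (-(1 / 2) : ℝ) := Real.rpow_pos_of_pos hs _
  refine abs_le_of_sq_le_sq ?_ (by positivity)
  have h1 := hz.trans (h.le_exp z)
  have h2 := Real.pow_div_factorial_le_exp |z| (abs_nonneg z) 2
  rw [Real.exp_neg, ← div_eq_mul_inv, le_div_iff₀ (Real.exp_pos _)] at h1
  have h3 : s * (z ^ 2 / 2) ≤ A := by
    refine le_trans ?_ h1
    gcongr
    simpa using h2
  have h4 : (s ^ (-(1 / 2) : ℝ)) ^ 2 = s⁻¹ := by
    rw [← Real.rpow_natCast, ← Real.rpow_mul hs.le]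
    norm_num
    exact Real.rpow_neg_one s
  rw [mul_pow, mul_pow, h4, Real.sq_sqrt hA.le, ← mul_assoc, ← div_eq_mul_inv, le_div_iff₀ hs]
  nlinarith

lemma exists_normal_oscillatory_const {A B : ℝ} (hA : 0 < A) (hB : 0 < B) {d : ℕ} (hd : 2 ≤ d) :
    ∃ K : ℝ, 0 < K ∧ ∀ R, IsNormalDensity A R → ∀ q : Polynomial ℝ, q.natDegree ≤ d →
      ∀ x ∈ Icc (-B) B, ∀ y ∈ Icc (-B) B, ∀ τ, 0 < τ → τ ≤ q.eval x - q.eval y →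
        ‖∫ z, R z • Complex.exp (Complex.I * ((q.eval z : ℝ) : ℂ))‖ ≤ K * τ ^ (-(1 / (d : ℝ))) := by
  obtain ⟨C, hC, hosc⟩ := exists_oscillatory_const d hd
  set w : ℝ → ℝ := fun s => B + 2 * (√A * s ^ (-(1 / 2) : ℝ)) with hw
  have hwpos : ∀ s, 0 < s → B ≤ w s := fun s hs => by
    have hp : 0 < s ^ (-(1 / 2) : ℝ) := Real.rpow_pos_of_pos hs _
    have : 0 ≤ 2 * (√A * s ^ (-(1 / 2) : ℝ)) := by positivity
    show B ≤ B + _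
    linarith
  have hwint : IntegrableOn (fun s => C * (2 * w s)) (Ioc 0 A) := by
    have h1 : IntegrableOn (fun s : ℝ => s ^ (-(1 / 2) : ℝ)) (Ioc 0 A) := by
      rw [← intervalIntegrable_iff_integrableOn_Ioc_of_le hA.le]
      exact intervalIntegral.intervalIntegrable_rpow' (by norm_num)
    have h2 : IntegrableOn (fun _ : ℝ => B) (Ioc 0 A) := integrableOn_const (by simp)
    exact (((h2.add ((h1.const_mul _).const_mul _))).const_mul _).const_mul _
  set K := ∫ s in Ioc 0 A, C * (2 * w s) with hK
  have hK0 : 0 ≤ K := setIntegral_nonneg measurableSet_Ioc fun s hs => by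
    have := hwpos s hs.1
    have : 0 < w s := by linarith
    positivity
  refine ⟨K + 1, by linarith, fun R hR q hq x hx y hy τ hτ hxy => ?_⟩
  set e : ℝ → ℂ := fun z => Complex.exp (Complex.I * ((q.eval z : ℝ) : ℂ)) with he
  have hec : Continuous e := by fun_prop
  have hen : ∀ z, ‖e z‖ = 1 := fun z => by
    rw [he]; simp only; rw [mul_comm, Complex.norm_exp_ofReal_mul_I]
  set F : ℝ → ℝ → ℂ := fun z s => if s ≤ R z then e z else 0 with hF
  have hFz : ∀ z, R z • e z = ∫ s in Ioc 0 A, F z s := by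
    intro z
    have h1 : F z = (Iic (R z)).indicator fun _ => e z := by
      ext s; simp [hF, indicator_apply]
    rw [h1, setIntegral_indicator measurableSet_Iic, Ioc_inter_Iic, min_eq_right (hR.le_const z),
      setIntegral_const]
    congr 1
    simp [hR.nonneg z]
  have hFm : Measurable (Function.uncurry F) :=
    Measurable.ite (measurableSet_le measurable_snd (hR.measurable.comp measurable_fst))
      (hec.measurable.comp measurable_fst) measurable_const
  have hFn : ∀ z s, ‖F z s‖ = if s ≤ R z then 1 else 0 := by
    intro z s
    simp only [hF]
    split_ifs
    · exact hen z
    · simp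
  have hFint : Integrable (Function.uncurry F) (volume.prod (volume.restrict (Ioc 0 A))) := by
    rw [integrable_prod_iff hFm.aestronglyMeasurable]
    constructor
    · refine Filter.Eventually.of_forall fun z => ?_
      refine Integrable.of_bound (hFm.comp measurable_prodMk_left).aestronglyMeasurable 1
        (Filter.Eventually.of_forall fun s => ?_)
      show ‖F z s‖ ≤ 1
      rw [hFn]
      split_ifs <;> norm_num
    · refine hR.integrable.congr (Filter.Eventually.of_forall fun z => ?_)
      show R z = ∫ s in Ioc 0 A, ‖F z s‖
      have h1 : (fun s => ‖F z s‖) = (Iic (R z)).indicator fun _ => (1 : ℝ) := by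
        ext s; rw [hFn]; simp [indicator_apply]
      rw [h1, setIntegral_indicator measurableSet_Iic, Ioc_inter_Iic, min_eq_right (hR.le_const z),
        setIntegral_const]
      simp [hR.nonneg z]
  have hmain : ∀ s ∈ Ioc 0 A, ‖∫ z, F z s‖ ≤ C * (2 * w s) * τ ^ (-(1 / (d : ℝ))) := by
    intro s hs
    have hws := hwpos s hs.1
    have hsub : {z | s ≤ R z} ⊆ Icc (-w s) (w s) := by
      intro z hz
      have := hR.abs_le_of_le hs.1 hz
      exact abs_le.1 (this.trans (by simp only [hw]; linarith))
    obtain ⟨c, f, hc, hcf, hf, hae⟩ := OrdConnected.exists_ae_eq_Ioc (hR.ordConnected s)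
      (by linarith) hsub
    have h1 : (fun z => F z s) = {z | s ≤ R z}.indicator e := by
      ext z; simp [hF, indicator_apply]
    have hbd := hosc q hq (-w s) (w s) τ x y hτ
      ⟨by linarith [hx.1], by linarith [hx.2]⟩ ⟨by linarith [hy.1], by linarith [hy.2]⟩ hxy c f hc
      hcf hf
    rw [h1, integral_indicator (measurableSet_le measurable_const hR.measurable),
      setIntegral_congr_set hae, ← intervalIntegral.integral_of_le hcf]
    calc _ ≤ _ := hbd
      _ = _ := by ring
  calc ‖∫ z, R z • e z‖ = ‖∫ s in Ioc 0 A, ∫ z, F z s‖ := by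
        simp_rw [hFz]
        rw [integral_integral_swap hFint]
    _ ≤ ∫ s in Ioc 0 A, C * (2 * w s) * τ ^ (-(1 / (d : ℝ))) := by
        refine norm_integral_le_of_norm_le (hwint.mul_const _) ?_
        filter_upwards [ae_restrict_mem measurableSet_Ioc] with s hs using hmain s hs
    _ = K * τ ^ (-(1 / (d : ℝ))) := integral_mul_const _ _
    _ ≤ _ := by
        have : 0 ≤ τ ^ (-(1 / (d : ℝ))) := Real.rpow_nonneg hτ.le _
        nlinarith

/-- Truncation to `[-1, 1]`. -/
def clamp (y : ℝ) : ℝ := max (-1) (min 1 y)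

@[fun_prop]
lemma continuous_clamp : Continuous clamp :=
  continuous_const.max (continuous_const.min continuous_id)

lemma abs_clamp_le (y : ℝ) : |clamp y| ≤ 1 :=
  abs_le.2 ⟨le_max_left _ _, max_le (by norm_num) (min_le_left _ _)⟩

lemma clamp_of_one_le {y : ℝ} (h : 1 ≤ y) : clamp y = 1 := by
  rw [clamp, min_eq_left h]; norm_num

lemma clamp_neg (y : ℝ) : clamp (-y) = -clamp y := by
  simp only [clamp, max_def, min_def]
  split_ifs <;> linarith

lemma IsNormalDensity.exists_lt_one {A B p : ℝ} {R : ℝ → ℝ} (hR : IsNormalDensity A R)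
    (hp : 0 < p) (htail : ∫ z in {z : ℝ | B < |z|}, R z ≤ p / 4) {g : ℝ → ℝ} (hg : Continuous g)
    (h : ∫ z, clamp (g z) * R z ≤ 1 - p) : ∃ z, |z| ≤ B ∧ g z < 1 := by
  by_contra hcon
  push Not at hcon
  have hTm : MeasurableSet {z : ℝ | B < |z|} := measurableSet_lt measurable_const measurable_norm
  have hi : Integrable fun z => clamp (g z) * R z :=
    hR.integrable_mul (by fun_prop) (K := 1) fun z => abs_clamp_le _
  have hi2 : Integrable ({z : ℝ | B < |z|}.indicator R) := hR.integrable.indicator hTm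
  have h1 : ∫ z, R z ≤ ∫ z, (clamp (g z) * R z + 2 * {z : ℝ | B < |z|}.indicator R z) := by
    refine integral_mono hR.integrable (hi.add (hi2.const_mul 2)) fun z => ?_
    have hz0 := hR.nonneg z
    show R z ≤ clamp (g z) * R z + 2 * {z : ℝ | B < |z|}.indicator R z
    by_cases h1 : B < |z|
    · rw [indicator_of_mem (s := {z : ℝ | B < |z|}) h1]
      have := (abs_le.1 (abs_clamp_le (g z))).1
      nlinarith
    · rw [indicator_of_notMem (s := {z : ℝ | B < |z|}) h1,
        clamp_of_one_le (hcon z (not_lt.1 h1))]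
      linarith
  rw [integral_add hi (hi2.const_mul 2), integral_const_mul, integral_indicator hTm,
    hR.integral_eq_one] at h1
  linarith

lemma exists_normal_clamp_const {A : ℝ} (hA : 0 < A) {d : ℕ} (hd : 2 ≤ d) {p : ℝ} (hp : 0 < p) :
    ∃ C : ℝ, 0 < C ∧ ∀ R, IsNormalDensity A R → ∀ q : Polynomial ℝ, q.natDegree ≤ d →
      |∫ z, clamp (q.eval z) * R z| ≤ 1 - p →
      ‖∫ z, R z • Complex.exp (Complex.I * ((q.eval z : ℝ) : ℂ))‖ ≤
        C * ∫ z, (1 + |q.eval z|) ^ (-(1 / (d : ℝ))) * R z := by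
  obtain ⟨B, hB, htail⟩ := exists_normal_tail A (show 0 < p / 4 by positivity)
  obtain ⟨K, hK, hosc⟩ := exists_normal_oscillatory_const hA hB hd
  refine ⟨4 * (K + 1), by positivity, fun R hR q hq h => ?_⟩
  have hp1 : p ≤ 1 := by linarith [abs_nonneg (∫ z, clamp (q.eval z) * R z)]
  have hαdef : 0 < 1 / (d : ℝ) ∧ 1 / (d : ℝ) ≤ 1 / 2 := by
    have : (2 : ℝ) ≤ d := by exact_mod_cast hd
    exact ⟨by positivity, by gcongr⟩
  set α := 1 / (d : ℝ) with hα
  obtain ⟨hα0, hα1⟩ := hαdef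
  have hne : (Icc (-B) B).Nonempty := ⟨0, by constructor <;> linarith⟩
  have hqc : Continuous fun z => q.eval z := by fun_prop
  obtain ⟨x, hx, hxmax⟩ := isCompact_Icc.exists_isMaxOn hne hqc.continuousOn
  obtain ⟨y, hy, hymin⟩ := isCompact_Icc.exists_isMinOn hne hqc.continuousOn
  set τ := q.eval x - q.eval y with hτ
  have hτ0 : 0 ≤ τ := sub_nonneg.2 (hymin hx)
  obtain ⟨z₁, hz₁, hz₁'⟩ := hR.exists_lt_one hp (htail R hR) hqc (abs_le.1 h).2
  obtain ⟨z₂, hz₂, hz₂'⟩ := hR.exists_lt_one (g := fun z => -q.eval z) hp (htail R hR)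
    (by fun_prop) (by
      simp only [clamp_neg, neg_mul]
      rw [integral_neg]
      linarith [(abs_le.1 h).1])
  have hqb : ∀ z, |z| ≤ B → |q.eval z| ≤ 1 + τ := by
    intro z hz
    have a1 := hxmax (abs_le.1 hz)
    have a2 := hymin (abs_le.1 hz)
    have a3 := hymin (abs_le.1 hz₁)
    have a4 := hxmax (abs_le.1 hz₂)
    simp only [mem_ofPred_eq] at a1 a2 a3 a4
    rw [abs_le]
    constructor <;> linarith
  have hTm : MeasurableSet {z : ℝ | B < |z|} := measurableSet_lt measurable_const measurable_norm
  have hτα : 0 ≤ (2 + τ) ^ (-α) := Real.rpow_nonneg (by linarith) _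
  have hcont : Continuous fun z => (1 + |q.eval z|) ^ (-α) := by
    refine Continuous.rpow_const (by fun_prop) fun z => Or.inl ?_
    positivity
  have hlow : 3 / 4 * (2 + τ) ^ (-α) ≤ ∫ z, (1 + |q.eval z|) ^ (-α) * R z := by
    have hi : Integrable fun z => (1 + |q.eval z|) ^ (-α) * R z := by
      refine hR.integrable_mul hcont.measurable (K := 1) fun z => ?_
      rw [abs_of_nonneg (by positivity)]
      exact Real.rpow_le_one_of_one_le_of_nonpos (by linarith [abs_nonneg (q.eval z)])
        (by linarith)
    have hi2 : Integrable ({z : ℝ | B < |z|}.indicator R) := hR.integrable.indicator hTm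
    have h1 : ∫ z, (2 + τ) ^ (-α) * (R z - {z : ℝ | B < |z|}.indicator R z) ≤
        ∫ z, (1 + |q.eval z|) ^ (-α) * R z := by
      refine integral_mono ((hR.integrable.sub hi2).const_mul _) hi fun z => ?_
      have hz0 := hR.nonneg z
      show (2 + τ) ^ (-α) * (R z - {z : ℝ | B < |z|}.indicator R z) ≤
        (1 + |q.eval z|) ^ (-α) * R z
      by_cases h1 : B < |z|
      · rw [indicator_of_mem (s := {z : ℝ | B < |z|}) h1, sub_self, mul_zero]
        positivity
      · rw [indicator_of_notMem (s := {z : ℝ | B < |z|}) h1, sub_zero]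
        refine mul_le_mul_of_nonneg_right ?_ hz0
        refine Real.rpow_le_rpow_of_nonpos (by positivity) ?_ (by linarith)
        linarith [hqb z (not_lt.1 h1)]
    rw [integral_const_mul, integral_sub hR.integrable hi2, integral_indicator hTm,
      hR.integral_eq_one] at h1
    have := htail R hR
    nlinarith
  have hup : ‖∫ z, R z • Complex.exp (Complex.I * ((q.eval z : ℝ) : ℂ))‖ ≤
      3 * (K + 1) * (2 + τ) ^ (-α) := by
    have h3 : (3 : ℝ) ^ α ≤ 3 := by
      calc (3 : ℝ) ^ α ≤ 3 ^ (1 : ℝ) := Real.rpow_le_rpow_of_exponent_le (by norm_num) (by linarith)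
        _ = 3 := by norm_num
    have hkey : ∀ u, 0 < u → 2 + τ ≤ 3 * u → u ^ (-α) ≤ 3 * (2 + τ) ^ (-α) := by
      intro u hu hle
      have e1 : (3 * u) ^ (-α) ≤ (2 + τ) ^ (-α) :=
        Real.rpow_le_rpow_of_nonpos (by linarith) hle (by linarith)
      have e2 : u ^ (-α) = 3 ^ α * (3 * u) ^ (-α) := by
        rw [Real.mul_rpow (by norm_num) hu.le, ← mul_assoc, ← Real.rpow_add (by norm_num)]
        simp
      rw [e2]
      have : 0 ≤ (3 * u) ^ (-α) := by positivity
      exact mul_le_mul h3 e1 this (by norm_num)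
    rcases le_or_gt τ 1 with hτ1 | hτ1
    · have h1 : ‖∫ z, R z • Complex.exp (Complex.I * ((q.eval z : ℝ) : ℂ))‖ ≤ 1 := by
        rw [← hR.integral_eq_one]
        refine norm_integral_le_of_norm_le hR.integrable (Filter.Eventually.of_forall fun z => ?_)
        rw [norm_smul, mul_comm Complex.I, Complex.norm_exp_ofReal_mul_I, mul_one,
          Real.norm_of_nonneg (hR.nonneg z)]
      have h2 := hkey 1 one_pos (by linarith)
      rw [Real.one_rpow] at h2
      nlinarith
    · have h1 := hosc R hR q hq x hx y hy τ (by linarith) le_rfl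
      have h2 := hkey τ (by linarith) (by linarith)
      nlinarith
  nlinarith

theorem exists_clamp_const_line {d : ℕ} (hd : 2 ≤ d) {p : ℝ} (hp : 0 < p) : ∃ C : ℝ, 0 < C ∧
    ∀ ν : Measure ℝ, IsProbabilityMeasure ν → HasLogConcaveDensity ν →
    ∀ q : Polynomial ℝ, q.natDegree ≤ d → |∫ x, clamp (q.eval x) ∂ν| ≤ 1 - p →
      ‖∫ x, Complex.exp (Complex.I * ((q.eval x : ℝ) : ℂ)) ∂ν‖ ≤
        C * ∫ x, (1 + |q.eval x|) ^ (-(1 / (d : ℝ))) ∂ν := by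
  obtain ⟨A, hA, hnf⟩ := exists_normal_form
  obtain ⟨C, hC, hM⟩ := exists_normal_clamp_const hA hd hp
  refine ⟨C, hC, fun ν hν hlc q hq h => ?_⟩
  obtain ⟨x₀, L, R, hR, rfl⟩ := hnf ν hν hlc
  have hcont : Continuous fun z => (1 + |q.eval z|) ^ (-(1 / (d : ℝ))) := by
    refine Continuous.rpow_const (by fun_prop) fun z => Or.inl ?_
    positivity
  rw [integral_map_affine_withDensity hR x₀ L (by fun_prop)] at h
  rw [integral_map_affine_withDensity hR x₀ L (by fun_prop),
    integral_map_affine_withDensity hR x₀ L hcont]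
  have := hM R hR _ (natDegree_comp_affine_le hq x₀ L)
  simp only [eval_comp_affine] at this
  simp only [smul_eq_mul, mul_comm (R _)] at h ⊢
  exact this h

section

open scoped Pointwise

/-- The Brunn-Minkowski inequality on the line. -/
lemma brunn_minkowski_line {a b : ℝ} (ha : 0 < a) (hb : 0 < b) {S T W : Set ℝ}
    (hS : MeasurableSet S) (hT : MeasurableSet T) (hSne : S.Nonempty) (hTne : T.Nonempty)
    (hW : ∀ x ∈ S, ∀ y ∈ T, a * x + b * y ∈ W) :
    ENNReal.ofReal a * volume S + ENNReal.ofReal b * volume T ≤ volume W := by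
  have key : ∀ K ⊆ S, IsCompact K → K.Nonempty → ∀ L ⊆ T, IsCompact L → L.Nonempty →
      ENNReal.ofReal a * volume K + ENNReal.ofReal b * volume L ≤ volume W := by
    intro K hKS hK hKne L hLT hL hLne
    obtain ⟨x₁, hx₁, hx₁'⟩ := hK.exists_isMaxOn hKne continuousOn_id
    obtain ⟨y₀, hy₀, hy₀'⟩ := hL.exists_isMinOn hLne continuousOn_id
    set K' := (fun z => b * y₀ + z) '' (a • K) with hK'
    set L' := (fun z => a * x₁ + z) '' (b • L) with hL'
    have hvK : volume K' = ENNReal.ofReal a * volume K := by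
      rw [hK', image_add_left, measure_preimage_add, Measure.addHaar_smul]
      simp [abs_of_pos ha]
    have hvL : volume L' = ENNReal.ofReal b * volume L := by
      rw [hL', image_add_left, measure_preimage_add, Measure.addHaar_smul]
      simp [abs_of_pos hb]
    have hLc : IsCompact L' := (hL.smul b).image (by fun_prop)
    have hint : K' ∩ L' ⊆ {a * x₁ + b * y₀} := by
      rintro _ ⟨⟨_, ⟨x, hx, rfl⟩, rfl⟩, ⟨_, ⟨y, hy, rfl⟩, he⟩⟩
      have h1 : x ≤ x₁ := hx₁' hx
      have h2 : y₀ ≤ y := hy₀' hy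
      simp only [smul_eq_mul, mem_singleton_iff] at he ⊢
      have h3 := mul_le_mul_of_nonneg_left h1 ha.le
      have h4 := mul_le_mul_of_nonneg_left h2 hb.le
      linarith
    have hae : AEDisjoint volume K' L' := measure_mono_null hint (by simp)
    rw [← hvK, ← hvL, ← measure_union₀ hLc.measurableSet.nullMeasurableSet hae]
    refine measure_mono (union_subset ?_ ?_)
    · rintro _ ⟨_, ⟨x, hx, rfl⟩, rfl⟩
      have := hW x (hKS hx) y₀ (hLT hy₀)
      simpa [add_comm] using this
    · rintro _ ⟨_, ⟨y, hy, rfl⟩, rfl⟩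
      exact hW x₁ (hKS hx₁) y (hLT hy)
  obtain ⟨s, hs⟩ := hSne
  obtain ⟨t, ht⟩ := hTne
  have key' : ∀ K ⊆ S, IsCompact K → ∀ L ⊆ T, IsCompact L →
      ENNReal.ofReal a * volume K + ENNReal.ofReal b * volume L ≤ volume W := by
    intro K hKS hK L hLT hL
    refine le_trans ?_ (key (insert s K) (insert_subset hs hKS) (hK.insert s) (insert_nonempty _ _)
      (insert t L) (insert_subset ht hLT) (hL.insert t) (insert_nonempty _ _))
    gcongr <;> exact subset_insert _ _
  have hv : ∀ Z : Set ℝ, MeasurableSet Z → volume Z = ⨆ K, ⨆ _ : K ⊆ Z ∧ IsCompact K, volume K := by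
    intro Z hZ
    rw [hZ.measure_eq_iSup_isCompact]
    simp only [iSup_and]
  rw [hv S hS, hv T hT]
  simp only [ENNReal.mul_iSup]
  exact ENNReal.biSup_add_biSup_le' ⟨∅, empty_subset _, isCompact_empty⟩
    ⟨∅, empty_subset _, isCompact_empty⟩ fun K hK L hL => key' K hK.1 hK.2 L hL.1 hL.2

lemma ENNReal.rpow_mul_rpow_le_add {a b : ℝ} (ha : 0 < a) (hb : 0 < b) (hab : a + b = 1)
    (x y : ENNReal) : x ^ a * y ^ b ≤ ENNReal.ofReal a * x + ENNReal.ofReal b * y := by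
  have ha' : ENNReal.ofReal a ≠ 0 := by simpa using ha
  have hb' : ENNReal.ofReal b ≠ 0 := by simpa using hb
  by_cases hx : x = ⊤
  · rw [hx, ENNReal.mul_top ha', top_add]; exact le_top
  by_cases hy : y = ⊤
  · rw [hy, ENNReal.mul_top hb', add_top]; exact le_top
  have h := Real.geom_mean_le_arith_mean2_weighted ha.le hb.le
    (ENNReal.toReal_nonneg (a := x)) (ENNReal.toReal_nonneg (a := y)) hab
  rw [← ENNReal.ofReal_toReal hx, ← ENNReal.ofReal_toReal hy,
    ENNReal.ofReal_rpow_of_nonneg ENNReal.toReal_nonneg ha.le,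
    ENNReal.ofReal_rpow_of_nonneg ENNReal.toReal_nonneg hb.le, ← ENNReal.ofReal_mul (by positivity),
    ← ENNReal.ofReal_mul (by positivity), ← ENNReal.ofReal_mul (by positivity),
    ← ENNReal.ofReal_add (by positivity) (by positivity)]
  exact ENNReal.ofReal_le_ofReal h

lemma prekopa_leindler_normalized {a b : ℝ} (ha : 0 < a) (hb : 0 < b) (hab : a + b = 1)
    {u v w : ℝ → ℝ} (hu : Measurable u) (hv : Measurable v) (hw : Measurable w)
    (hu0 : ∀ x, 0 ≤ u x) (hv0 : ∀ x, 0 ≤ v x) (hw0 : ∀ x, 0 ≤ w x)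
    (hu1 : ∀ x, u x ≤ 1) (hv1 : ∀ x, v x ≤ 1)
    (hus : ∀ t < 1, ∃ x, t < u x) (hvs : ∀ t < 1, ∃ x, t < v x)
    (h : ∀ x y, u x ^ a * v y ^ b ≤ w (a * x + b * y)) :
    ENNReal.ofReal a * (∫⁻ x, ENNReal.ofReal (u x)) + ENNReal.ofReal b *
      (∫⁻ x, ENNReal.ofReal (v x)) ≤ ∫⁻ x, ENNReal.ofReal (w x) := by
  rw [lintegral_eq_lintegral_meas_lt _ (Filter.Eventually.of_forall hu0) hu.aemeasurable,
    lintegral_eq_lintegral_meas_lt _ (Filter.Eventually.of_forall hv0) hv.aemeasurable,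
    lintegral_eq_lintegral_meas_lt _ (Filter.Eventually.of_forall hw0) hw.aemeasurable,
    ← lintegral_const_mul' _ _ ENNReal.ofReal_ne_top,
    ← lintegral_const_mul' _ _ ENNReal.ofReal_ne_top, ← lintegral_add_left]
  · refine setLIntegral_mono' measurableSet_Ioi fun t ht => ?_
    have ht0 : 0 < t := ht
    rcases lt_or_ge t 1 with ht1 | ht1
    · refine brunn_minkowski_line ha hb (measurableSet_lt measurable_const hu)
        (measurableSet_lt measurable_const hv) (hus t ht1) (hvs t ht1) fun x hx y hy => ?_
      refine lt_of_lt_of_le ?_ (h x y)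
      calc t = t ^ a * t ^ b := by rw [← Real.rpow_add ht0, hab, Real.rpow_one]
        _ < _ := mul_lt_mul'' (Real.rpow_lt_rpow ht0.le hx ha) (Real.rpow_lt_rpow ht0.le hy hb)
          (by positivity) (by positivity)
    · have h1 : {x | t < u x} = ∅ := by
        ext x; simpa using (hu1 x).trans ht1
      have h2 : {x | t < v x} = ∅ := by
        ext x; simpa using (hv1 x).trans ht1
      rw [h1, h2]; simp
  · refine Measurable.const_mul (Antitone.measurable fun s t hst => ?_) _
    exact measure_mono fun x hx => lt_of_le_of_lt hst hx

lemma prekopa_leindler_bounded {a b : ℝ} (ha : 0 < a) (hb : 0 < b) (hab : a + b = 1)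
    {u v w : ℝ → ENNReal} (hu : Measurable u) (hv : Measurable v) (hw : Measurable w)
    {N : ENNReal} (hN : N ≠ ⊤) (huN : ∀ x, u x ≤ N) (hvN : ∀ x, v x ≤ N)
    (h : ∀ x y, u x ^ a * v y ^ b ≤ w (a * x + b * y)) :
    (∫⁻ x, u x) ^ a * (∫⁻ x, v x) ^ b ≤ ∫⁻ x, w x := by
  set U := ⨆ x, u x with hU
  set V := ⨆ x, v x with hV
  have hUt : U ≠ ⊤ := ne_top_of_le_ne_top hN (iSup_le huN)
  have hVt : V ≠ ⊤ := ne_top_of_le_ne_top hN (iSup_le hvN)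
  by_cases hU0 : U = 0
  · have : ∀ x, u x = 0 := fun x => le_antisymm ((le_iSup u x).trans hU0.le) bot_le
    simp [this, ha]
  by_cases hV0 : V = 0
  · have : ∀ x, v x = 0 := fun x => le_antisymm ((le_iSup v x).trans hV0.le) bot_le
    simp [this, hb]
  set P := U ^ a * V ^ b with hP
  have hUa0 : U ^ a ≠ 0 := by simp [ENNReal.rpow_eq_zero_iff, hU0, hUt]
  have hVb0 : V ^ b ≠ 0 := by simp [ENNReal.rpow_eq_zero_iff, hV0, hVt]
  have hP0 : P ≠ 0 := mul_ne_zero hUa0 hVb0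
  have hPt : P ≠ ⊤ := ENNReal.mul_ne_top (ENNReal.rpow_ne_top_of_nonneg ha.le hUt)
    (ENNReal.rpow_ne_top_of_nonneg hb.le hVt)
  have hu1 : ∀ x, u x / U ≤ 1 := fun x => ENNReal.div_le_of_le_mul (by
    rw [one_mul]; exact le_iSup u x)
  have hv1 : ∀ x, v x / V ≤ 1 := fun x => ENNReal.div_le_of_le_mul (by
    rw [one_mul]; exact le_iSup v x)
  have hsup : ∀ (f : ℝ → ENNReal) (F : ENNReal), F = ⨆ x, f x → F ≠ 0 → F ≠ ⊤ →
      ∀ t < 1, ∃ x, t < (f x / F).toReal := by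
    intro f F hF hF0 hFt t ht
    by_cases ht0 : t < 0
    · exact ⟨0, ht0.trans_le ENNReal.toReal_nonneg⟩
    push Not at ht0
    have : ENNReal.ofReal t * F < ⨆ x, f x := by
      rw [← hF]
      calc ENNReal.ofReal t * F < 1 * F :=
            (ENNReal.mul_lt_mul_iff_left hF0 hFt).2 (by simpa using ht)
        _ = F := one_mul F
    obtain ⟨x, hx⟩ := lt_iSup_iff.1 this
    refine ⟨x, ?_⟩
    have hfx : f x ≤ F := hF ▸ le_iSup f x
    have h1 : ENNReal.ofReal t < f x / F := by
      rwa [ENNReal.lt_div_iff_mul_lt (Or.inl hF0) (Or.inl hFt)]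
    have h2 : f x / F ≠ ⊤ := ENNReal.div_ne_top (ne_top_of_le_ne_top hFt hfx) hF0
    exact (ENNReal.ofReal_lt_iff_lt_toReal ht0 h2).1 h1
  have hmain := prekopa_leindler_normalized ha hb hab (u := fun x => (u x / U).toReal)
    (v := fun x => (v x / V).toReal) (w := fun x => (min 1 (w x / P)).toReal)
    (hu.div_const U).ennreal_toReal (hv.div_const V).ennreal_toReal
    ((measurable_const.min (hw.div_const P)).ennreal_toReal)
    (fun _ => ENNReal.toReal_nonneg) (fun _ => ENNReal.toReal_nonneg)
    (fun _ => ENNReal.toReal_nonneg)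
    (fun x => ENNReal.toReal_le_of_le_ofReal zero_le_one (by simpa using hu1 x))
    (fun x => ENNReal.toReal_le_of_le_ofReal zero_le_one (by simpa using hv1 x))
    (hsup u U rfl hU0 hUt) (hsup v V rfl hV0 hVt) (fun x y => by
      rw [ENNReal.toReal_rpow, ENNReal.toReal_rpow, ← ENNReal.toReal_mul]
      refine ENNReal.toReal_mono (ne_top_of_le_ne_top ENNReal.one_ne_top (min_le_left _ _))
        (le_min ?_ ?_)
      · calc (u x / U) ^ a * (v y / V) ^ b ≤ 1 ^ a * 1 ^ b := by
              gcongr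
              · exact hu1 x
              · exact hv1 y
          _ = 1 := by simp
      · rw [ENNReal.le_div_iff_mul_le (Or.inl hP0) (Or.inl hPt)]
        refine le_trans (le_of_eq ?_) (h x y)
        calc (u x / U) ^ a * (v y / V) ^ b * P = ((u x / U) ^ a * U ^ a) * ((v y / V) ^ b * V ^ b) := by
              rw [hP]; ring
          _ = _ := by
            rw [← ENNReal.mul_rpow_of_nonneg _ _ ha.le, ← ENNReal.mul_rpow_of_nonneg _ _ hb.le,
              ENNReal.div_mul_cancel hU0 hUt, ENNReal.div_mul_cancel hV0 hVt])
  have e1 : ∀ (f : ℝ → ENNReal) (F : ENNReal), (∀ x, f x / F ≤ 1) → F ≠ 0 → F ≠ ⊤ →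
      ∫⁻ x, f x = F * ∫⁻ x, ENNReal.ofReal ((f x / F).toReal) := by
    intro f F hf hF0 hFt
    rw [← lintegral_const_mul' _ _ hFt]
    refine lintegral_congr fun x => ?_
    rw [ENNReal.ofReal_toReal (ne_top_of_le_ne_top ENNReal.one_ne_top (hf x)), mul_comm,
      ENNReal.div_mul_cancel hF0 hFt]
  rw [e1 u U hu1 hU0 hUt, e1 v V hv1 hV0 hVt, ENNReal.mul_rpow_of_nonneg _ _ ha.le,
    ENNReal.mul_rpow_of_nonneg _ _ hb.le]
  set Iu := ∫⁻ x, ENNReal.ofReal ((u x / U).toReal)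
  set Iv := ∫⁻ x, ENNReal.ofReal ((v x / V).toReal)
  calc U ^ a * Iu ^ a * (V ^ b * Iv ^ b) = P * (Iu ^ a * Iv ^ b) := by rw [hP]; ring
    _ ≤ P * ∫⁻ x, ENNReal.ofReal ((min 1 (w x / P)).toReal) := by
      gcongr
      exact (ENNReal.rpow_mul_rpow_le_add ha hb hab _ _).trans hmain
    _ = ∫⁻ x, P * ENNReal.ofReal ((min 1 (w x / P)).toReal) :=
      (lintegral_const_mul' _ _ hPt).symm
    _ ≤ ∫⁻ x, w x := by
      refine lintegral_mono fun x => ?_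
      rw [ENNReal.ofReal_toReal (ne_top_of_le_ne_top ENNReal.one_ne_top (min_le_left _ _))]
      calc P * min 1 (w x / P) ≤ P * (w x / P) := by gcongr; exact min_le_right _ _
        _ = w x := by rw [mul_comm, ENNReal.div_mul_cancel hP0 hPt]

lemma tendsto_lintegral_min_nat {f : ℝ → ENNReal} (hf : Measurable f) :
    Filter.Tendsto (fun n : ℕ => ∫⁻ x, min (f x) n) Filter.atTop (nhds (∫⁻ x, f x)) := by
  refine lintegral_tendsto_of_tendsto_of_monotone
    (fun n => (hf.min measurable_const).aemeasurable) ?_ ?_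
  · exact Filter.Eventually.of_forall fun x m n hmn =>
      min_le_min_left _ (by exact_mod_cast hmn)
  · refine Filter.Eventually.of_forall fun x => ?_
    have := (tendsto_const_nhds (x := f x)).min ENNReal.tendsto_nat_nhds_top
    simpa using this

theorem prekopa_leindler_line {a b : ℝ} (ha : 0 < a) (hb : 0 < b) (hab : a + b = 1)
    {u v w : ℝ → ENNReal} (hu : Measurable u) (hv : Measurable v) (hw : Measurable w)
    (h : ∀ x y, u x ^ a * v y ^ b ≤ w (a * x + b * y)) :
    (∫⁻ x, u x) ^ a * (∫⁻ x, v x) ^ b ≤ ∫⁻ x, w x := by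
  have hu' := (ENNReal.continuous_rpow_const (y := a)).continuousAt.tendsto.comp
    (tendsto_lintegral_min_nat hu)
  have hv' := (ENNReal.continuous_rpow_const (y := b)).continuousAt.tendsto.comp
    (tendsto_lintegral_min_nat hv)
  refine ENNReal.mul_le_of_forall_lt fun p hp q hq => ?_
  obtain ⟨n, hn1, hn2⟩ := ((hu'.eventually (lt_mem_nhds hp)).and (hv'.eventually (lt_mem_nhds hq))).exists
  refine (mul_le_mul' hn1.le hn2.le).trans ?_
  refine prekopa_leindler_bounded ha hb hab (hu.min measurable_const) (hv.min measurable_const) hw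
    (N := n) (ENNReal.natCast_ne_top n) (fun x => min_le_right _ _) (fun x => min_le_right _ _)
    fun x y => le_trans ?_ (h x y)
  gcongr <;> exact min_le_left _ _

end

section

open scoped Pointwise

lemma lintegral_insertNth {n : ℕ} (i : Fin (n + 1)) {f : (Fin (n + 1) → ℝ) → ENNReal}
    (hf : Measurable f) :
    ∫⁻ x, f x = ∫⁻ s : ℝ, ∫⁻ y : Fin n → ℝ, f (i.insertNth s y) := by
  have hmp := (volume_preserving_piFinSuccAbove (fun _ : Fin (n + 1) => ℝ) i).symm
  rw [← hmp.lintegral_comp hf, Measure.volume_eq_prod, lintegral_prod]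
  · rfl
  · exact (hf.comp (MeasurableEquiv.measurable _)).aemeasurable

lemma measurable_insertNth {n : ℕ} (i : Fin (n + 1)) :
    Measurable fun p : ℝ × (Fin n → ℝ) => (i.insertNth p.1 p.2 : Fin (n + 1) → ℝ) :=
  (MeasurableEquiv.piFinSuccAbove (fun _ : Fin (n + 1) => ℝ) i).symm.measurable

lemma insertNth_combo {n : ℕ} (i : Fin (n + 1)) (a b s t : ℝ) (y z : Fin n → ℝ) :
    (i.insertNth (a * s + b * t) (a • y + b • z) : Fin (n + 1) → ℝ) =
      a • i.insertNth s y + b • i.insertNth t z := by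
  ext j
  refine i.succAboveCases ?_ (fun k => ?_) j <;> simp

/-- The Prékopa-Leindler inequality. -/
theorem prekopa_leindler {a b : ℝ} (ha : 0 < a) (hb : 0 < b) (hab : a + b = 1) (n : ℕ) :
    ∀ u v w : (Fin n → ℝ) → ENNReal, Measurable u → Measurable v → Measurable w →
    (∀ x y, u x ^ a * v y ^ b ≤ w (a • x + b • y)) →
    (∫⁻ x, u x) ^ a * (∫⁻ x, v x) ^ b ≤ ∫⁻ x, w x := by
  induction n with
  | zero =>
    intro u v w hu hv hw h
    simp only [lintegral_unique, Measure.volume_pi_eq_dirac 0]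
    have h0 := h default default
    rw [Subsingleton.elim (a • default + b • default) (default : Fin 0 → ℝ)] at h0
    simp only [measure_univ, mul_one]
    convert h0
  | succ n ih =>
    intro u v w hu hv hw h
    rw [lintegral_insertNth 0 hu, lintegral_insertNth 0 hv, lintegral_insertNth 0 hw]
    have hm := measurable_insertNth (0 : Fin (n + 1))
    refine prekopa_leindler_line ha hb hab (hu.comp hm).lintegral_prod_right'
      (hv.comp hm).lintegral_prod_right' (hw.comp hm).lintegral_prod_right' fun s t => ?_
    refine ih _ _ _ ((hu.comp hm).comp measurable_prodMk_left)
      ((hv.comp hm).comp measurable_prodMk_left) ((hw.comp hm).comp measurable_prodMk_left)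
      fun y z => ?_
    have := h ((0 : Fin (n + 1)).insertNth s y) ((0 : Fin (n + 1)).insertNth t z)
    rw [← insertNth_combo] at this
    exact this

/-- One-dimensional marginals of log-concave measures are log-concave. -/
theorem hasLogConcaveDensity_map_eval {n : ℕ} (i : Fin (n + 1)) {φ : (Fin (n + 1) → ℝ) → ENNReal}
    (hm : Measurable φ) (hφ : LogConcaveFun φ) :
    HasLogConcaveDensity ((volume.withDensity φ).map fun x => x i) := by
  have hmi := measurable_insertNth i
  refine ⟨fun s => ∫⁻ y : Fin n → ℝ, φ (i.insertNth s y), (hm.comp hmi).lintegral_prod_right',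
    ?_, ?_⟩
  · intro s t a b ha hb hab
    refine prekopa_leindler ha hb hab n _ _ _ ((hm.comp hmi).comp measurable_prodMk_left)
      ((hm.comp hmi).comp measurable_prodMk_left) ((hm.comp hmi).comp measurable_prodMk_left)
      fun y z => ?_
    have := hφ (i.insertNth s y) (i.insertNth t z) a b ha hb hab
    rw [← insertNth_combo] at this
    exact this
  · ext S hS
    have hpre : MeasurableSet ((fun x : Fin (n + 1) → ℝ => x i) ⁻¹' S) := measurable_pi_apply i hS
    rw [Measure.map_apply (measurable_pi_apply i) hS, withDensity_apply _ hS,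
      withDensity_apply _ hpre, ← lintegral_indicator hpre, ← lintegral_indicator hS,
      lintegral_insertNth i (hm.indicator hpre)]
    refine lintegral_congr fun s => ?_
    by_cases hs : s ∈ S
    · rw [indicator_of_mem hs]
      refine lintegral_congr fun y => ?_
      rw [indicator_of_mem]
      simpa using hs
    · rw [indicator_of_notMem hs]
      have : ∀ y : Fin n → ℝ, ((fun x : Fin (n + 1) → ℝ => x i) ⁻¹' S).indicator φ
          (i.insertNth s y) = 0 := fun y => by
        rw [indicator_of_notMem]
        simpa using hs
      simp [this]

lemma LogConcaveFun.indicator {E : Type*} [AddCommGroup E] [Module ℝ E]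
    {φ : E → ENNReal} (hφ : LogConcaveFun φ) {K : Set E} (hK : Convex ℝ K) :
    LogConcaveFun (K.indicator φ) := by
  intro x y a b ha hb hab
  by_cases hx : x ∈ K
  · by_cases hy : y ∈ K
    · rw [indicator_of_mem hx, indicator_of_mem hy, indicator_of_mem (hK hx hy ha.le hb.le hab)]
      exact hφ x y a b ha hb hab
    · rw [indicator_of_notMem hy, ENNReal.zero_rpow_of_pos hb, mul_zero]
      exact zero_le
  · rw [indicator_of_notMem hx, ENNReal.zero_rpow_of_pos ha, zero_mul]
    exact zero_le

/-- The density of a log-concave measure can be chosen measurable. -/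
theorem IsLogConcave.exists_measurable_density {n : ℕ} {μ : Measure (Fin n → ℝ)}
    (h : IsLogConcave μ) : ∃ φ : (Fin n → ℝ) → ENNReal, Measurable φ ∧ LogConcaveFun φ ∧
      (∀ x, φ x ≠ ⊤) ∧ μ = volume.withDensity φ := by
  classical
  obtain ⟨ρ, hρ0, rfl, hlc⟩ := h
  have hlc' : ∀ (x y : Fin n → ℝ) (a b : ℝ), 0 < a → 0 < b → a + b = 1 → ρ x ^ a * ρ y ^ b ≤ ρ (a • x + b • y) := by
    intro x y a b ha hb hab
    have := hlc x y a ha.le (by linarith)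
    rwa [show 1 - a = b by linarith] at this
  set D := {x | 0 < ρ x} with hD
  have hDconv : Convex ℝ D := by
    rw [convex_iff_forall_pos]
    intro x hx y hy a b ha hb hab
    exact (mul_pos (Real.rpow_pos_of_pos hx _) (Real.rpow_pos_of_pos hy _)).trans_le
      (hlc' x y a b ha hb hab)
  have hconc : ConcaveOn ℝ (interior D) fun x => Real.log (ρ x) := by
    refine ⟨hDconv.interior, fun x hx y hy a b ha hb hab => ?_⟩
    rcases ha.eq_or_lt with rfl | ha
    · have : b = 1 := by linarith
      subst this; simp
    rcases hb.eq_or_lt with rfl | hb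
    · have : a = 1 := by linarith
      subst this; simp
    have hx0 : 0 < ρ x := interior_subset (s := D) hx
    have hy0 : 0 < ρ y := interior_subset (s := D) hy
    have h1 := Real.log_le_log (by positivity) (hlc' x y a b ha hb hab)
    rw [Real.log_mul (by positivity) (by positivity), Real.log_rpow hx0, Real.log_rpow hy0] at h1
    simpa using h1
  have hcont : ContinuousOn ρ (interior D) := by
    have h1 := (hconc.continuousOn isOpen_interior).rexp
    refine h1.congr fun x hx => ?_
    have hx0 : 0 < ρ x := interior_subset (s := D) hx
    exact (Real.exp_log hx0).symm
  have hconti : ContinuousOn (fun x => ENNReal.ofReal (ρ x)) (interior D) :=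
    ENNReal.continuous_ofReal.comp_continuousOn hcont
  refine ⟨(interior D).indicator fun x => ENNReal.ofReal (ρ x), ?_, ?_, ?_, ?_⟩
  · rw [← piecewise_eq_indicator]
    exact hconti.measurable_piecewise continuousOn_const isOpen_interior.measurableSet
  · refine LogConcaveFun.indicator ?_ hDconv.interior
    intro x y a b ha hb hab
    rw [ENNReal.ofReal_rpow_of_nonneg (hρ0 x) ha.le, ENNReal.ofReal_rpow_of_nonneg (hρ0 y) hb.le,
      ← ENNReal.ofReal_mul (Real.rpow_nonneg (hρ0 x) _)]
    exact ENNReal.ofReal_le_ofReal (hlc' x y a b ha hb hab)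
  · intro x
    rw [indicator_apply]
    split_ifs <;> simp
  · refine withDensity_congr_ae ?_
    have hfr : ∀ᵐ x : Fin n → ℝ, x ∉ frontier D :=
      measure_eq_zero_iff_ae_notMem.1 (hDconv.addHaar_frontier volume)
    filter_upwards [hfr] with x hx
    by_cases hxi : x ∈ interior D
    · rw [indicator_of_mem hxi]
    · rw [indicator_of_notMem hxi]
      have : x ∉ D := fun hxD => hx ⟨subset_closure hxD, hxi⟩
      have h0 : ρ x ≤ 0 := not_lt.1 this
      simp [h0]

end

/-- The affine function vanishing on a line through `(p, q)` in the `(i, j)` coordinate plane. -/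
def planeCut {n : ℕ} (i j : Fin n) (p q θ : ℝ) (x : Fin n → ℝ) : ℝ :=
  Real.cos θ * (x i - p) + Real.sin θ * (x j - q)

lemma continuous_planeCut {n : ℕ} (i j : Fin n) (p q θ : ℝ) :
    Continuous (planeCut i j p q θ) := by
  unfold planeCut; fun_prop

lemma planeCut_add_pi {n : ℕ} (i j : Fin n) (p q θ : ℝ) (x : Fin n → ℝ) :
    planeCut i j p q (θ + Real.pi) x = -planeCut i j p q θ x := by
  simp only [planeCut, Real.cos_add_pi, Real.sin_add_pi]; ring

lemma convex_planeCut {n : ℕ} (i j : Fin n) (p q θ : ℝ) :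
    Convex ℝ {x | 0 ≤ planeCut i j p q θ x} := by
  intro x hx y hy a b ha hb hab
  have hx' : 0 ≤ planeCut i j p q θ x := hx
  have hy' : 0 ≤ planeCut i j p q θ y := hy
  have h : planeCut i j p q θ (a • x + b • y) =
      a * planeCut i j p q θ x + b * planeCut i j p q θ y := by
    simp only [planeCut, Pi.add_apply, Pi.smul_apply, smul_eq_mul]
    linear_combination (Real.cos θ * p + Real.sin θ * q) * hab
  show 0 ≤ planeCut i j p q θ (a • x + b • y)
  rw [h]; positivity

lemma volume_planeCut_eq_zero {n : ℕ} {i j : Fin n} (hij : i ≠ j) (p q θ : ℝ) :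
    volume {x : Fin n → ℝ | planeCut i j p q θ x = 0} = 0 := by
  set x₀ : Fin n → ℝ := fun k => if k = i then p else if k = j then q else 0 with hx₀
  set ℓ : (Fin n → ℝ) →ₗ[ℝ] ℝ := Real.cos θ • LinearMap.proj i + Real.sin θ • LinearMap.proj j
    with hℓ
  have hker : LinearMap.ker ℓ ≠ ⊤ := by
    intro htop
    have h0 : ℓ (fun k => if k = i then Real.cos θ else if k = j then Real.sin θ else 0) = 0 := by
      have : (fun k => if k = i then Real.cos θ else if k = j then Real.sin θ else 0) ∈
          LinearMap.ker ℓ := by rw [htop]; trivial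
      exact this
    simp only [hℓ, LinearMap.add_apply, LinearMap.smul_apply, LinearMap.proj_apply, if_true,
      smul_eq_mul, hij.symm, if_false] at h0
    nlinarith [Real.sin_sq_add_cos_sq θ]
  have hnull := Measure.addHaar_submodule (volume : Measure (Fin n → ℝ)) (LinearMap.ker ℓ) hker
  have : {x : Fin n → ℝ | planeCut i j p q θ x = 0} =
      (fun x => x + -x₀) ⁻¹' (LinearMap.ker ℓ : Set (Fin n → ℝ)) := by
    ext x
    simp [planeCut, hℓ, hx₀, hij.symm, sub_eq_add_neg]
  rw [this, measure_preimage_add_right, hnull]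

lemma exists_planeCut_half {n : ℕ} {i j : Fin n} (hij : i ≠ j) (p q : ℝ)
    {μ : Measure (Fin n → ℝ)} (hμ : μ ≪ volume) {K : Set (Fin n → ℝ)}
    {G H : (Fin n → ℝ) → ℝ} (hG : IntegrableOn G K μ) (hH : IntegrableOn H K μ)
    (hG0 : ∫ x in K, G x ∂μ = 0) (hH0 : 0 < ∫ x in K, H x ∂μ) :
    ∃ θ, ∫ x in K ∩ {x | 0 ≤ planeCut i j p q θ x}, G x ∂μ = 0 ∧
      0 < ∫ x in K ∩ {x | 0 ≤ planeCut i j p q θ x}, H x ∂μ := by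
  have hm : ∀ θ, MeasurableSet {x : Fin n → ℝ | 0 ≤ planeCut i j p q θ x} := fun θ =>
    measurableSet_le measurable_const (continuous_planeCut i j p q θ).measurable
  have hnull : ∀ θ, ∀ᵐ x ∂(μ.restrict K), planeCut i j p q θ x ≠ 0 := fun θ =>
    ae_restrict_of_ae (measure_eq_zero_iff_ae_notMem.1 (hμ (volume_planeCut_eq_zero hij p q θ)))
  have hind : ∀ (θ : ℝ) (F : (Fin n → ℝ) → ℝ),
      ∫ x in K ∩ {x | 0 ≤ planeCut i j p q θ x}, F x ∂μ =
        ∫ x in K, {x | 0 ≤ planeCut i j p q θ x}.indicator F x ∂μ := fun θ F =>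
    (setIntegral_indicator (hm θ)).symm
  have hsum : ∀ (θ : ℝ) (F : (Fin n → ℝ) → ℝ), IntegrableOn F K μ →
      ∫ x in K ∩ {x | 0 ≤ planeCut i j p q θ x}, F x ∂μ +
        ∫ x in K ∩ {x | 0 ≤ planeCut i j p q (θ + Real.pi) x}, F x ∂μ = ∫ x in K, F x ∂μ := by
    intro θ F hF
    rw [hind, hind, ← integral_add (hF.indicator (hm _)) (hF.indicator (hm _))]
    refine integral_congr_ae ?_
    filter_upwards [hnull θ] with x hx
    simp only [indicator_apply, mem_ofPred_eq, planeCut_add_pi]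
    rcases lt_or_gt_of_ne hx with h | h
    · rw [if_neg (by linarith), if_pos (by linarith), zero_add]
    · rw [if_pos h.le, if_neg (by linarith), add_zero]
  have hcont : Continuous fun θ => ∫ x in K ∩ {x | 0 ≤ planeCut i j p q θ x}, G x ∂μ := by
    simp_rw [hind]
    rw [continuous_iff_continuousAt]
    intro θ₀
    refine continuousAt_of_dominated (bound := fun x => ‖G x‖) ?_ ?_ hG.norm ?_
    · exact Filter.Eventually.of_forall fun θ => (hG.indicator (hm θ)).aestronglyMeasurable
    · exact Filter.Eventually.of_forall fun θ => Filter.Eventually.of_forall fun x =>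
        norm_indicator_le_norm_self _ _
    · filter_upwards [hnull θ₀] with x hx
      have hc : Continuous fun θ => planeCut i j p q θ x := by unfold planeCut; fun_prop
      rcases lt_or_gt_of_ne hx with h | h
      · refine (continuousAt_const (y := (0 : ℝ))).congr ?_
        filter_upwards [hc.continuousAt.eventually (gt_mem_nhds h)] with θ hθ
        rw [indicator_of_notMem]
        exact not_le.2 hθ
      · refine (continuousAt_const (y := G x)).congr ?_
        filter_upwards [hc.continuousAt.eventually (lt_mem_nhds h)] with θ hθ
        rw [indicator_of_mem]
        exact le_of_lt hθ
  obtain ⟨θ, hθ⟩ : ∃ θ, ∫ x in K ∩ {x | 0 ≤ planeCut i j p q θ x}, G x ∂μ = 0 := by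
    have h1 := hsum 0 G hG
    rw [hG0] at h1
    have hc := intermediate_value_univ (0 : ℝ) (0 + Real.pi) hcont
    have hc' := intermediate_value_univ (0 + Real.pi) (0 : ℝ) hcont
    rcases le_total (∫ x in K ∩ {x | 0 ≤ planeCut i j p q 0 x}, G x ∂μ) 0 with h | h
    · exact hc ⟨h, by linarith⟩
    · exact hc' ⟨by linarith, h⟩
  have hG' := hsum θ G hG
  have hH' := hsum θ H hH
  rw [hG0, hθ, zero_add] at hG'
  rcases lt_or_ge 0 (∫ x in K ∩ {x | 0 ≤ planeCut i j p q θ x}, H x ∂μ) with h | h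
  · exact ⟨θ, hθ, h⟩
  · exact ⟨θ + Real.pi, hG', by linarith⟩

lemma exists_bisection_seq {n : ℕ} {μ : Measure (Fin (n + 1) → ℝ)} [IsFiniteMeasure μ]
    (hμ : μ ≪ volume) {K₀ : Set (Fin (n + 1) → ℝ)} (hK₀ : IsCompact K₀) (hconv : Convex ℝ K₀)
    {G H : (Fin (n + 1) → ℝ) → ℝ} (hG : Continuous G) (hH : Continuous H)
    (hG0 : ∫ x in K₀, G x ∂μ = 0) (hH0 : 0 < ∫ x in K₀, H x ∂μ) :
    ∃ K : ℕ → Set (Fin (n + 1) → ℝ), Antitone K ∧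
      (∀ m, IsCompact (K m) ∧ Convex ℝ (K m) ∧ ∫ x in K m, G x ∂μ = 0 ∧
        0 < ∫ x in K m, H x ∂μ) ∧
      ∀ i j, i ≠ j → ∀ p q : ℚ, ∃ m θ, K m ⊆ {x | 0 ≤ planeCut i j p q θ x} := by
  let P : Set (Fin (n + 1) → ℝ) → Prop := fun K => IsCompact K ∧ Convex ℝ K ∧
    ∫ x in K, G x ∂μ = 0 ∧ 0 < ∫ x in K, H x ∂μ
  have hstep : ∀ (c : Fin (n + 1) × Fin (n + 1) × ℚ × ℚ) (s : {K // P K}),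
      ∃ s' : {K // P K}, s'.1 ⊆ s.1 ∧ (c.1 ≠ c.2.1 → ∃ θ,
        s'.1 ⊆ {x | 0 ≤ planeCut c.1 c.2.1 c.2.2.1 c.2.2.2 θ x}) := by
    rintro ⟨i, j, p, q⟩ ⟨K, hKc, hKv, hKG, hKH⟩
    by_cases hij : i = j
    · exact ⟨⟨K, hKc, hKv, hKG, hKH⟩, Subset.rfl, fun h => absurd hij h⟩
    · obtain ⟨θ, h1, h2⟩ := exists_planeCut_half hij p q hμ
        (hG.continuousOn.integrableOn_compact hKc) (hH.continuousOn.integrableOn_compact hKc)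
        hKG hKH
      refine ⟨⟨K ∩ {x | 0 ≤ planeCut i j p q θ x}, hKc.inter_right ?_,
        hKv.inter (convex_planeCut i j p q θ), h1, h2⟩, inter_subset_left,
        fun _ => ⟨θ, inter_subset_right⟩⟩
      exact isClosed_le continuous_const (continuous_planeCut i j p q θ)
  choose step hsub hcut using hstep
  obtain ⟨e, he⟩ := exists_surjective_nat (Fin (n + 1) × Fin (n + 1) × ℚ × ℚ)
  let S : ℕ → {K // P K} := fun m =>
    Nat.rec ⟨K₀, hK₀, hconv, hG0, hH0⟩ (fun m s => step (e m) s) m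
  have hS : ∀ m, S (m + 1) = step (e m) (S m) := fun m => rfl
  refine ⟨fun m => (S m).1, antitone_nat_of_succ_le fun m => ?_, fun m => (S m).2, ?_⟩
  · rw [hS]; exact hsub _ _
  · intro i j hij p q
    obtain ⟨m, hm⟩ := he (i, j, p, q)
    obtain ⟨θ, hθ⟩ := hcut (e m) (S m) (by rw [hm]; exact hij)
    refine ⟨m + 1, θ, ?_⟩
    rw [← hS, hm] at hθ
    exact hθ

lemma minor_eq_zero_of_planeCut {n : ℕ} {K : Set (Fin n → ℝ)} (hK : Convex ℝ K) {i j : Fin n}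
    (hcut : ∀ p q : ℚ, ∃ θ, K ⊆ {x | 0 ≤ planeCut i j p q θ x}) {x y z : Fin n → ℝ}
    (hx : x ∈ K) (hy : y ∈ K) (hz : z ∈ K) :
    (x i - z i) * (y j - z j) - (x j - z j) * (y i - z i) = 0 := by
  by_contra hΔ
  set Δ := (x i - z i) * (y j - z j) - (x j - z j) * (y i - z i) with hΔdef
  let s : ℝ × ℝ → ℝ := fun w => ((w.1 - z i) * (y j - z j) - (w.2 - z j) * (y i - z i)) / Δ
  let t : ℝ × ℝ → ℝ := fun w => ((x i - z i) * (w.2 - z j) - (x j - z j) * (w.1 - z i)) / Δ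
  have hs : Continuous s := by fun_prop
  have ht : Continuous t := by fun_prop
  let O : Set (ℝ × ℝ) := {w | 0 < s w} ∩ {w | 0 < t w} ∩ {w | s w + t w < 1}
  have hO : IsOpen O := ((isOpen_lt continuous_const hs).inter (isOpen_lt continuous_const ht)).inter
    (isOpen_lt (hs.add ht) continuous_const)
  have hne : O.Nonempty := by
    have h1 : s ((x i + y i + z i) / 3, (x j + y j + z j) / 3) = 1 / 3 := by
      simp only [s]; rw [div_eq_iff hΔ, hΔdef]; ring
    have h2 : t ((x i + y i + z i) / 3, (x j + y j + z j) / 3) = 1 / 3 := by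
      simp only [t]; rw [div_eq_iff hΔ, hΔdef]; ring
    refine ⟨((x i + y i + z i) / 3, (x j + y j + z j) / 3), ⟨?_, ?_⟩, ?_⟩
    · show 0 < s _
      rw [h1]; norm_num
    · show 0 < t _
      rw [h2]; norm_num
    · show s _ + t _ < 1
      rw [h1, h2]; norm_num
  have hmem : ∀ w ∈ O, ∃ u ∈ K, u i = w.1 ∧ u j = w.2 := by
    rintro w ⟨⟨h1, h2⟩, h3⟩
    have h1' : 0 < s w := h1
    have h2' : 0 < t w := h2
    have h3' : s w + t w < 1 := h3
    have hcomb : s w • x + t w • y + (1 - s w - t w) • z ∈ K := by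
      have := hK.sum_mem (t := Finset.univ) (w := ![s w, t w, 1 - s w - t w]) (z := ![x, y, z])
        (by intro k _; fin_cases k
            · exact h1'.le
            · exact h2'.le
            · show 0 ≤ 1 - s w - t w
              linarith)
        (by simp [Fin.sum_univ_three])
        (by intro k _; fin_cases k
            · exact hx
            · exact hy
            · exact hz)
      simpa [Fin.sum_univ_three] using this
    refine ⟨_, hcomb, ?_, ?_⟩
    · simp only [Pi.add_apply, Pi.smul_apply, smul_eq_mul, s, t]
      field_simp
      rw [hΔdef]; ring
    · simp only [Pi.add_apply, Pi.smul_apply, smul_eq_mul, s, t]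
      field_simp
      rw [hΔdef]; ring
  have hdense : DenseRange (Prod.map ((↑) : ℚ → ℝ) ((↑) : ℚ → ℝ)) :=
    Rat.denseRange_cast.prodMap Rat.denseRange_cast
  obtain ⟨⟨p, q⟩, hpq⟩ := hdense.exists_mem_open hO hne
  obtain ⟨θ, hθ⟩ := hcut p q
  have hcurve : Continuous fun ε : ℝ => ((p : ℝ) - ε * Real.cos θ, (q : ℝ) - ε * Real.sin θ) := by
    fun_prop
  have hev : ∀ᶠ ε in nhdsWithin (0 : ℝ) (Ioi 0),
      ((p : ℝ) - ε * Real.cos θ, (q : ℝ) - ε * Real.sin θ) ∈ O := by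
    refine nhdsWithin_le_nhds (hcurve.continuousAt.preimage_mem_nhds (hO.mem_nhds ?_))
    simpa using hpq
  obtain ⟨ε, hε, hε0⟩ := (hev.and self_mem_nhdsWithin).exists
  obtain ⟨u, hu, hui, huj⟩ := hmem _ hε
  have h : 0 ≤ planeCut i j p q θ u := hθ hu
  have hε0' : 0 < ε := hε0
  simp only [planeCut, hui, huj] at h
  nlinarith [Real.sin_sq_add_cos_sq θ]

lemma exists_line_of_planeCut {n : ℕ} {K : Set (Fin (n + 1) → ℝ)} (hK : Convex ℝ K)
    (hne : K.Nonempty)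
    (hcut : ∀ i j, i ≠ j → ∀ p q : ℚ, ∃ θ, K ⊆ {x | 0 ≤ planeCut i j p q θ x}) :
    ∃ (i : Fin (n + 1)) (x v : Fin (n + 1) → ℝ), ∀ z ∈ K, ∀ j, z j = x j + (z i - x i) * v j := by
  obtain ⟨x, hx⟩ := hne
  by_cases hs : ∀ y ∈ K, y = x
  · exact ⟨0, x, 0, fun z hz j => by rw [hs z hz]; simp⟩
  · push Not at hs
    obtain ⟨y, hy, hyx⟩ := hs
    obtain ⟨i, hi⟩ := Function.ne_iff.1 hyx
    refine ⟨i, x, fun j => (y j - x j) / (y i - x i), fun z hz j => ?_⟩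
    have hi' : y i - x i ≠ 0 := sub_ne_zero.2 hi
    by_cases hij : i = j
    · subst hij; field_simp; ring
    · have := minor_eq_zero_of_planeCut hK (hcut i j hij) hz hy hx
      field_simp
      linarith

lemma LogConcaveFun.const_smul {E : Type*} [AddCommGroup E] [Module ℝ E] {φ : E → ENNReal}
    (hφ : LogConcaveFun φ) (c : ENNReal) : LogConcaveFun (c • φ) := by
  intro x y a b ha hb hab
  simp only [Pi.smul_apply, smul_eq_mul]
  rw [ENNReal.mul_rpow_of_nonneg _ _ ha.le, ENNReal.mul_rpow_of_nonneg _ _ hb.le,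
    mul_mul_mul_comm, ← ENNReal.rpow_add_of_nonneg _ _ ha.le hb.le, hab, ENNReal.rpow_one]
  gcongr
  exact hφ x y a b ha hb hab

lemma exists_line_polynomial {n d : ℕ} {f : MvPolynomial (Fin n) ℝ} (hf : f.totalDegree ≤ d)
    (i : Fin n) (x v : Fin n → ℝ) : ∃ q : Polynomial ℝ, q.natDegree ≤ d ∧
      ∀ s, q.eval s = MvPolynomial.eval (fun j => x j + (s - x i) * v j) f := by
  refine ⟨MvPolynomial.aeval (fun j => Polynomial.C (x j) +
    (Polynomial.X - Polynomial.C (x i)) * Polynomial.C (v j)) f, ?_, fun s => ?_⟩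
  · refine (MvPolynomial.aeval_natDegree_le (m := d) (n := 1) f hf _ fun j => ?_).trans (by simp)
    compute_degree
  · have h : (Polynomial.aeval s : Polynomial ℝ →ₐ[ℝ] ℝ).comp (MvPolynomial.aeval
        (fun j => Polynomial.C (x j) + (Polynomial.X - Polynomial.C (x i)) * Polynomial.C (v j))) =
        MvPolynomial.aeval (fun j => x j + (s - x i) * v j) := by
      ext j; simp
    have h2 := DFunLike.congr_fun h f
    simpa [MvPolynomial.aeval_eq_eval, Polynomial.coe_aeval_eq_eval] using h2

/-- Localization: a linear constraint and an open condition on a polynomial over a log-concave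
measure pass to some log-concave measure on the line. -/
theorem exists_needle {n d : ℕ} {φ : (Fin (n + 1) → ℝ) → ENNReal} (hm : Measurable φ)
    (hφ : LogConcaveFun φ) [IsFiniteMeasure (volume.withDensity φ)]
    {K₀ : Set (Fin (n + 1) → ℝ)} (hK₀ : IsCompact K₀) (hconv : Convex ℝ K₀)
    {f : MvPolynomial (Fin (n + 1)) ℝ} (hf : f.totalDegree ≤ d) {χ h : ℝ → ℝ} (hχ : Continuous χ)
    (hh : Continuous h) {c : ℝ}
    (hχ0 : ∫ x in K₀, (χ (MvPolynomial.eval x f) - c) ∂(volume.withDensity φ) = 0)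
    (hh0 : 0 < ∫ x in K₀, h (MvPolynomial.eval x f) ∂(volume.withDensity φ)) {δ : ℝ} (hδ : 0 < δ) :
    ∃ ν : Measure ℝ, IsProbabilityMeasure ν ∧ HasLogConcaveDensity ν ∧
      (∀ g : ℝ → ℝ, Continuous g → Integrable g ν) ∧ ∃ q : Polynomial ℝ, q.natDegree ≤ d ∧
      |∫ s, χ (q.eval s) ∂ν - c| ≤ δ ∧ -δ ≤ ∫ s, h (q.eval s) ∂ν := by
  set μ := volume.withDensity φ with hμ
  have hfc : Continuous fun x => MvPolynomial.eval x f := MvPolynomial.continuous_eval f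
  obtain ⟨K, hanti, hK, hcut⟩ := exists_bisection_seq (withDensity_absolutelyContinuous _ _) hK₀
    hconv ((hχ.comp hfc).sub continuous_const) (hh.comp hfc) hχ0 hh0
  have hne : ∀ m, (K m).Nonempty := fun m => by
    rw [nonempty_iff_ne_empty]
    intro h0
    have := (hK m).2.2.2
    rw [h0] at this
    simp at this
  have hdir : Directed (· ⊇ ·) K := hanti.directed_ge
  obtain ⟨i, x, v, hline⟩ := exists_line_of_planeCut (K := ⋂ m, K m)
    (convex_iInter fun m => (hK m).2.1)
    (IsCompact.nonempty_iInter_of_directed_nonempty_isCompact_isClosed K hdir hne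
      (fun m => (hK m).1) fun m => (hK m).1.isClosed) fun i j hij p q => by
        obtain ⟨m, θ, hθ⟩ := hcut i j hij p q
        exact ⟨θ, (iInter_subset K m).trans hθ⟩
  obtain ⟨q, hqd, hq⟩ := exists_line_polynomial hf i x v
  have hqf : ∀ z ∈ ⋂ m, K m, q.eval (z i) = MvPolynomial.eval z f := fun z hz => by
    rw [hq]
    congr 2
    ext j
    exact (hline z hz j).symm
  have hqc : Continuous fun z : Fin (n + 1) → ℝ => q.eval (z i) :=
    q.continuous.comp (continuous_apply i)
  obtain ⟨m, hmU⟩ := exists_subset_nhds_of_isCompact (U :=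
    {z | |χ (q.eval (z i)) - χ (MvPolynomial.eval z f)| < δ} ∩
    {z | |h (q.eval (z i)) - h (MvPolynomial.eval z f)| < δ}) hdir (fun m => (hK m).1) fun z hz => by
      refine (IsOpen.inter ?_ ?_).mem_nhds ⟨?_, ?_⟩
      · exact isOpen_lt ((hχ.comp hqc).sub (hχ.comp hfc)).abs continuous_const
      · exact isOpen_lt ((hh.comp hqc).sub (hh.comp hfc)).abs continuous_const
      · show |_| < δ
        rw [hqf z hz, sub_self, abs_zero]; exact hδ
      · show |_| < δ
        rw [hqf z hz, sub_self, abs_zero]; exact hδ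
  obtain ⟨hKc, hKv, hKχ, hKh⟩ := hK m
  have hKm : MeasurableSet (K m) := hKc.isClosed.measurableSet
  have hμK : μ (K m) ≠ 0 := fun h0 => by
    rw [Measure.restrict_eq_zero.2 h0, integral_zero_measure] at hKh
    exact lt_irrefl _ hKh
  have hprob := ProbabilityTheory.cond_isProbabilityMeasure hμK
  set κ := ProbabilityTheory.cond μ (K m) with hκ
  have hκd : κ = volume.withDensity ((μ (K m))⁻¹ • (K m).indicator φ) := by
    rw [hκ, ProbabilityTheory.cond, hμ, restrict_withDensity hKm,
      withDensity_smul _ (hm.indicator hKm), withDensity_indicator hKm]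
  have hint : ∀ F : (Fin (n + 1) → ℝ) → ℝ, Continuous F → Integrable F κ := fun F hF => by
    rw [hκ, ProbabilityTheory.cond]
    exact Integrable.smul_measure (hF.continuousOn.integrableOn_compact hKc)
      (ENNReal.inv_ne_top.2 hμK)
  have hbd : ∀ F F' : (Fin (n + 1) → ℝ) → ℝ, Continuous F → Continuous F' →
      (∀ z ∈ K m, |F z - F' z| < δ) → |∫ z, F z ∂κ - ∫ z, F' z ∂κ| ≤ δ := by
    intro F F' hF hF' hb
    rw [← integral_sub (hint F hF) (hint F' hF')]
    have hae : ∀ᵐ z ∂κ, ‖F z - F' z‖ ≤ δ := by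
      rw [hκ, ProbabilityTheory.cond]
      refine Measure.ae_smul_measure ?_ _
      exact ae_restrict_of_forall_mem hKm fun z hz => (hb z hz).le
    simpa using norm_integral_le_of_norm_le_const hae
  have hcond : ∀ F : (Fin (n + 1) → ℝ) → ℝ,
      ∫ z, F z ∂κ = ((μ (K m))⁻¹).toReal * ∫ z in K m, F z ∂μ := fun F => by
    rw [hκ, ProbabilityTheory.cond, integral_smul_measure, smul_eq_mul]
  have hmap : ∀ g : ℝ → ℝ, Continuous g → ∫ s, g s ∂(κ.map fun z => z i) = ∫ z, g (z i) ∂κ :=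
    fun g hg => integral_map (measurable_pi_apply i).aemeasurable hg.aestronglyMeasurable
  refine ⟨κ.map fun z => z i, Measure.isProbabilityMeasure_map (measurable_pi_apply i).aemeasurable,
    ?_, ?_, q, hqd, ?_, ?_⟩
  · rw [hκd]
    exact hasLogConcaveDensity_map_eval i ((hm.indicator hKm).const_smul _)
      ((hφ.indicator hKv).const_smul _)
  · intro g hg
    rw [integrable_map_measure hg.aestronglyMeasurable (measurable_pi_apply i).aemeasurable]
    exact hint _ (hg.comp (continuous_apply i))
  · rw [hmap (fun s => χ (q.eval s)) (hχ.comp q.continuous)]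
    have h1 := hbd _ _ (hχ.comp hqc) (hχ.comp hfc) fun z hz => (hmU hz).1
    have h2 := hcond fun z => χ (MvPolynomial.eval z f) - c
    have h3 : ∫ z in K m, (χ (MvPolynomial.eval z f) - c) ∂μ = 0 := hKχ
    rw [h3, mul_zero, integral_sub (hint (fun z => χ (MvPolynomial.eval z f)) (hχ.comp hfc)) (integrable_const c)]
      at h2
    simp only [integral_const, probReal_univ, smul_eq_mul, one_mul] at h2
    simp only [Function.comp_def] at h1 ⊢
    rwa [sub_eq_zero.1 h2] at h1
  · rw [hmap (fun s => h (q.eval s)) (hh.comp q.continuous)]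
    have h1 := hbd _ _ (hh.comp hqc) (hh.comp hfc) fun z hz => (hmU hz).2
    have h2 := hcond fun z => h (MvPolynomial.eval z f)
    have h3 : 0 < ∫ z in K m, h (MvPolynomial.eval z f) ∂μ := hKh
    have h4 : 0 ≤ ∫ z, h (MvPolynomial.eval z f) ∂κ := by rw [h2]; positivity
    simp only [Function.comp_def] at h1 ⊢
    linarith [neg_le_of_abs_le h1]

/-- `exists_needle` for a probability measure on the whole space. -/
theorem exists_needle_univ {n d : ℕ} {φ : (Fin (n + 1) → ℝ) → ENNReal} (hm : Measurable φ)
    (hφ : LogConcaveFun φ) [IsProbabilityMeasure (volume.withDensity φ)]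
    {f : MvPolynomial (Fin (n + 1)) ℝ} (hf : f.totalDegree ≤ d) {χ h : ℝ → ℝ} (hχ : Continuous χ)
    (hh : Continuous h)
    (hχi : Integrable (fun x => χ (MvPolynomial.eval x f)) (volume.withDensity φ))
    (hhi : Integrable (fun x => h (MvPolynomial.eval x f)) (volume.withDensity φ))
    (hh0 : 0 < ∫ x, h (MvPolynomial.eval x f) ∂(volume.withDensity φ)) {δ : ℝ} (hδ : 0 < δ) :
    ∃ ν : Measure ℝ, IsProbabilityMeasure ν ∧ HasLogConcaveDensity ν ∧
      (∀ g : ℝ → ℝ, Continuous g → Integrable g ν) ∧ ∃ q : Polynomial ℝ, q.natDegree ≤ d ∧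
      |∫ s, χ (q.eval s) ∂ν - ∫ x, χ (MvPolynomial.eval x f) ∂(volume.withDensity φ)| ≤ δ ∧
      -δ ≤ ∫ s, h (q.eval s) ∂ν := by
  set μ := volume.withDensity φ with hμ
  have hcov : AECover μ Filter.atTop fun R : ℝ => Metric.closedBall (0 : Fin (n + 1) → ℝ) R :=
    aecover_closedBall Filter.tendsto_id
  have t1 := hcov.integral_tendsto_of_countably_generated hχi
  have t2 := hcov.integral_tendsto_of_countably_generated hhi
  have t3 := hcov.integral_tendsto_of_countably_generated (integrable_const (1 : ℝ))
  simp only [integral_const, probReal_univ, smul_eq_mul, mul_one, measureReal_restrict_apply_univ]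
    at t3
  have t4 := t1.div t3 one_ne_zero
  rw [div_one] at t4
  obtain ⟨R, hR1, hR2, hR3⟩ := ((t2.eventually (lt_mem_nhds hh0)).and
    ((t3.eventually (lt_mem_nhds zero_lt_one)).and
      (t4.eventually (Metric.ball_mem_nhds _ (half_pos hδ))))).exists
  obtain ⟨ν, h1, h2, h3, q, h4, h5, h6⟩ := exists_needle hm hφ (isCompact_closedBall 0 R)
    (convex_closedBall 0 R) hf hχ hh (c := (∫ x in Metric.closedBall 0 R,
      χ (MvPolynomial.eval x f) ∂μ) / μ.real (Metric.closedBall 0 R)) (by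
        rw [integral_sub hχi.integrableOn (integrable_const _)]
        simp only [integral_const, smul_eq_mul, measureReal_restrict_apply_univ]
        field_simp
        simp) hR1 (half_pos hδ)
  refine ⟨ν, h1, h2, h3, q, h4, ?_, by linarith⟩
  have hR3' : |_ - _| < δ / 2 := hR3
  refine (abs_sub_le _ _ _).trans ((add_le_add h5 hR3'.le).trans (by linarith))

/-- Dimension-free moment bounds for polynomials under log-concave measures. -/
theorem exists_moment_const (d : ℕ) : ∃ C : ℝ, 0 < C ∧
    ∀ (n : ℕ) (φ : (Fin (n + 1) → ℝ) → ENNReal), Measurable φ → LogConcaveFun φ →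
    IsProbabilityMeasure (volume.withDensity φ) →
    ∀ f : MvPolynomial (Fin (n + 1)) ℝ, f.totalDegree ≤ d →
    ∫ x, min 1 |MvPolynomial.eval x f| ∂(volume.withDensity φ) ≤ 1 / 4 →
    Integrable (fun x => MvPolynomial.eval x f ^ 2) (volume.withDensity φ) ∧
    ∫ x, MvPolynomial.eval x f ^ 2 ∂(volume.withDensity φ) ≤ C := by
  obtain ⟨C, hC, hline⟩ := exists_moment_const_line d
  refine ⟨C + 1, by positivity, fun n φ hm hφ hprob f hf hsmall => ?_⟩
  set μ := volume.withDensity φ with hμ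
  have hfc : Continuous fun x => MvPolynomial.eval x f := MvPolynomial.continuous_eval f
  have hbdd : ∀ M : ℕ, Integrable (fun x => min (MvPolynomial.eval x f ^ 2) (M : ℝ)) μ := fun M => by
    refine Integrable.of_bound (by fun_prop) (M : ℝ) (Filter.Eventually.of_forall fun x => ?_)
    rw [Real.norm_of_nonneg (by positivity)]
    exact min_le_right _ _
  have hM : ∀ M : ℕ, ∫ x, min (MvPolynomial.eval x f ^ 2) (M : ℝ) ∂μ ≤ C + 1 := by
    intro M
    by_contra! hgt
    obtain ⟨ν, h1, h2, h3, q, h4, h5, h6⟩ := exists_needle_univ hm hφ hf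
      (χ := fun y => min 1 |y|) (h := fun y => min (y ^ 2) (M : ℝ) - (C + 1)) (by fun_prop)
      (by fun_prop)
      (Integrable.of_bound (by fun_prop) 1 (Filter.Eventually.of_forall fun x => by
        rw [Real.norm_of_nonneg (by positivity)]
        exact min_le_left _ _))
      ((hbdd M).sub (integrable_const _))
      (by
        rw [integral_sub (hbdd M) (integrable_const _)]
        simpa using hgt) (δ := 1 / 4) (by norm_num)
    have h7 := hline ν h1 h2 q h4 (by linarith [le_of_abs_le h5])
    rw [integral_sub (h3 _ (by fun_prop)) (integrable_const _)] at h6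
    have h8 : ∫ s, min (q.eval s ^ 2) (M : ℝ) ∂ν ≤ ∫ s, q.eval s ^ 2 ∂ν :=
      integral_mono (h3 _ (by fun_prop)) (h3 _ (by fun_prop)) fun s => min_le_left _ _
    simp only [integral_const, probReal_univ, smul_eq_mul, one_mul] at h6
    linarith
  have hlim : ∫⁻ x, ENNReal.ofReal (MvPolynomial.eval x f ^ 2) ∂μ ≤ ENNReal.ofReal (C + 1) := by
    have hFatou := lintegral_liminf_le (μ := μ) (u := Filter.atTop) (f := fun (M : ℕ) x =>
      ENNReal.ofReal (min (MvPolynomial.eval x f ^ 2) (M : ℝ))) fun M => by fun_prop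
    have hpt : ∀ x, Filter.liminf (fun M : ℕ =>
        ENNReal.ofReal (min (MvPolynomial.eval x f ^ 2) (M : ℝ))) Filter.atTop =
        ENNReal.ofReal (MvPolynomial.eval x f ^ 2) := fun x => by
      refine (tendsto_const_nhds.congr' ?_).liminf_eq
      obtain ⟨N, hN⟩ := exists_nat_ge (MvPolynomial.eval x f ^ 2)
      filter_upwards [Filter.eventually_ge_atTop N] with M hMN
      rw [min_eq_left (hN.trans (by exact_mod_cast hMN))]
    simp only [hpt] at hFatou
    refine hFatou.trans (Filter.liminf_le_of_frequently_le' (Filter.Frequently.of_forall fun M => ?_))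
    rw [← ofReal_integral_eq_lintegral_ofReal (hbdd M)
      (Filter.Eventually.of_forall fun x => by positivity)]
    exact ENNReal.ofReal_le_ofReal (hM M)
  have hint : Integrable (fun x => MvPolynomial.eval x f ^ 2) μ := by
    refine ⟨by fun_prop, ?_⟩
    rw [hasFiniteIntegral_iff_ofReal (Filter.Eventually.of_forall fun x => sq_nonneg _)]
    exact hlim.trans_lt ENNReal.ofReal_lt_top
  refine ⟨hint, ?_⟩
  rw [← ofReal_integral_eq_lintegral_ofReal hint
    (Filter.Eventually.of_forall fun x => sq_nonneg _)] at hlim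
  exact (ENNReal.ofReal_le_ofReal_iff (by positivity)).1 hlim

lemma integral_cos_sub_eq {α : Type*} [MeasurableSpace α] {μ : Measure α} [IsFiniteMeasure μ]
    {g : α → ℝ} (hg : AEStronglyMeasurable g μ) (θ : ℝ) :
    ∫ x, Real.cos (g x - θ) ∂μ =
      (Complex.exp (-(θ * Complex.I)) * ∫ x, Complex.exp (Complex.I * (g x : ℂ)) ∂μ).re := by
  have hint : Integrable (fun x => Complex.exp (-(θ * Complex.I)) *
      Complex.exp (Complex.I * (g x : ℂ))) μ := by
    refine Integrable.of_bound ?_ 1 (Filter.Eventually.of_forall fun x => ?_)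
    · exact ((by fun_prop : Continuous fun s : ℝ => Complex.exp (-(θ * Complex.I)) *
        Complex.exp (Complex.I * (s : ℂ))).comp_aestronglyMeasurable hg)
    · rw [← Complex.exp_add, Complex.norm_exp]
      simp
  rw [← integral_const_mul]
  have := Complex.reCLM.integral_comp_comm hint
  simp only [Complex.reCLM_apply] at this
  rw [← this]
  refine integral_congr_ae (Filter.Eventually.of_forall fun x => ?_)
  show _ = (Complex.exp (-(θ * Complex.I)) * Complex.exp (Complex.I * (g x : ℂ))).re
  rw [← Complex.exp_add, show -(θ * Complex.I) + Complex.I * (g x : ℂ) =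
    ((g x - θ : ℝ) : ℂ) * Complex.I by push_cast; ring, Complex.exp_ofReal_mul_I_re]

lemma integral_sub_sub_const {α : Type*} [MeasurableSpace α] {μ : Measure α}
    [IsProbabilityMeasure μ] {u v : α → ℝ} (hu : Integrable u μ) (hv : Integrable v μ) (c : ℝ) :
    ∫ x, (u x - v x - c) ∂μ = ∫ x, u x ∂μ - ∫ x, v x ∂μ - c := by
  have huv : Integrable (fun x => u x - v x) μ := hu.sub hv
  rw [integral_sub huv (integrable_const _), integral_sub hu hv]
  simp

/-- Oscillatory integral bound for polynomials that do not have one sign and large modulus on most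
of the space, under log-concave measures in any dimension. -/
theorem exists_clamp_const {d : ℕ} (hd : 2 ≤ d) {p : ℝ} (hp : 0 < p) : ∃ C : ℝ, 0 < C ∧
    ∀ (n : ℕ) (φ : (Fin (n + 1) → ℝ) → ENNReal), Measurable φ → LogConcaveFun φ →
    IsProbabilityMeasure (volume.withDensity φ) →
    ∀ f : MvPolynomial (Fin (n + 1)) ℝ, f.totalDegree ≤ d →
    |∫ x, clamp (MvPolynomial.eval x f) ∂(volume.withDensity φ)| ≤ 1 - p →
    ‖∫ x, Complex.exp (Complex.I * ((MvPolynomial.eval x f : ℝ) : ℂ)) ∂(volume.withDensity φ)‖ ≤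
      C * ∫ x, (1 + |MvPolynomial.eval x f|) ^ (-(1 / (d : ℝ))) ∂(volume.withDensity φ) := by
  obtain ⟨C, hC, hline⟩ := exists_clamp_const_line hd (half_pos hp)
  refine ⟨C, hC, fun n φ hm hφ hprob f hf hclamp => ?_⟩
  set μ := volume.withDensity φ with hμ
  have hfc : Continuous fun x => MvPolynomial.eval x f := MvPolynomial.continuous_eval f
  have hα : (0 : ℝ) ≤ 1 / (d : ℝ) := by positivity
  have hw : Continuous fun y : ℝ => (1 + |y|) ^ (-(1 / (d : ℝ))) :=
    (by fun_prop : Continuous fun y : ℝ => 1 + |y|).rpow_const fun y => Or.inl (by positivity)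
  have hwi : Integrable (fun x => (1 + |MvPolynomial.eval x f|) ^ (-(1 / (d : ℝ)))) μ := by
    refine Integrable.of_bound (hw.comp hfc).aestronglyMeasurable 1
      (Filter.Eventually.of_forall fun x => ?_)
    rw [Real.norm_of_nonneg (by positivity)]
    exact Real.rpow_le_one_of_one_le_of_nonpos (by linarith [abs_nonneg (MvPolynomial.eval x f)])
      (by linarith)
  by_contra! hgt
  set Z := ∫ x, Complex.exp (Complex.I * ((MvPolynomial.eval x f : ℝ) : ℂ)) ∂μ with hZ
  set W := ∫ x, (1 + |MvPolynomial.eval x f|) ^ (-(1 / (d : ℝ))) ∂μ with hW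
  set θ := Complex.arg Z with hθ
  have hcosZ : ∫ x, Real.cos (MvPolynomial.eval x f - θ) ∂μ = ‖Z‖ := by
    rw [integral_cos_sub_eq hfc.aestronglyMeasurable]
    have h1 : Complex.exp (-(θ * Complex.I)) * Z = (‖Z‖ : ℂ) := by
      nth_rewrite 1 [← Complex.norm_mul_exp_arg_mul_I Z]
      rw [mul_comm, mul_assoc, ← Complex.exp_add, hθ]
      simp
    rw [h1, Complex.ofReal_re]
  set η := (‖Z‖ - C * W) / 2 with hη
  have hη0 : 0 < η := by rw [hη]; linarith
  have hci : Integrable (fun x => Real.cos (MvPolynomial.eval x f - θ)) μ :=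
    Integrable.of_bound (by fun_prop) 1 (Filter.Eventually.of_forall fun x => Real.abs_cos_le_one _)
  obtain ⟨ν, h1, h2, h3, q, h4, h5, h6⟩ := exists_needle_univ hm hφ hf (χ := clamp)
    (h := fun y => Real.cos (y - θ) - C * (1 + |y|) ^ (-(1 / (d : ℝ))) - η) (by fun_prop)
    (by fun_prop)
    (Integrable.of_bound (by fun_prop) 1 (Filter.Eventually.of_forall fun x => abs_clamp_le _))
    ((hci.sub (hwi.const_mul C)).sub (integrable_const _))
    (by
      rw [integral_sub_sub_const hci (hwi.const_mul C), integral_const_mul, hcosZ]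
      linarith) (δ := min (p / 2) (η / 2)) (by positivity)
  have h7 := hline ν h1 h2 q h4 (by
    have := abs_sub_abs_le_abs_sub (∫ s, clamp (q.eval s) ∂ν)
      (∫ x, clamp (MvPolynomial.eval x f) ∂μ)
    linarith [min_le_left (p / 2) (η / 2)])
  have i1 : Integrable (fun s => Real.cos (q.eval s - θ)) ν := h3 _ (by fun_prop)
  have i2 : Integrable (fun s => C * (1 + |q.eval s|) ^ (-(1 / (d : ℝ)))) ν :=
    h3 _ (continuous_const.mul (hw.comp q.continuous))
  rw [integral_sub_sub_const i1 i2, integral_const_mul,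
    integral_cos_sub_eq q.continuous.aestronglyMeasurable] at h6
  have h8 := (Complex.re_le_norm (Complex.exp (-(θ * Complex.I)) *
    ∫ s, Complex.exp (Complex.I * ((q.eval s : ℝ) : ℂ)) ∂ν))
  rw [norm_mul, show ‖Complex.exp (-(θ * Complex.I))‖ = 1 by rw [Complex.norm_exp]; simp,
    one_mul] at h8
  linarith [min_le_right (p / 2) (η / 2)]

lemma integrableOn_abs_rpow_neg {α η : ℝ} (hα : α ≤ 1 / 2) (hη : 0 < η) :
    IntegrableOn (fun u : ℝ => |u| ^ (-α)) (Icc (-η) η) ∧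
      ∫ u in Icc (-η) η, |u| ^ (-α) ≤ 4 * η ^ (1 - α) := by
  have heq : ∀ u : ℝ, (Icc (-η) η).indicator (fun u : ℝ => |u| ^ (-α)) u =
      (Iic η).indicator (fun v : ℝ => v ^ (-α)) |u| := by
    intro u
    by_cases hu : |u| ≤ η
    · rw [indicator_of_mem (show u ∈ Icc (-η) η from abs_le.1 hu),
        indicator_of_mem (show |u| ∈ Iic η from hu)]
    · rw [indicator_of_notMem (show u ∉ Icc (-η) η from fun h => hu (abs_le.2 h)),
        indicator_of_notMem (show |u| ∉ Iic η from hu)]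
  have hval : ∫ u in Icc (-η) η, |u| ^ (-α) = 2 * (η ^ (1 - α) / (1 - α)) := by
    rw [← integral_indicator measurableSet_Icc]
    simp_rw [heq]
    rw [integral_comp_abs (f := (Iic η).indicator fun v : ℝ => v ^ (-α)),
      setIntegral_indicator measurableSet_Iic, Ioi_inter_Iic,
      ← intervalIntegral.integral_of_le hη.le, integral_rpow (Or.inl (by linarith))]
    rw [Real.zero_rpow (by linarith), sub_zero, show -α + 1 = 1 - α by ring]
  have hpos : 0 < η ^ (1 - α) := Real.rpow_pos_of_pos hη _
  refine ⟨?_, ?_⟩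
  · by_contra h
    have h0 := integral_undef h
    rw [hval] at h0
    have : 0 < 2 * (η ^ (1 - α) / (1 - α)) := by
      have : 0 < 1 - α := by linarith
      positivity
    linarith
  · rw [hval, show 4 * η ^ (1 - α) = 2 * (2 * η ^ (1 - α)) by ring]
    gcongr
    rw [div_le_iff₀ (by linarith)]
    nlinarith

lemma integrable_abs_rpow_neg_gaussian {α : ℝ} (hα0 : 0 ≤ α) (hα : α ≤ 1 / 2) :
    Integrable (fun u : ℝ => |u| ^ (-α)) (ProbabilityTheory.gaussianReal 0 1) := by
  have hloc : Integrable ((Icc (-1 : ℝ) 1).indicator fun u : ℝ => |u| ^ (-α))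
      (ProbabilityTheory.gaussianReal 0 1) := by
    rw [ProbabilityTheory.gaussianReal_of_var_ne_zero _ one_ne_zero,
      integrable_withDensity_iff_integrable_smul' (ProbabilityTheory.measurable_gaussianPDF _ _)
        (Filter.Eventually.of_forall fun x => ENNReal.ofReal_lt_top)]
    have h := (integrable_indicator_iff measurableSet_Icc).2
      (integrableOn_abs_rpow_neg hα (zero_lt_one' ℝ)).1
    refine h.bdd_mul (c := 1)
      (ProbabilityTheory.measurable_gaussianPDF 0 1).ennreal_toReal.aestronglyMeasurable
      (Filter.Eventually.of_forall fun x => ?_)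
    rw [ProbabilityTheory.toReal_gaussianPDF, ProbabilityTheory.gaussianPDFReal,
      Real.norm_of_nonneg (by positivity)]
    refine mul_le_one₀ ?_ (Real.exp_pos _).le ?_
    · refine inv_le_one_of_one_le₀ ?_
      rw [Real.one_le_sqrt]
      simp only [NNReal.coe_one, mul_one]
      linarith [Real.two_le_pi]
    · rw [Real.exp_le_one_iff]
      refine div_nonpos_of_nonpos_of_nonneg ?_ (by positivity)
      linarith [sq_nonneg (x - 0)]
  refine ((integrable_const (1 : ℝ)).add hloc).mono'
    (continuous_abs.measurable.pow_const _).aestronglyMeasurable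
    (Filter.Eventually.of_forall fun u => ?_)
  rw [Real.norm_of_nonneg (by positivity)]
  by_cases hu : |u| ≤ 1
  · simp only [Pi.add_apply]
    rw [indicator_of_mem (show u ∈ Icc (-1 : ℝ) 1 from abs_le.1 hu)]
    linarith
  · simp only [Pi.add_apply]
    rw [indicator_of_notMem (show u ∉ Icc (-1 : ℝ) 1 from fun h => hu (abs_le.2 h)), add_zero]
    exact Real.rpow_le_one_of_one_le_of_nonpos (not_le.1 hu).le (by linarith)

/-- Decay of the characteristic function implies a small-ball estimate. -/
theorem smallBall_of_charFun_decay {Ω : Type*} [MeasurableSpace Ω] {μ : Measure Ω}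
    [IsProbabilityMeasure μ] {g : Ω → ℝ} (hg : Measurable g) {α C : ℝ} (hα0 : 0 ≤ α)
    (hα : α ≤ 1 / 2)
    (hdecay : ∀ t : ℝ, t ≠ 0 →
      ‖∫ x, Complex.exp (Complex.I * (t : ℂ) * (g x : ℂ)) ∂μ‖ ≤ C * |t| ^ (-α))
    {ε : ℝ} (hε : 0 < ε) (a : ℝ) :
    (μ {x | |g x - a| ≤ ε}).toReal ≤ Real.exp (1 / 2) *
      (C * ∫ u, |u| ^ (-α) ∂(ProbabilityTheory.gaussianReal 0 1)) * ε ^ α := by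
  set γ := ProbabilityTheory.gaussianReal 0 1 with hγ
  have hmS : MeasurableSet {x | |g x - a| ≤ ε} :=
    measurableSet_le (by fun_prop) measurable_const
  have hchar : ∀ y : ℝ, ∫ u : ℝ, Complex.exp (y * u * Complex.I) ∂γ =
      ((Real.exp (-(y ^ 2 / 2)) : ℝ) : ℂ) := fun y => by
    rw [← charFun_apply_real, hγ, ProbabilityTheory.charFun_gaussianReal]
    push_cast
    congr 1
    simp
  have hei : Integrable (fun x => Real.exp (-(((g x - a) / ε) ^ 2 / 2))) μ := by
    refine Integrable.of_bound (by fun_prop) 1 (Filter.Eventually.of_forall fun x => ?_)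
    rw [Real.norm_of_nonneg (by positivity), Real.exp_le_one_iff]
    have := sq_nonneg ((g x - a) / ε)
    linarith
  have h1 : (μ {x | |g x - a| ≤ ε}).toReal ≤
      Real.exp (1 / 2) * ∫ x, Real.exp (-(((g x - a) / ε) ^ 2 / 2)) ∂μ := by
    rw [← integral_const_mul, ← measureReal_def, ← integral_indicator_one hmS]
    refine integral_mono ((integrable_const 1).indicator hmS) (hei.const_mul _) fun x => ?_
    show _ ≤ Real.exp (1 / 2) * Real.exp (-(((g x - a) / ε) ^ 2 / 2))
    by_cases hx : x ∈ {x | |g x - a| ≤ ε}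
    · rw [indicator_of_mem hx, ← Real.exp_add, Pi.one_apply, Real.one_le_exp_iff]
      have hx' : |g x - a| ≤ ε := hx
      have : ((g x - a) / ε) ^ 2 ≤ 1 := by
        rw [sq_le_one_iff_abs_le_one, abs_div, abs_of_pos hε, div_le_one hε]
        exact hx'
      linarith
    · rw [indicator_of_notMem hx]; positivity
  have h2 : ((∫ x, Real.exp (-(((g x - a) / ε) ^ 2 / 2)) ∂μ : ℝ) : ℂ) =
      ∫ u : ℝ, Complex.exp (-((a / ε : ℝ) * u * Complex.I)) *
        ∫ x, Complex.exp (Complex.I * ((u / ε : ℝ) : ℂ) * (g x : ℂ)) ∂μ ∂γ := by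
    rw [← integral_complex_ofReal]
    simp_rw [← hchar, ← integral_const_mul]
    rw [integral_integral_swap]
    · refine integral_congr_ae (Filter.Eventually.of_forall fun u => ?_)
      refine integral_congr_ae (Filter.Eventually.of_forall fun x => ?_)
      show Complex.exp _ = Complex.exp _ * Complex.exp _
      rw [← Complex.exp_add]
      congr 1
      push_cast
      ring
    · refine Integrable.of_bound ?_ 1 (Filter.Eventually.of_forall fun z => ?_)
      · refine Measurable.aestronglyMeasurable ?_
        simp only [Function.uncurry_def]
        fun_prop
      · simp only [Function.uncurry_def]
        rw [Complex.norm_exp]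
        simp
  have h3 : ∫ x, Real.exp (-(((g x - a) / ε) ^ 2 / 2)) ∂μ ≤ C * (∫ u, |u| ^ (-α) ∂γ) * ε ^ α := by
    have hnn : 0 ≤ ∫ x, Real.exp (-(((g x - a) / ε) ^ 2 / 2)) ∂μ :=
      integral_nonneg fun x => (Real.exp_pos _).le
    rw [← Real.norm_of_nonneg hnn, ← Complex.norm_real, h2, mul_right_comm, ← integral_const_mul]
    refine norm_integral_le_of_norm_le ((integrable_abs_rpow_neg_gaussian hα0 hα).const_mul _) ?_
    have hne : ∀ᵐ u : ℝ ∂γ, u ≠ 0 := by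
      have : NullSingletonClass γ :=
        ProbabilityTheory.nullSingletonClass_gaussianReal one_ne_zero
      exact measure_eq_zero_iff_ae_notMem.1 (measure_singleton (0 : ℝ))
    filter_upwards [hne] with u hu
    rw [norm_mul, show ‖Complex.exp (-((a / ε : ℝ) * u * Complex.I))‖ = 1 by
      rw [Complex.norm_exp]; simp, one_mul]
    refine (hdecay (u / ε) (div_ne_zero hu hε.ne')).trans (le_of_eq ?_)
    rw [abs_div, abs_of_pos hε, Real.div_rpow (abs_nonneg _) hε.le, Real.rpow_neg hε.le, div_inv_eq_mul]
    ring
  refine h1.trans ?_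
  rw [mul_assoc]
  gcongr

lemma totalDegree_C_mul_le {n d : ℕ} {f : MvPolynomial (Fin n) ℝ} (hf : f.totalDegree ≤ d)
    (s : ℝ) : (MvPolynomial.C s * f).totalDegree ≤ d := by
  refine (MvPolynomial.totalDegree_mul _ _).trans ?_
  rwa [MvPolynomial.totalDegree_C, zero_add]

lemma totalDegree_sub_C_le {n d : ℕ} {f : MvPolynomial (Fin n) ℝ} (hf : f.totalDegree ≤ d)
    (a : ℝ) : (f - MvPolynomial.C a).totalDegree ≤ d := by
  refine (MvPolynomial.totalDegree_sub _ _).trans ?_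
  rw [MvPolynomial.totalDegree_C]
  exact max_le hf (Nat.zero_le d)

/-- Polynomials are square integrable with respect to log-concave probability measures. -/
lemma memLp_two_of_logConcaveFun {n : ℕ} {φ : (Fin (n + 1) → ℝ) → ENNReal} (hm : Measurable φ)
    (hφ : LogConcaveFun φ) [hprob : IsProbabilityMeasure (volume.withDensity φ)]
    (f : MvPolynomial (Fin (n + 1)) ℝ) :
    MemLp (fun x => MvPolynomial.eval x f) 2 (volume.withDensity φ) := by
  obtain ⟨C, hC, hmom⟩ := exists_moment_const f.totalDegree
  set μ := volume.withDensity φ with hμ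
  have hfc : Continuous fun x => MvPolynomial.eval x f := MvPolynomial.continuous_eval f
  have hlim : Filter.Tendsto (fun N : ℕ => ∫ x, min 1 |1 / ((N : ℝ) + 1) * MvPolynomial.eval x f| ∂μ)
      Filter.atTop (nhds (∫ _, (0 : ℝ) ∂μ)) := by
    refine tendsto_integral_of_dominated_convergence (fun _ => (1 : ℝ)) (fun N => ?_)
      (integrable_const _) (fun N => Filter.Eventually.of_forall fun x => ?_)
      (Filter.Eventually.of_forall fun x => ?_)
    · exact (by fun_prop : Continuous fun x => min 1 |1 / ((N : ℝ) + 1) * MvPolynomial.eval x f|).aestronglyMeasurable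
    · rw [Real.norm_of_nonneg (by positivity)]
      exact min_le_left _ _
    · have h := (tendsto_one_div_add_atTop_nhds_zero_nat (𝕜 := ℝ)).mul_const (MvPolynomial.eval x f)
      have h2 := (tendsto_const_nhds (x := (1 : ℝ))).min h.abs
      simpa using h2
  rw [integral_zero] at hlim
  obtain ⟨N, hN⟩ := (hlim.eventually (gt_mem_nhds (by norm_num : (0 : ℝ) < 1 / 4))).exists
  have h := (hmom n φ hm hφ hprob (MvPolynomial.C (1 / ((N : ℝ) + 1)) * f)
    (totalDegree_C_mul_le le_rfl _) (by
      simp only [map_mul, MvPolynomial.eval_C]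
      exact hN.le)).1
  rw [memLp_two_iff_integrable_sq hfc.aestronglyMeasurable]
  have h2 := h.const_mul (((N : ℝ) + 1) ^ 2)
  refine h2.congr (Filter.Eventually.of_forall fun x => ?_)
  simp only [map_mul, MvPolynomial.eval_C]
  field_simp

lemma integral_sub_sq_eq_mVar_add {α : Type*} [MeasurableSpace α] {μ : Measure α}
    [IsProbabilityMeasure μ] {g : α → ℝ} (hg : MemLp g 2 μ) (a : ℝ) :
    ∫ x, (g x - a) ^ 2 ∂μ = mVar μ g + (∫ x, g x ∂μ - a) ^ 2 := by
  have h1 : Integrable g μ := hg.integrable (by norm_num)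
  have h2 : Integrable (fun x => g x ^ 2) μ := hg.integrable_sq
  have h3 : ∀ x, (g x - a) ^ 2 = g x ^ 2 - (2 * a * g x - a ^ 2) := fun x => by ring
  simp_rw [h3]
  have h4 : Integrable (fun x => 2 * a * g x - a ^ 2) μ :=
    (h1.const_mul _).sub (integrable_const _)
  rw [integral_sub h2 h4, integral_sub (h1.const_mul _) (integrable_const _), integral_const_mul,
    mVar]
  simp only [integral_const, probReal_univ, smul_eq_mul, one_mul]
  ring

/-- A small-ball bound at one scale forces a variance lower bound. -/
lemma le_mVar_of_smallBall {α : Type*} [MeasurableSpace α] {μ : Measure α}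
    [IsProbabilityMeasure μ] {g : α → ℝ} (hg : MemLp g 2 μ) (hgm : Measurable g) {ε : ℝ}
    (hε : 0 < ε) (h : ∀ a : ℝ, (μ {x | |g x - a| ≤ ε}).toReal ≤ 1 / 2) :
    ε ^ 2 / 2 ≤ mVar μ g := by
  set a := ∫ x, g x ∂μ with ha
  have hm : MeasurableSet {x | |g x - a| ≤ ε} :=
    measurableSet_le (by fun_prop) measurable_const
  have h1 := integral_sub_sq_eq_mVar_add hg a
  rw [← ha, sub_self, zero_pow two_ne_zero, add_zero] at h1
  have h2 : Integrable (fun x => (g x - a) ^ 2) μ := (hg.sub (memLp_const a)).integrable_sq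
  have h3 : ∫ x, ({x | |g x - a| ≤ ε}ᶜ).indicator (fun _ => ε ^ 2) x ∂μ ≤ ∫ x, (g x - a) ^ 2 ∂μ := by
    refine integral_mono ((integrable_const _).indicator hm.compl) h2 fun x => ?_
    by_cases hx : x ∈ {x | |g x - a| ≤ ε}ᶜ
    · rw [indicator_of_mem hx]
      have hx' : ¬ |g x - a| ≤ ε := hx
      exact sq_le_sq.2 (by rw [abs_of_pos hε]; exact (not_le.1 hx').le)
    · rw [indicator_of_notMem hx]; positivity
  rw [integral_indicator_const _ hm.compl, probReal_compl_eq_one_sub hm, h1, smul_eq_mul] at h3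
  have h4 : μ.real {x | |g x - a| ≤ ε} ≤ 1 / 2 := h a
  nlinarith [sq_nonneg ε]

/-- A bounded function having each weak sign with probability at least `p` has mean at most `1 - p`
in absolute value. -/
lemma abs_integral_le_one_sub {α : Type*} [MeasurableSpace α] {μ : Measure α}
    [IsProbabilityMeasure μ] {ψ : α → ℝ} (hψ : Measurable ψ) (hb : ∀ x, |ψ x| ≤ 1) {p : ℝ}
    (h1 : p ≤ μ.real {x | ψ x ≤ 0}) (h2 : p ≤ μ.real {x | 0 ≤ ψ x}) :
    |∫ x, ψ x ∂μ| ≤ 1 - p := by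
  have key : ∀ ψ : α → ℝ, Measurable ψ → (∀ x, |ψ x| ≤ 1) → p ≤ μ.real {x | ψ x ≤ 0} →
      ∫ x, ψ x ∂μ ≤ 1 - p := by
    intro ψ hψ hb h
    have hm : MeasurableSet {x | ψ x ≤ 0} := measurableSet_le hψ measurable_const
    have hi : Integrable ψ μ := Integrable.of_bound hψ.aestronglyMeasurable 1
      (Filter.Eventually.of_forall hb)
    have h3 : ∫ x, ψ x ∂μ ≤ ∫ x, ({x | ψ x ≤ 0}ᶜ).indicator (fun _ => (1 : ℝ)) x ∂μ := by
      refine integral_mono hi ((integrable_const _).indicator hm.compl) fun x => ?_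
      by_cases hx : x ∈ {x | ψ x ≤ 0}ᶜ
      · rw [indicator_of_mem hx]
        exact le_of_abs_le (hb x)
      · rw [indicator_of_notMem hx]
        exact not_not.1 hx
    rw [integral_indicator_const _ hm.compl, probReal_compl_eq_one_sub hm, smul_eq_mul,
      mul_one] at h3
    linarith
  refine abs_le.2 ⟨?_, key ψ hψ hb h1⟩
  have := key (fun x => -ψ x) hψ.neg (fun x => by rw [abs_neg]; exact hb x) (by simpa using h2)
  rw [integral_neg] at this
  linarith

/-- A variance lower bound keeps polynomials away from constants with positive probability. -/
lemma exists_spread_const {d : ℕ} {C₁ : ℝ} (hC₁ : 0 < C₁) : ∃ η : ℝ, 0 < η ∧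
    ∀ (n : ℕ) (φ : (Fin (n + 1) → ℝ) → ENNReal), Measurable φ → LogConcaveFun φ →
    IsProbabilityMeasure (volume.withDensity φ) →
    ∀ f : MvPolynomial (Fin (n + 1)) ℝ, f.totalDegree ≤ d →
    C₁ ≤ mVar (volume.withDensity φ) (fun x => MvPolynomial.eval x f) → ∀ a : ℝ,
    1 / 8 ≤ (volume.withDensity φ).real {x | η ≤ |MvPolynomial.eval x f - a|} := by
  obtain ⟨C, hC, hmom⟩ := exists_moment_const d
  set s := Real.sqrt (C₁ / (2 * C)) with hs
  have hs0 : 0 < s := by positivity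
  have hs2 : s ^ 2 = C₁ / (2 * C) := Real.sq_sqrt (by positivity)
  refine ⟨s / 8, by positivity, fun n φ hm hφ hprob f hf hvar a => ?_⟩
  set μ := volume.withDensity φ with hμ
  have hfc : Continuous fun x => MvPolynomial.eval x f := MvPolynomial.continuous_eval f
  by_contra! hlt
  have hmS : MeasurableSet {x | s / 8 ≤ |MvPolynomial.eval x f - a|} :=
    measurableSet_le measurable_const (by fun_prop)
  have hev : ∀ x, MvPolynomial.eval x (MvPolynomial.C (1 / s) * (f - MvPolynomial.C a)) =
      1 / s * (MvPolynomial.eval x f - a) := fun x => by simp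
  have h := (hmom n φ hm hφ hprob (MvPolynomial.C (1 / s) * (f - MvPolynomial.C a))
    (totalDegree_C_mul_le (totalDegree_sub_C_le hf a) _) (by
      simp_rw [hev]
      have h1 : ∫ x, min 1 |1 / s * (MvPolynomial.eval x f - a)| ∂μ ≤
          ∫ x, ({x | s / 8 ≤ |MvPolynomial.eval x f - a|}.indicator (fun _ => (1 : ℝ)) x + 1 / 8) ∂μ := by
        refine integral_mono (Integrable.of_bound (Continuous.aestronglyMeasurable (by fun_prop)) 1
          (Filter.Eventually.of_forall fun x => ?_))
          (((integrable_const _).indicator hmS).add (integrable_const _)) fun x => ?_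
        · rw [Real.norm_of_nonneg (by positivity)]
          exact min_le_left _ _
        · by_cases hx : x ∈ {x | s / 8 ≤ |MvPolynomial.eval x f - a|}
          · rw [indicator_of_mem hx]
            exact (min_le_left _ _).trans (by norm_num)
          · rw [indicator_of_notMem hx, zero_add]
            have hx' : ¬ s / 8 ≤ |MvPolynomial.eval x f - a| := hx
            refine (min_le_right _ _).trans ?_
            rw [abs_mul, abs_of_pos (by positivity : 0 < 1 / s), one_div_mul_eq_div,
              div_le_iff₀ hs0]
            linarith
      rw [integral_add ((integrable_const _).indicator hmS) (integrable_const _),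
        integral_indicator_const _ hmS] at h1
      simp only [integral_const, probReal_univ, smul_eq_mul, one_mul, mul_one] at h1
      linarith)).2
  simp_rw [hev, mul_pow] at h
  rw [integral_const_mul, integral_sub_sq_eq_mVar_add (memLp_two_of_logConcaveFun hm hφ f) a,
    one_div, inv_pow, inv_mul_le_iff₀ (by positivity), hs2,
    show C₁ / (2 * C) * C = C₁ / 2 by field_simp] at h
  nlinarith [sq_nonneg (∫ x, MvPolynomial.eval x f ∂μ - a)]

lemma integrable_one_add_rpow_neg {α : Type*} [MeasurableSpace α] {μ : Measure α}
    [IsFiniteMeasure μ] {g : α → ℝ} (hg : Measurable g) {r T : ℝ} (hr : 0 ≤ r) (hT : 0 ≤ T) :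
    Integrable (fun x => (1 + T * |g x|) ^ (-r)) μ := by
  refine Integrable.of_bound (Measurable.aestronglyMeasurable ?_) 1
    (Filter.Eventually.of_forall fun x => ?_)
  · exact ((continuous_abs.measurable.comp hg).const_mul T |>.const_add 1).pow_const _
  · have : 0 ≤ T * |g x| := by positivity
    rw [Real.norm_of_nonneg (by positivity)]
    exact Real.rpow_le_one_of_one_le_of_nonpos (by linarith) (by linarith)

lemma setIntegral_one_add_rpow_neg_le {r η T : ℝ} (hr0 : 0 ≤ r) (hr : r ≤ 1 / 2) (hη : 0 < η)
    (hT : 0 < T) (a y : ℝ) :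
    ∫ b in Icc a (a + η), (1 + T * |y - b|) ^ (-r) ≤ 5 * (T * η) ^ (-r) * η := by
  obtain ⟨hloc, hval⟩ := integrableOn_abs_rpow_neg hr hη
  set k : ℝ → ℝ := (Icc (-η) η).indicator fun u => |u| ^ (-r) with hk
  have hki : Integrable k := (integrable_indicator_iff measurableSet_Icc).2 hloc
  have hk0 : ∀ u, 0 ≤ k u := fun u => indicator_nonneg (fun u _ => by positivity) u
  have hkint : ∫ b, k (b - y) ≤ 4 * η ^ (1 - r) := by
    rw [integral_sub_right_eq_self, hk, integral_indicator measurableSet_Icc]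
    exact hval
  have hpt : ∀ b, b ≠ y → (1 + T * |y - b|) ^ (-r) ≤ (T * η) ^ (-r) + T ^ (-r) * k (b - y) := by
    intro b hb
    have hb0 : 0 < |b - y| := abs_pos.2 (sub_ne_zero.2 hb)
    rw [abs_sub_comm y b]
    by_cases hu : |b - y| ≤ η
    · rw [hk, indicator_of_mem (show b - y ∈ Icc (-η) η from abs_le.1 hu),
        ← Real.mul_rpow hT.le hb0.le]
      have h1 : (1 + T * |b - y|) ^ (-r) ≤ (T * |b - y|) ^ (-r) :=
        Real.rpow_le_rpow_of_nonpos (by positivity) (by linarith) (by linarith)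
      have h2 : 0 ≤ (T * η) ^ (-r) := by positivity
      linarith
    · have h1 : (1 + T * |b - y|) ^ (-r) ≤ (T * η) ^ (-r) := by
        refine Real.rpow_le_rpow_of_nonpos (by positivity) ?_ (by linarith)
        have := mul_le_mul_of_nonneg_left (not_le.1 hu).le hT.le
        linarith
      have h2 := mul_nonneg (Real.rpow_nonneg hT.le (-r)) (hk0 (b - y))
      linarith
  have hki' : Integrable (fun b => T ^ (-r) * k (b - y)) := (hki.comp_sub_right y).const_mul _
  have hfin : volume (Icc a (a + η)) ≠ ⊤ := by simp
  have : IsFiniteMeasure (volume.restrict (Icc a (a + η))) := ⟨by simp⟩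
  calc ∫ b in Icc a (a + η), (1 + T * |y - b|) ^ (-r)
      ≤ ∫ b in Icc a (a + η), ((T * η) ^ (-r) + T ^ (-r) * k (b - y)) := by
        refine integral_mono_ae (integrable_one_add_rpow_neg (by fun_prop) hr0 hT.le)
          ((integrable_const _).add hki'.integrableOn) ?_
        have hne : ∀ᵐ b : ℝ ∂(volume.restrict (Icc a (a + η))), b ≠ y :=
          ae_restrict_of_ae (measure_eq_zero_iff_ae_notMem.1 (measure_singleton y))
        filter_upwards [hne] with b hb using hpt b hb
    _ = (T * η) ^ (-r) * η + ∫ b in Icc a (a + η), T ^ (-r) * k (b - y) := by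
        rw [integral_add (integrable_const _) hki'.integrableOn]
        simp [hη.le, mul_comm]
    _ ≤ (T * η) ^ (-r) * η + ∫ b, T ^ (-r) * k (b - y) := by
        refine add_le_add le_rfl (setIntegral_le_integral hki' (Filter.Eventually.of_forall
          fun b => mul_nonneg (by positivity) (hk0 _)))
    _ ≤ (T * η) ^ (-r) * η + T ^ (-r) * (4 * η ^ (1 - r)) := by
        rw [integral_const_mul]
        gcongr
    _ = 5 * (T * η) ^ (-r) * η := by
        rw [Real.mul_rpow hT.le hη.le, sub_eq_add_neg, Real.rpow_add hη, Real.rpow_one]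
        ring

/-- Some point of an interval of length `η` is a good centre for the kernel `(1 + T|·|)^(-r)`. -/
lemma exists_center_le {α : Type*} [MeasurableSpace α] {μ : Measure α} [IsProbabilityMeasure μ]
    {g : α → ℝ} (hg : Measurable g) {r η T : ℝ} (hr0 : 0 ≤ r) (hr : r ≤ 1 / 2) (hη : 0 < η)
    (hT : 0 < T) (a : ℝ) :
    ∃ b ∈ Icc a (a + η), ∫ x, (1 + T * |g x - b|) ^ (-r) ∂μ ≤ 6 * (T * η) ^ (-r) := by
  by_contra! hgt
  have : IsFiniteMeasure (volume.restrict (Icc a (a + η))) := ⟨by simp⟩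
  have hi : Integrable (Function.uncurry fun (b : ℝ) (x : α) => (1 + T * |g x - b|) ^ (-r))
      ((volume.restrict (Icc a (a + η))).prod μ) :=
    integrable_one_add_rpow_neg (g := fun z : ℝ × α => g z.2 - z.1) (by fun_prop) hr0 hT.le
  have hpos : 0 < (T * η) ^ (-r) := by positivity
  have h1 : ∫ b in Icc a (a + η), ∫ x, (1 + T * |g x - b|) ^ (-r) ∂μ ≤ 5 * (T * η) ^ (-r) * η := by
    rw [integral_integral_swap hi]
    calc ∫ x, (∫ b in Icc a (a + η), (1 + T * |g x - b|) ^ (-r)) ∂μ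
        ≤ ∫ x, 5 * (T * η) ^ (-r) * η ∂μ := integral_mono hi.integral_prod_right
          (integrable_const _) fun x => setIntegral_one_add_rpow_neg_le hr0 hr hη hT a (g x)
      _ = _ := by simp
  have h2 : ∫ b in Icc a (a + η), 6 * (T * η) ^ (-r) ≤
      ∫ b in Icc a (a + η), ∫ x, (1 + T * |g x - b|) ^ (-r) ∂μ :=
    setIntegral_mono_on (integrable_const _) hi.integral_prod_left measurableSet_Icc
      fun b hb => (hgt b hb).le
  simp only [setIntegral_const, smul_eq_mul, Real.volume_real_Icc, add_sub_cancel_left,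
    max_eq_left hη.le] at h2
  nlinarith [mul_pos hpos hη]

/-- If `g` is spread around every point at scale `η`, some interval of length `η` has mass on both
sides. -/
lemma exists_two_sided_interval {α : Type*} [MeasurableSpace α] {μ : Measure α}
    [IsProbabilityMeasure μ] {g : α → ℝ} (hg : Measurable g) {η p : ℝ} (hη : 0 < η) (hp : 0 < p)
    (hp1 : p < 1) (h : ∀ a : ℝ, 2 * p ≤ μ.real {x | η ≤ |g x - a|}) :
    ∃ a : ℝ, p ≤ μ.real {x | g x ≤ a} ∧ p ≤ μ.real {x | a + η ≤ g x} := by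
  set A : Set ℝ := {a | p ≤ μ.real {x | g x ≤ a}} with hA
  have hcdf : ∀ a, ProbabilityTheory.cdf (μ.map g) a = μ.real {x | g x ≤ a} := fun a => by
    have := Measure.isProbabilityMeasure_map (μ := μ) hg.aemeasurable
    rw [ProbabilityTheory.cdf_eq_real, map_measureReal_apply hg measurableSet_Iic]
    rfl
  have hAne : A.Nonempty := by
    obtain ⟨a, ha⟩ := ((ProbabilityTheory.tendsto_cdf_atTop (μ.map g)).eventually
      (lt_mem_nhds hp1)).exists
    exact ⟨a, by rw [hcdf] at ha; exact ha.le⟩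
  have hAbdd : BddBelow A := by
    obtain ⟨a, ha⟩ := ((ProbabilityTheory.tendsto_cdf_atBot (μ.map g)).eventually
      (gt_mem_nhds hp)).exists
    refine ⟨a, fun b hb => ?_⟩
    have hb' : p ≤ μ.real {x | g x ≤ b} := hb
    rw [← hcdf] at hb'
    by_contra! hlt
    have := ProbabilityTheory.monotone_cdf (μ.map g) hlt.le
    linarith
  obtain ⟨a, ha, hlt⟩ := exists_lt_of_csInf_lt hAne (lt_add_of_pos_right (sInf A) hη)
  refine ⟨a, ha, ?_⟩
  have h1 : μ.real {x | g x ≤ a - η} < p := by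
    by_contra! hle
    have := csInf_le hAbdd (show a - η ∈ A from hle)
    linarith
  have h2 : μ.real {x | η ≤ |g x - a|} ≤ μ.real {x | g x ≤ a - η} + μ.real {x | a + η ≤ g x} := by
    refine (measureReal_mono fun x hx => ?_).trans (measureReal_union_le _ _)
    have hx' : η ≤ |g x - a| := hx
    rcases le_abs.1 hx' with h | h
    · exact Or.inr (show a + η ≤ g x by linarith)
    · exact Or.inl (show g x ≤ a - η by linarith)
  linarith [h a]

lemma clamp_nonneg {y : ℝ} (h : 0 ≤ y) : 0 ≤ clamp y :=
  le_max_of_le_right (le_min zero_le_one h)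

lemma clamp_nonpos {y : ℝ} (h : y ≤ 0) : clamp y ≤ 0 :=
  max_le (by norm_num) ((min_le_right _ _).trans h)

/-- A variance lower bound implies decay of the characteristic function. -/
theorem exists_decay_const {d : ℕ} (hd : 2 ≤ d) {C₁ : ℝ} (hC₁ : 0 < C₁) : ∃ C : ℝ, 0 < C ∧
    ∀ (n : ℕ) (φ : (Fin (n + 1) → ℝ) → ENNReal), Measurable φ → LogConcaveFun φ →
    IsProbabilityMeasure (volume.withDensity φ) →
    ∀ f : MvPolynomial (Fin (n + 1)) ℝ, f.totalDegree ≤ d →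
    C₁ ≤ mVar (volume.withDensity φ) (fun x => MvPolynomial.eval x f) → ∀ t : ℝ, t ≠ 0 →
    ‖∫ x, Complex.exp (Complex.I * (t : ℂ) * (MvPolynomial.eval x f : ℂ)) ∂(volume.withDensity φ)‖
      ≤ C * |t| ^ (-(1 / (d : ℝ))) := by
  obtain ⟨η, hη, hspread⟩ := exists_spread_const (d := d) hC₁
  obtain ⟨C, hC, hosc⟩ := exists_clamp_const hd (show (0 : ℝ) < 1 / 16 by norm_num)
  have hr0 : (0 : ℝ) ≤ 1 / d := by positivity
  have hr : 1 / (d : ℝ) ≤ 1 / 2 :=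
    one_div_le_one_div_of_le two_pos (by exact_mod_cast hd)
  refine ⟨C * (6 * η ^ (-(1 / (d : ℝ)))), by positivity,
    fun n φ hm hφ hprob f hf hvar t ht => ?_⟩
  set μ := volume.withDensity φ with hμ
  have hfc : Continuous fun x => MvPolynomial.eval x f := MvPolynomial.continuous_eval f
  have hT : 0 < |t| := abs_pos.2 ht
  obtain ⟨a, ha1, ha2⟩ := exists_two_sided_interval (p := 1 / 16) (μ := μ) hfc.measurable hη
    (by norm_num) (by norm_num) fun a =>
      (by norm_num : (2 : ℝ) * (1 / 16) = 1 / 8).trans_le (hspread n φ hm hφ hprob f hf hvar a)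
  obtain ⟨b, hb, hbJ⟩ := exists_center_le (μ := μ) hfc.measurable hr0 hr hη hT a
  have hev : ∀ x, MvPolynomial.eval x (MvPolynomial.C t * (f - MvPolynomial.C b)) =
      t * (MvPolynomial.eval x f - b) := fun x => by simp
  have hsign : ∀ S : Set (Fin (n + 1) → ℝ), ∀ S' : Set (Fin (n + 1) → ℝ), S ⊆ S' →
      1 / 16 ≤ μ.real S → 1 / 16 ≤ μ.real S' := fun S S' hS h => h.trans (measureReal_mono hS)
  have hclamp : |∫ x, clamp (t * (MvPolynomial.eval x f - b)) ∂μ| ≤ 1 - 1 / 16 := by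
    have hmeas : Measurable fun x => clamp (t * (MvPolynomial.eval x f - b)) := by fun_prop
    rcases lt_or_gt_of_ne ht with h | h
    · refine abs_integral_le_one_sub hmeas (fun x => abs_clamp_le _)
        (hsign _ _ (fun x hx => ?_) ha2) (hsign _ _ (fun x hx => ?_) ha1)
      · have hx' : a + η ≤ MvPolynomial.eval x f := hx
        exact clamp_nonpos (mul_nonpos_of_nonpos_of_nonneg h.le (by linarith [hb.2]))
      · have hx' : MvPolynomial.eval x f ≤ a := hx
        exact clamp_nonneg (mul_nonneg_of_nonpos_of_nonpos h.le (by linarith [hb.1]))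
    · refine abs_integral_le_one_sub hmeas (fun x => abs_clamp_le _)
        (hsign _ _ (fun x hx => ?_) ha1) (hsign _ _ (fun x hx => ?_) ha2)
      · have hx' : MvPolynomial.eval x f ≤ a := hx
        exact clamp_nonpos (mul_nonpos_of_nonneg_of_nonpos h.le (by linarith [hb.1]))
      · have hx' : a + η ≤ MvPolynomial.eval x f := hx
        exact clamp_nonneg (mul_nonneg h.le (by linarith [hb.2]))
  have h := hosc n φ hm hφ hprob (MvPolynomial.C t * (f - MvPolynomial.C b))
    (totalDegree_C_mul_le (totalDegree_sub_C_le hf b) t) (by simp_rw [hev]; exact hclamp)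
  simp_rw [hev, abs_mul] at h
  have hphase : ∫ x, Complex.exp (Complex.I * (t : ℂ) * (MvPolynomial.eval x f : ℂ)) ∂μ =
      Complex.exp (Complex.I * (t * b : ℝ)) *
        ∫ x, Complex.exp (Complex.I * ((t * (MvPolynomial.eval x f - b) : ℝ) : ℂ)) ∂μ := by
    rw [← integral_const_mul]
    congr 1
    ext x
    rw [← Complex.exp_add]
    congr 1
    push_cast
    ring
  rw [hphase, norm_mul, show ‖Complex.exp (Complex.I * (t * b : ℝ))‖ = 1 by
    rw [Complex.norm_exp]; simp, one_mul]
  refine h.trans ?_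
  rw [mul_assoc]
  gcongr
  refine hbJ.trans (le_of_eq ?_)
  rw [Real.mul_rpow hT.le hη.le]
  ring

lemma exists_eq_succ_of_totalDegree {n d : ℕ} (hd : 2 ≤ d) (f : MvPolynomial (Fin n) ℝ)
    (hf : f.totalDegree = d) : ∃ m, n = m + 1 := by
  rcases n with _ | m
  · rw [MvPolynomial.eq_C_of_isEmpty f, MvPolynomial.totalDegree_C] at hf
    omega
  · exact ⟨m, rfl⟩

lemma mVar_ge_of_smallBall_rpow {d : ℕ} (hd : 2 ≤ d) {C₂ : ℝ} (hC₂ : 0 < C₂) {n : ℕ}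
    {μ : Measure (Fin n → ℝ)} [IsProbabilityMeasure μ] (hμ : IsLogConcave μ)
    (f : MvPolynomial (Fin n) ℝ) (hf : f.totalDegree = d)
    (h : ∀ ε : ℝ, 0 < ε → ∀ a : ℝ,
      (μ {x | |MvPolynomial.eval x f - a| ≤ ε}).toReal ≤ C₂ * ε ^ (1 / (d : ℝ))) :
    ((1 / (2 * C₂)) ^ d) ^ 2 / 2 ≤ mVar μ (fun x => MvPolynomial.eval x f) := by
  obtain ⟨m, rfl⟩ := exists_eq_succ_of_totalDegree hd f hf
  obtain ⟨φ, hm, hφ, -, rfl⟩ := hμ.exists_measurable_density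
  refine le_mVar_of_smallBall (memLp_two_of_logConcaveFun hm hφ f)
    (MvPolynomial.continuous_eval f).measurable (by positivity) fun a =>
      (h _ (by positivity) a).trans (le_of_eq ?_)
  rw [one_div (d : ℝ), Real.pow_rpow_inv_natCast (by positivity) (by omega)]
  field_simp

end

/-- Proposition 1.2: for a log-concave probability measure and a polynomial of degree `d ≥ 2`,
variance lower bounds, small-ball estimates with exponent `1/d`, and Fourier decay with
exponent `1/d` are quantitatively equivalent, with constants depending only on each other
and on `d`. -/
theorem equivalence_of_anticoncentration_notions (d : ℕ) (hd : 2 ≤ d) :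
    -- (3) ⟹ (2), with C₂ depending only on C₃ and d
    (∃ F : ℝ → ℝ, ∀ C₃ : ℝ, 0 < C₃ → 0 < F C₃ ∧
      ∀ (n : ℕ) (μ : Measure (Fin n → ℝ)), IsProbabilityMeasure μ → IsLogConcave μ →
      ∀ f : MvPolynomial (Fin n) ℝ, f.totalDegree = d →
      (∀ t : ℝ, t ≠ 0 →
        ‖∫ x, Complex.exp (Complex.I * (t : ℂ) * (MvPolynomial.eval x f : ℂ)) ∂μ‖
          ≤ C₃ * |t| ^ (-(1 / (d : ℝ)))) →
      ∀ ε : ℝ, 0 < ε → ∀ a : ℝ,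
        (μ {x | |MvPolynomial.eval x f - a| ≤ ε}).toReal ≤ F C₃ * ε ^ (1 / (d : ℝ))) ∧
    -- (2) ⟹ (1), with C₁ depending only on C₂ and d
    (∃ F : ℝ → ℝ, ∀ C₂ : ℝ, 0 < C₂ → 0 < F C₂ ∧
      ∀ (n : ℕ) (μ : Measure (Fin n → ℝ)), IsProbabilityMeasure μ → IsLogConcave μ →
      ∀ f : MvPolynomial (Fin n) ℝ, f.totalDegree = d →
      (∀ ε : ℝ, 0 < ε → ∀ a : ℝ,
        (μ {x | |MvPolynomial.eval x f - a| ≤ ε}).toReal ≤ C₂ * ε ^ (1 / (d : ℝ))) →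
      F C₂ ≤ mVar μ (fun x => MvPolynomial.eval x f)) ∧
    -- (1) ⟹ (3), with C₃ depending only on C₁ and d
    (∃ F : ℝ → ℝ, ∀ C₁ : ℝ, 0 < C₁ → 0 < F C₁ ∧
      ∀ (n : ℕ) (μ : Measure (Fin n → ℝ)), IsProbabilityMeasure μ → IsLogConcave μ →
      ∀ f : MvPolynomial (Fin n) ℝ, f.totalDegree = d →
      C₁ ≤ mVar μ (fun x => MvPolynomial.eval x f) →
      ∀ t : ℝ, t ≠ 0 →
        ‖∫ x, Complex.exp (Complex.I * (t : ℂ) * (MvPolynomial.eval x f : ℂ)) ∂μ‖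
          ≤ F C₁ * |t| ^ (-(1 / (d : ℝ)))) := by
  refine ⟨⟨fun C₃ => Real.exp (1 / 2) * (C₃ * ∫ u, |u| ^ (-(1 / (d : ℝ)))
    ∂(ProbabilityTheory.gaussianReal 0 1)) + 1, fun C₃ hC₃ => ⟨?_, ?_⟩⟩,
    ⟨fun C₂ => ((1 / (2 * C₂)) ^ d) ^ 2 / 2, fun C₂ hC₂ => ⟨by positivity, ?_⟩⟩, ?_⟩
  · have : 0 ≤ ∫ u, |u| ^ (-(1 / (d : ℝ))) ∂(ProbabilityTheory.gaussianReal 0 1) :=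
      integral_nonneg fun u => by positivity
    positivity
  · intro n μ hμ _ f _ h ε hε a
    have hd' : 1 / (d : ℝ) ≤ 1 / 2 := one_div_le_one_div_of_le two_pos (by exact_mod_cast hd)
    refine (smallBall_of_charFun_decay (MvPolynomial.continuous_eval f).measurable
      (by positivity) hd' h hε a).trans ?_
    gcongr
    linarith
  · exact fun n μ _ hμ f hf h => mVar_ge_of_smallBall_rpow hd hC₂ hμ f hf h
  · choose! F hF0 hF using fun (C₁ : ℝ) (h : 0 < C₁) => exists_decay_const hd h
    refine ⟨F, fun C₁ hC₁ => ⟨hF0 C₁ hC₁, fun n μ hprob hμ f hf hvar => ?_⟩⟩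
    obtain ⟨m, rfl⟩ := exists_eq_succ_of_totalDegree hd f hf
    obtain ⟨φ, hm, hφ, -, rfl⟩ := hμ.exists_measurable_density
    exact hF C₁ hC₁ m φ hm hφ hprob f hf.le hvar
end
end

section
/- Let p ≥ 1, n ∈ ℕ, let f : ℝ^n → ℝ be a degree-d homogeneous polynomial, and let β ≥ −d be real. Then ∫ ‖x‖_p^β f(x) dμ_{n,p}(x) = ((n+d)/(n+d+β)) · R_{n,p}^β · ∫ f dμ_{n,p}, where ‖x‖_p := (Σ_{i=1}^n |x_i|^p)^{1/p}; in particular ∫ ‖x‖_p^β dμ_{n,p} = (n/(n+β)) R_{n,p}^β. Similarly, ∫ ‖x‖_p^β f(x) dγ_p^n(x) = (Γ((n+d+β)/p)/Γ((n+d)/p)) · ∫ f dγ_p^n. -/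
open MeasureTheory

noncomputable section

/-- `coeffNorm d f` is `coeff_d(f)`, the ℓ² norm of the coefficients of the degree-`d`
homogeneous part of `f`. -/
def coeffNorm {n : ℕ} (d : ℕ) (f : MvPolynomial (Fin n) ℝ) : ℝ :=
  Real.sqrt (∑ I ∈ f.support.filter (fun I => (I.sum fun _ e => e) = d),
    (MvPolynomial.coeff I f) ^ 2)

/-- The isotropic radius `R_{n,p}`. -/
def Rnp (n : ℕ) (p : ℝ) : ℝ :=
  Real.sqrt ((((n : ℝ) + 2) / n) * (Real.Gamma (((n : ℝ) + 2) / p) / Real.Gamma ((n : ℝ) / p)) *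
    (Real.Gamma (1 / p) / Real.Gamma (3 / p)))

/-- The isotropic `L^p` ball `B_{n,p}` in ℝ^n. -/
def lpBall (n : ℕ) (p : ℝ) : Set (Fin n → ℝ) :=
  {x | ∑ i, |x i| ^ p ≤ Rnp n p ^ p}

/-- `μ_{n,p}`, the uniform probability measure on the isotropic `L^p` ball. -/
def muNP (n : ℕ) (p : ℝ) : Measure (Fin n → ℝ) :=
  (volume (lpBall n p))⁻¹ • volume.restrict (lpBall n p)

/-- The `p`-Gaussian probability measure on ℝ, with density `e^{-|x|^p} / ((2/p) Γ(1/p))`. -/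
def gammaP (p : ℝ) : Measure ℝ :=
  volume.withDensity fun x =>
    ENNReal.ofReal (Real.exp (-|x| ^ p) / ((2 / p) * Real.Gamma (1 / p)))

/-- The `n`-fold product of the `p`-Gaussian measure, on ℝ^n. -/
def gammaPn (p : ℝ) (n : ℕ) : Measure (Fin n → ℝ) :=
  Measure.pi fun _ => gammaP p

open Set Metric Measure in
/-- Polar coordinates separate the radial part from a positively homogeneous function. -/
lemma integral_fun_norm_mul_homogeneous {E : Type*} [NormedAddCommGroup E] [NormedSpace ℝ E]
    [Nontrivial E] [FiniteDimensional ℝ E] [MeasurableSpace E] [BorelSpace E] (μ : Measure E)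
    [μ.IsAddHaarMeasure] {F : E → ℝ} {d : ℕ}
    (hF : ∀ r : ℝ, 0 < r → ∀ x, F (r • x) = r ^ d * F x) (h : ℝ → ℝ) :
    ∫ x, h ‖x‖ * F x ∂μ = (∫ u : sphere (0 : E) 1, F u ∂μ.toSphere) *
      ∫ r in Ioi (0 : ℝ), r ^ (Module.finrank ℝ E - 1) * (r ^ d * h r) := by
  calc
    ∫ x, h ‖x‖ * F x ∂μ = ∫ x : ({(0)}ᶜ : Set E), h ‖x.1‖ * F x.1 ∂(μ.comap (↑)) := by
      rw [integral_subtype_comap (measurableSet_singleton _).compl fun x ↦ h ‖x‖ * F x,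
        restrict_compl_singleton]
    _ = ∫ z, F z.1 * (z.2.1 ^ d * h z.2)
          ∂μ.toSphere.prod (.volumeIoiPow (Module.finrank ℝ E - 1)) := by
      rw [← μ.measurePreserving_homeomorphUnitSphereProd.integral_comp
        (Homeomorph.measurableEmbedding _)
        (fun z : sphere (0 : E) 1 × Ioi (0 : ℝ) ↦ F z.1 * (z.2.1 ^ d * h z.2))]
      refine integral_congr_ae (.of_forall fun x ↦ ?_)
      have hx : 0 < ‖x.1‖ := norm_pos_iff.2 x.2
      have hFx : F x.1 = ‖x.1‖ ^ d * F (‖x.1‖⁻¹ • x.1) := by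
        rw [← hF _ hx, smul_inv_smul₀ hx.ne']
      simp only [homeomorphUnitSphereProd_apply_snd_coe, homeomorphUnitSphereProd_apply_fst_coe]
      rw [hFx]
      ring
    _ = (∫ u : sphere (0 : E) 1, F u ∂μ.toSphere) *
          ∫ r : Ioi (0 : ℝ), r.1 ^ d * h r ∂.volumeIoiPow (Module.finrank ℝ E - 1) :=
      integral_prod_mul (fun u : sphere (0 : E) 1 ↦ F u) fun r : Ioi (0 : ℝ) ↦ r.1 ^ d * h r
    _ = _ := by
      simp only [Measure.volumeIoiPow, ENNReal.ofReal]
      rw [integral_withDensity_eq_integral_smul,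
        integral_subtype_comap measurableSet_Ioi fun a ↦
          Real.toNNReal (a ^ (Module.finrank ℝ E - 1)) • (a ^ d * h a),
        setIntegral_congr_fun measurableSet_Ioi fun x hx ↦ ?_]
      · rw [NNReal.smul_def, Real.coe_toNNReal _ (pow_nonneg hx.out.le _), smul_eq_mul]
      · exact (measurable_subtype_coe.pow_const _).real_toNNReal

lemma MvPolynomial.IsHomogeneous.eval_smul_arg {σ R : Type*} [CommSemiring R] [Finite σ]
    {f : MvPolynomial σ R} {d : ℕ} (hf : f.IsHomogeneous d) (r : R) (x : σ → R) :
    MvPolynomial.eval (r • x) f = r ^ d * MvPolynomial.eval x f := by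
  cases nonempty_fintype σ
  rw [MvPolynomial.eval_eq', MvPolynomial.eval_eq', Finset.mul_sum]
  refine Finset.sum_congr rfl fun e he ↦ ?_
  have hd : ∑ i, e i = d := by
    rw [← hf (MvPolynomial.mem_support_iff.1 he), Finsupp.weight_apply, Finsupp.sum_fintype] <;> simp
  simp only [Pi.smul_apply, smul_eq_mul, mul_pow, Finset.prod_mul_distrib,
    Finset.prod_pow_eq_pow_sum, hd]
  ring

open Set in
/-- Integrals over `ℝ^n` of a radial function for the `L^p` norm times a homogeneous polynomial
factor, with the first factor depending only on the polynomial. -/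
lemma exists_integral_lpNorm_mul_eval {p : ℝ} (hp : 1 ≤ p) {n d : ℕ} (hn : 1 ≤ n)
    {f : MvPolynomial (Fin n) ℝ} (hf : f.IsHomogeneous d) :
    ∃ K : ℝ, ∀ h : ℝ → ℝ,
      ∫ x : Fin n → ℝ, h ((∑ i, |x i| ^ p) ^ (1 / p)) * MvPolynomial.eval x f =
        K * ∫ r in Ioi (0 : ℝ), r ^ ((n : ℝ) + d - 1) * h r := by
  have hp0 : 0 < p := by linarith
  let q : ENNReal := ENNReal.ofReal p
  have hq : q.toReal = p := ENNReal.toReal_ofReal hp0.le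
  have : Fact (1 ≤ q) := ⟨by simpa [q] using hp⟩
  have : NeZero n := ⟨by omega⟩
  let L := (PiLp.continuousLinearEquiv q ℝ (fun _ : Fin n ↦ ℝ)).symm
  let μ : Measure (PiLp q fun _ : Fin n ↦ ℝ) := (volume : Measure (Fin n → ℝ)).map L
  have : μ.IsAddHaarMeasure := L.isAddHaarMeasure_map _
  have : Nontrivial (PiLp q fun _ : Fin n ↦ ℝ) := L.symm.toEquiv.nontrivial
  have hdim : Module.finrank ℝ (PiLp q fun _ : Fin n ↦ ℝ) = n := by
    rw [L.symm.toLinearEquiv.finrank_eq]; simp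
  refine ⟨∫ u : Metric.sphere (0 : PiLp q fun _ : Fin n ↦ ℝ) 1,
    MvPolynomial.eval (WithLp.ofLp u.1) f ∂μ.toSphere, fun h ↦ ?_⟩
  have key := integral_fun_norm_mul_homogeneous μ
    (F := fun y ↦ MvPolynomial.eval (WithLp.ofLp y) f) (d := d)
    (fun r _ x ↦ by simpa using hf.eval_smul_arg r (WithLp.ofLp x)) h
  rw [show μ = volume.map L.toHomeomorph from rfl,
    L.toHomeomorph.measurableEmbedding.integral_map, hdim] at key
  convert key using 1
  · refine integral_congr_ae (.of_forall fun x ↦ ?_)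
    have : ‖L x‖ = (∑ i, |x i| ^ p) ^ (1 / p) := by
      rw [PiLp.norm_eq_sum (by rw [hq]; exact hp0), hq]; rfl
    simp only [← this]; rfl
  · congr 1
    refine setIntegral_congr_fun measurableSet_Ioi fun r (hr : 0 < r) ↦ ?_
    rw [← mul_assoc, ← pow_add, ← Real.rpow_natCast, Nat.cast_add, Nat.cast_sub hn]
    congr 2
    push_cast
    ring

lemma lintegral_fin_nat_prod_eq_prod {n : ℕ} {E : Fin n → Type*}
    {mE : ∀ i, MeasurableSpace (E i)} {μ : (i : Fin n) → Measure (E i)} [∀ i, SigmaFinite (μ i)]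
    {f : (i : Fin n) → E i → ENNReal} (hf : ∀ i, Measurable (f i)) :
    ∫⁻ x, ∏ i, f i (x i) ∂(Measure.pi μ) = ∏ i, ∫⁻ x, f i x ∂(μ i) := by
  induction n with
  | zero => simp
  | succ n ih =>
    calc
      _ = ∫⁻ x : E 0 × ((i : Fin n) → E i.succ), f 0 x.1 * ∏ i : Fin n, f i.succ (x.2 i)
            ∂((μ 0).prod (Measure.pi fun i ↦ μ i.succ)) := by
        rw [← ((measurePreserving_piFinSuccAbove μ 0).symm).lintegral_comp_emb
          (MeasurableEquiv.measurableEmbedding _)]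
        refine lintegral_congr fun x ↦ ?_
        rw [Fin.prod_univ_succ]
        rfl
      _ = (∫⁻ x, f 0 x ∂μ 0) * ∏ i : Fin n, ∫⁻ x, f i.succ x ∂(μ i.succ) := by
        rw [← ih fun i : Fin n ↦ hf i.succ]
        exact lintegral_prod_mul (hf 0).aemeasurable (Finset.measurable_prod _ fun i _ ↦
          (hf (Fin.succ i)).comp (measurable_pi_apply i)).aemeasurable
      _ = ∏ i, ∫⁻ x, f i x ∂(μ i) := by rw [Fin.prod_univ_succ]

lemma pi_withDensity_fin {n : ℕ} {E : Fin n → Type*}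
    {mE : ∀ i, MeasurableSpace (E i)} {μ : (i : Fin n) → Measure (E i)} [∀ i, SigmaFinite (μ i)]
    {f : (i : Fin n) → E i → ENNReal} (hf : ∀ i, Measurable (f i))
    [∀ i, SigmaFinite ((μ i).withDensity (f i))] :
    Measure.pi (fun i ↦ (μ i).withDensity (f i)) =
      (Measure.pi μ).withDensity fun x ↦ ∏ i, f i (x i) := by
  refine Measure.pi_eq fun s hs ↦ ?_
  rw [withDensity_apply _ (.univ_pi hs), Measure.restrict_pi_pi, lintegral_fin_nat_prod_eq_prod hf]
  exact Finset.prod_congr rfl fun i _ ↦ (withDensity_apply _ (hs i)).symm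

lemma integral_gammaPn {p : ℝ} (hp : 0 < p) (n : ℕ) (g : (Fin n → ℝ) → ℝ) :
    ∫ x, g x ∂(gammaPn p n) = (((2 / p) * Real.Gamma (1 / p)) ^ n)⁻¹ *
      ∫ x, Real.exp (-∑ i, |x i| ^ p) * g x := by
  have hc : 0 < (2 / p) * Real.Gamma (1 / p) :=
    mul_pos (by positivity) (Real.Gamma_pos_of_pos (by positivity))
  have hm : Measurable fun x : ℝ ↦
      ENNReal.ofReal (Real.exp (-|x| ^ p) / ((2 / p) * Real.Gamma (1 / p))) := by fun_prop
  have : SigmaFinite (volume.withDensity fun x : ℝ ↦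
      ENNReal.ofReal (Real.exp (-|x| ^ p) / ((2 / p) * Real.Gamma (1 / p)))) :=
    SigmaFinite.withDensity_ofReal _
  unfold gammaPn gammaP
  rw [pi_withDensity_fin fun _ ↦ hm, integral_withDensity_eq_integral_toReal_smul
    (by fun_prop)
    (.of_forall fun x ↦ ENNReal.prod_lt_top fun i _ ↦ ENNReal.ofReal_lt_top),
    ← integral_const_mul, volume_pi]
  refine integral_congr_ae (.of_forall fun x ↦ ?_)
  simp only [ENNReal.toReal_prod, smul_eq_mul]
  simp_rw [ENNReal.toReal_ofReal (div_nonneg (Real.exp_pos _).le hc.le), Finset.prod_div_distrib,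
    ← Real.exp_sum, Finset.sum_neg_distrib, Finset.prod_const, Finset.card_univ, Fintype.card_fin]
  ring

lemma Rnp_pos {p : ℝ} (hp : 1 ≤ p) {n : ℕ} (hn : 1 ≤ n) : 0 < Rnp n p := by
  have hp0 : 0 < p := by linarith
  have hn0 : 0 < (n : ℝ) := by exact_mod_cast hn
  have h₁ := Real.Gamma_pos_of_pos (show 0 < ((n : ℝ) + 2) / p by positivity)
  have h₂ := Real.Gamma_pos_of_pos (show 0 < (n : ℝ) / p by positivity)
  have h₃ := Real.Gamma_pos_of_pos (show 0 < 1 / p by positivity)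
  have h₄ := Real.Gamma_pos_of_pos (show 0 < 3 / p by positivity)
  unfold Rnp
  positivity

open Set in
lemma integral_Ioi_rpow_mul_indicator_Iic {s β R : ℝ} (hs : 0 < s + β) (hR : 0 < R) :
    ∫ r in Ioi (0 : ℝ), r ^ (s - 1) * (Iic R).indicator (fun r ↦ r ^ β) r =
      R ^ (s + β) / (s + β) := by
  have : ∀ r ∈ Ioi (0 : ℝ), r ^ (s - 1) * (Iic R).indicator (fun r ↦ r ^ β) r =
      (Iic R).indicator (fun r ↦ r ^ (s + β - 1)) r := fun r (hr : 0 < r) ↦ by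
    by_cases h : r ∈ Iic R
    · rw [indicator_of_mem h, indicator_of_mem h, ← Real.rpow_add hr]; ring_nf
    · simp [indicator_of_notMem h]
  rw [setIntegral_congr_fun measurableSet_Ioi this, setIntegral_indicator measurableSet_Iic,
    Ioi_inter_Iic, ← intervalIntegral.integral_of_le hR.le, integral_rpow (.inl (by linarith))]
  simp [Real.zero_rpow hs.ne']

lemma lpBall_eq {p : ℝ} (hp : 1 ≤ p) {n : ℕ} (hn : 1 ≤ n) :
    lpBall n p = {x | (∑ i, |x i| ^ p) ^ (1 / p) ≤ Rnp n p} := by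
  ext x
  have hp0 : 0 < p := by linarith
  have hx : 0 ≤ ∑ i, |x i| ^ p := by positivity
  rw [lpBall, Set.mem_ofPred_eq, Set.mem_ofPred_eq, one_div,
    Real.rpow_inv_le_iff_of_pos hx (Rnp_pos hp hn).le hp0]

lemma measurableSet_lpBall (n : ℕ) (p : ℝ) : MeasurableSet (lpBall n p) :=
  measurableSet_le (by fun_prop) measurable_const

open Set in
lemma integral_muNP {p : ℝ} (hp : 1 ≤ p) {n : ℕ} (hn : 1 ≤ n) (β : ℝ) (g : (Fin n → ℝ) → ℝ) :
    ∫ x, (∑ i, |x i| ^ p) ^ (β / p) * g x ∂(muNP n p) =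
      ((volume (lpBall n p))⁻¹).toReal * ∫ x : Fin n → ℝ,
        (Iic (Rnp n p)).indicator (fun r ↦ r ^ β) ((∑ i, |x i| ^ p) ^ (1 / p)) * g x := by
  rw [muNP, integral_smul_measure, ← integral_indicator (measurableSet_lpBall n p), smul_eq_mul]
  congr 2 with x
  rw [lpBall_eq hp hn]
  have hx : 0 ≤ ∑ i, |x i| ^ p := by positivity
  by_cases h : (∑ i, |x i| ^ p) ^ (1 / p) ≤ Rnp n p
  · rw [indicator_of_mem (by exact h), indicator_of_mem (by exact h), ← Real.rpow_mul hx]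
    ring_nf
  · rw [indicator_of_notMem (by exact h), indicator_of_notMem (by exact h), zero_mul]

lemma isProbabilityMeasure_muNP {p : ℝ} (hp : 1 ≤ p) {n : ℕ} (hn : 1 ≤ n) :
    IsProbabilityMeasure (muNP n p) := by
  have hp0 : 0 < p := by linarith
  have hR := Rnp_pos hp hn
  have hRp : 0 < Rnp n p ^ p := by positivity
  have h0 : volume (lpBall n p) ≠ 0 := by
    have ho : IsOpen {x : Fin n → ℝ | ∑ i, |x i| ^ p < Rnp n p ^ p} :=
      isOpen_lt (by fun_prop (disch := simp [hp0.le])) continuous_const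
    have hsub : {x : Fin n → ℝ | ∑ i, |x i| ^ p < Rnp n p ^ p} ⊆ lpBall n p :=
      fun x hx ↦ by
      rw [Set.mem_ofPred_eq] at hx
      exact hx.le
    exact ((ho.measure_pos volume ⟨0, by simpa [Real.zero_rpow hp0.ne'] using hRp⟩).trans_le
      (measure_mono hsub)).ne'
  have htop : volume (lpBall n p) ≠ ⊤ := by
    refine measure_ne_top_of_subset (fun x hx ↦ ?_)
      (measure_closedBall_lt_top (x := (0 : Fin n → ℝ)) (r := Rnp n p)).ne
    rw [mem_closedBall_zero_iff, pi_norm_le_iff_of_nonneg hR.le]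
    intro i
    rw [Real.norm_eq_abs, ← Real.rpow_le_rpow_iff (abs_nonneg _) hR.le hp0]
    exact (Finset.single_le_sum (f := fun i ↦ |x i| ^ p) (fun _ _ ↦ by positivity)
      (Finset.mem_univ i)).trans hx
  constructor
  rw [muNP, Measure.smul_apply, Measure.restrict_apply_univ, smul_eq_mul,
    ENNReal.inv_mul_cancel h0 htop]

lemma integral_lpNorm_rpow_mul_eval_muNP {p : ℝ} (hp : 1 ≤ p) {n d : ℕ} (hn : 1 ≤ n)
    {f : MvPolynomial (Fin n) ℝ} (hf : f.IsHomogeneous d) {β : ℝ} (hβ : -(d : ℝ) ≤ β) :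
    ∫ x, (∑ i, |x i| ^ p) ^ (β / p) * MvPolynomial.eval x f ∂(muNP n p)
      = (((n : ℝ) + d) / ((n : ℝ) + d + β)) * Rnp n p ^ β *
          ∫ x, MvPolynomial.eval x f ∂(muNP n p) := by
  have hn0 : 0 < (n : ℝ) := by exact_mod_cast hn
  have hR := Rnp_pos hp hn
  have hs : 0 < (n : ℝ) + d := by positivity
  have hsβ : 0 < (n : ℝ) + d + β := by linarith
  obtain ⟨K, hK⟩ := exists_integral_lpNorm_mul_eval hp hn hf
  have h0 := integral_muNP hp hn 0 fun x ↦ MvPolynomial.eval x f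
  simp only [zero_div, Real.rpow_zero, one_mul] at h0
  rw [h0, integral_muNP hp hn, hK, integral_Ioi_rpow_mul_indicator_Iic hsβ hR]
  have hK0 := hK ((Set.Iic (Rnp n p)).indicator fun r ↦ r ^ (0 : ℝ))
  rw [integral_Ioi_rpow_mul_indicator_Iic (by linarith) hR] at hK0
  simp only [Real.rpow_zero, add_zero] at hK0
  rw [hK0, Real.rpow_add hR]
  field_simp

lemma integral_lpNorm_rpow_mul_eval_gammaPn {p : ℝ} (hp : 1 ≤ p) {n d : ℕ} (hn : 1 ≤ n)
    {f : MvPolynomial (Fin n) ℝ} (hf : f.IsHomogeneous d) {β : ℝ} (hβ : -(d : ℝ) ≤ β) :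
    ∫ x, (∑ i, |x i| ^ p) ^ (β / p) * MvPolynomial.eval x f ∂(gammaPn p n)
      = (Real.Gamma (((n : ℝ) + d + β) / p) / Real.Gamma (((n : ℝ) + d) / p)) *
          ∫ x, MvPolynomial.eval x f ∂(gammaPn p n) := by
  have hp0 : 0 < p := by linarith
  have hn0 : 0 < (n : ℝ) := by exact_mod_cast hn
  have hs : 0 < (n : ℝ) + d := by positivity
  obtain ⟨K, hK⟩ := exists_integral_lpNorm_mul_eval hp hn hf
  have radial : ∀ b : ℝ, 0 < (n : ℝ) + d + b →
      ∫ x : Fin n → ℝ, Real.exp (-∑ i, |x i| ^ p) *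
        ((∑ i, |x i| ^ p) ^ (b / p) * MvPolynomial.eval x f) =
      K * ((1 / p) * Real.Gamma (((n : ℝ) + d + b) / p)) := fun b hb ↦ by
    have hradial := _root_.integral_rpow_mul_exp_neg_rpow hp0
      (show -1 < (n : ℝ) + d + b - 1 by linarith)
    rw [sub_add_cancel] at hradial
    rw [← hradial]
    convert hK fun r ↦ r ^ b * Real.exp (-r ^ p) using 2
    · ext x
      have hx : 0 ≤ ∑ i, |x i| ^ p := by positivity
      rw [← Real.rpow_mul hx, ← Real.rpow_mul hx, one_div_mul_cancel hp0.ne', Real.rpow_one,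
        one_div_mul_eq_div]
      ring
    · refine setIntegral_congr_fun measurableSet_Ioi fun r (hr : 0 < r) ↦ ?_
      rw [← mul_assoc, ← Real.rpow_add hr]
      ring_nf
  have h0 := radial 0 (by linarith)
  simp only [zero_div, Real.rpow_zero, one_mul, add_zero] at h0
  have hΓ := (Real.Gamma_pos_of_pos (div_pos hs hp0)).ne'
  rw [integral_gammaPn hp0, integral_gammaPn hp0, radial β (by linarith), h0]
  field_simp

/-- Lemma 2.3: integrating out powers of the `L^p` norm against a degree-`d` homogeneous
polynomial, both for the uniform measure on the isotropic `L^p` ball and for the `p`-Gaussian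
product measure.  Here `‖x‖_p^β` is written as `(Σ |x_i|^p)^{β/p}`. -/
theorem integrate_out_lp_norm (p : ℝ) (hp : 1 ≤ p) (n d : ℕ) (hn : 1 ≤ n)
    (f : MvPolynomial (Fin n) ℝ) (hf : f.IsHomogeneous d) (β : ℝ) (hβ : -(d : ℝ) ≤ β) :
    (∫ x, (∑ i, |x i| ^ p) ^ (β / p) * MvPolynomial.eval x f ∂(muNP n p)
      = (((n : ℝ) + d) / ((n : ℝ) + d + β)) * Rnp n p ^ β *
          ∫ x, MvPolynomial.eval x f ∂(muNP n p)) ∧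
    (0 ≤ β →
      ∫ x, (∑ i, |x i| ^ p) ^ (β / p) ∂(muNP n p)
        = ((n : ℝ) / ((n : ℝ) + β)) * Rnp n p ^ β) ∧
    (∫ x, (∑ i, |x i| ^ p) ^ (β / p) * MvPolynomial.eval x f ∂(gammaPn p n)
      = (Real.Gamma (((n : ℝ) + d + β) / p) / Real.Gamma (((n : ℝ) + d) / p)) *
          ∫ x, MvPolynomial.eval x f ∂(gammaPn p n)) := by
  refine ⟨integral_lpNorm_rpow_mul_eval_muNP hp hn hf hβ, fun hβ0 ↦ ?_,
    integral_lpNorm_rpow_mul_eval_gammaPn hp hn hf hβ⟩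
  have := isProbabilityMeasure_muNP hp hn
  simpa using integral_lpNorm_rpow_mul_eval_muNP hp hn
    (MvPolynomial.isHomogeneous_one (Fin n) ℝ) (by simpa using hβ0)
end
end
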